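/- Let s ≥ 1 and t ≥ 5 be integers and set n = 2(2^s − 1) + 2^s(2^t − 1) = 2^{s+t} + 2^s − 2. Then the dimension over F_2 of the subspace of GL_4(F_2)-invariants of Q_n equals 1 if s ∈ {1, 2}, equals 2 if s ∈ {3, 4}, and equals 3 if s ≥ 5. -/

import Mathlib

/-!
Common setup: the polynomial algebra `P_4 = F_2[x_1,x_2,x_3,x_4]` (variables `X 0, ..., X 3`),
the Steenrod action, hit polynomials, the cohit spaces `Q_n`, and the (induced) actions of
`GL_4(F_2)` and of the symmetric group `Σ_4` on `Q_n`.
-/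
open MvPolynomial
noncomputable section
abbrev kk : Type := ZMod 2
abbrev P4 : Type := MvPolynomial (Fin 4) kk
/-- The total Steenrod square: the algebra endomorphism of `P4` with `X i ↦ X i + (X i)^2`.
For `g` homogeneous of degree `d`, `Sq^t g` is the degree-`d+t` homogeneous component
of `sqTotal g`. -/
def sqTotal : P4 →ₐ[kk] P4 := aeval fun i => X i + X i ^ 2
/-- The homogeneous polynomials of degree `n`, i.e. `(P_4)_n`, as a submodule. -/
def homog (n : ℕ) : Submodule kk P4 := homogeneousSubmodule (Fin 4) kk n
/-- The subspace `H_n` of hit polynomials of degree `n`: it is spanned by the elements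
`Sq^{n-d}(g) = (sqTotal g)_n` for `g` homogeneous of degree `d < n`, i.e. by all
`∑_{t>0} Sq^t(f_t)` with `f_t ∈ (P_4)_{n-t}`. -/
def hitSub (n : ℕ) : Submodule kk P4 :=
  Submodule.span kk
    {p | ∃ d, d < n ∧ ∃ g ∈ homog d, p = homogeneousComponent n (sqTotal g)}
/-- The cohit space `Q_n = (P_4)_n / H_n`. -/
abbrev Qn (n : ℕ) :=
  ↥(homog n) ⧸ ((hitSub n).comap (homog n).subtype)
/-- Projection of a polynomial onto its degree-`n` part, landing in `homog n`. -/
def toHomog (n : ℕ) : P4 →ₗ[kk] homog n :=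
  (homogeneousComponent n).codRestrict (homog n) fun f => homogeneousComponent_mem n f
/-- The class in `Q_n` of (the degree-`n` component of) a polynomial.  For `f`
homogeneous of degree `n` this is the class `[f]` of `f`. -/
def Qmk (n : ℕ) : P4 →ₗ[kk] Qn n :=
  ((hitSub n).comap (homog n).subtype).mkQ.comp (toHomog n)
/-- Substitution action of a matrix `M`: the algebra endomorphism `X i ↦ ∑ j M i j • X j`. -/
def substM (M : Matrix (Fin 4) (Fin 4) kk) : P4 →ₐ[kk] P4 :=
  aeval fun i => ∑ j, M i j • X j
/-- The set of invertible `4 × 4` matrices over `F_2`, i.e. `GL_4(F_2)`. -/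
def glSet : Set (Matrix (Fin 4) (Fin 4) kk) := {M | IsUnit M}
/-- The set of permutation matrices, i.e. `Σ_4 ⊆ GL_4(F_2)`. -/
def permSet : Set (Matrix (Fin 4) (Fin 4) kk) :=
  {M | ∃ σ : Equiv.Perm (Fin 4), M = σ.toPEquiv.toMatrix}
/-- Homogeneous polynomials of degree `n` whose class in `Q_n` is invariant under every
element of `G` (the action on classes being induced by `substM`): for every `M ∈ G`,
`M·f - f` is hit. -/
def invPre (n : ℕ) (G : Set (Matrix (Fin 4) (Fin 4) kk)) : Submodule kk P4 :=
  homog n ⊓ ⨅ M ∈ G, (hitSub n).comap ((substM M).toLinearMap - LinearMap.id)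
/-- The subspace `(Q_n)^G` of `G`-invariant classes in `Q_n`. -/
def QInv (n : ℕ) (G : Set (Matrix (Fin 4) (Fin 4) kk)) : Submodule kk (Qn n) :=
  (invPre n G).map (Qmk n)
/-- The `Σ_4`-submodule of `Q_n` generated by the classes of the polynomials in `S`:
the span of the classes of all the permuted polynomials `σ · f`, `σ ∈ Σ_4`, `f ∈ S`. -/
def permSpan (n : ℕ) (S : Set P4) : Submodule kk (Qn n) :=
  Submodule.span kk
    {c | ∃ σ : Equiv.Perm (Fin 4), ∃ f ∈ S, c = Qmk n (rename (⇑σ) f)}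
def xp (E : Fin 4 → ℕ) : P4 := ∏ i, X i ^ E i
def SS : P4 →ₐ[kk] Polynomial P4 :=
  aeval fun i => Polynomial.C (X i) + Polynomial.C (X i ^ 2) * Polynomial.X
def Sq (k : ℕ) : P4 →ₗ[kk] P4 :=
  ((Polynomial.lcoeff P4 k).restrictScalars kk).comp SS.toLinearMap
theorem sq_apply (k : ℕ) (f : P4) : Sq k f = (SS f).coeff k := rfl
theorem xp_eq (E : Fin 4 → ℕ) : xp E = monomial (Finsupp.equivFunOnFinite.symm E) 1 := by
  rw [monomial_eq, xp, Finsupp.prod_fintype _ _ (by simp)]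
  simp
theorem xp_add (E F : Fin 4 → ℕ) : xp (E + F) = xp E * xp F := by
  simp [xp, pow_add, Finset.prod_mul_distrib]
theorem xp_pow (E : Fin 4 → ℕ) (k : ℕ) : xp (k • E) = xp E ^ k := by
  simp [xp, ← Finset.prod_pow, ← pow_mul, mul_comm]
theorem xp_zero : xp 0 = 1 := by simp [xp]
theorem SS_xp (E : Fin 4 → ℕ) : SS (xp E) =
    ∑ e ∈ Fintype.piFinset (fun i => Finset.range (E i + 1)),
      Polynomial.monomial (∑ i, e i) (((∏ i, (E i).choose (e i) : ℕ) : P4) * xp (E + e)) := by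
  have h1 : ∀ (a : P4) (m : ℕ), (Polynomial.C a + Polynomial.C (a^2) * Polynomial.X)^m
      = ∑ j ∈ Finset.range (m+1), Polynomial.monomial j ((m.choose j : P4) * a^(m+j)) := by
    intro a m
    rw [add_comm, add_pow]
    refine Finset.sum_congr rfl fun j hj => ?_
    have hj' : j ≤ m := by simpa [Nat.lt_succ_iff] using hj
    rw [← Polynomial.C_mul_X_pow_eq_monomial, mul_pow]
    have : a ^ (m + j) = (a^2)^j * a^(m-j) := by
      rw [← pow_mul, ← pow_add]; congr 1; omega
    rw [this]
    simp only [Polynomial.C_mul, Polynomial.C_pow, map_natCast]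
    ring
  have : SS (xp E) = ∏ i, (Polynomial.C (X i : P4) + Polynomial.C (X i ^ 2) * Polynomial.X) ^ E i := by
    simp [xp, SS]
  rw [this]
  simp_rw [h1]
  rw [Finset.prod_univ_sum]
  refine Finset.sum_congr rfl fun e he => ?_
  have : ∀ (s : Finset (Fin 4)) (a : Fin 4 → ℕ) (b : Fin 4 → P4),
      ∏ i ∈ s, Polynomial.monomial (a i) (b i) = Polynomial.monomial (∑ i ∈ s, a i) (∏ i ∈ s, b i) := by
    intro s a b
    induction s using Finset.induction_on with
    | empty => simp
    | insert i s hi ih => rw [Finset.prod_insert hi, ih, Polynomial.monomial_mul_monomial,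
        Finset.sum_insert hi, Finset.prod_insert hi]
  rw [this, Finset.prod_mul_distrib]
  simp [xp]
theorem sq_xp (k : ℕ) (E : Fin 4 → ℕ) : Sq k (xp E) =
    ∑ e ∈ Fintype.piFinset (fun i => Finset.range (E i + 1)),
      if ∑ i, e i = k then ((∏ i, (E i).choose (e i) : ℕ) : P4) * xp (E + e) else 0 := by
  rw [sq_apply, SS_xp, Polynomial.finsetSum_coeff]
  refine Finset.sum_congr rfl fun e he => ?_
  rw [Polynomial.coeff_monomial]
theorem xp_homog (E : Fin 4 → ℕ) : (xp E).IsHomogeneous (∑ i, E i) := by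
  rw [xp_eq]
  apply isHomogeneous_monomial
  simp [Finsupp.degree_eq_sum]
theorem sq_homog (k : ℕ) (E : Fin 4 → ℕ) : (Sq k (xp E)).IsHomogeneous (∑ i, E i + k) := by
  rw [sq_xp]
  apply IsHomogeneous.sum
  intro e he
  split_ifs with h
  · have h2 := xp_homog (E + e)
    simp only [Pi.add_apply, Finset.sum_add_distrib, h] at h2
    have := (isHomogeneous_C (Fin 4) ((∏ i, (E i).choose (e i) : ℕ) : kk)).mul h2
    simpa using this
  · exact isHomogeneous_zero _ _ _
theorem sqTotal_eq (f : P4) : sqTotal f = (SS f).eval 1 := by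
  have : sqTotal = ((Polynomial.aeval (R := P4) (1 : P4)).restrictScalars kk).comp SS := by
    apply MvPolynomial.algHom_ext
    intro i
    simp [sqTotal, SS]
  rw [this]; simp
theorem comp_sqTotal_xp (n : ℕ) (E : Fin 4 → ℕ) (h : ∑ i, E i ≤ n) :
    homogeneousComponent n (sqTotal (xp E)) = Sq (n - ∑ i, E i) (xp E) := by
  rw [sqTotal_eq, Polynomial.eval_eq_sum_range]
  simp only [one_pow, mul_one, map_sum]
  rw [show (∑ x ∈ Finset.range ((SS (xp E)).natDegree + 1),
      homogeneousComponent n ((SS (xp E)).coeff x)) = ∑ x ∈ Finset.range ((SS (xp E)).natDegree + 1),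
      if x = n - ∑ i, E i then Sq (n - ∑ i, E i) (xp E) else 0 from ?_]
  · rw [Finset.sum_ite_eq']
    split_ifs with h1
    · rfl
    · rw [sq_apply, Polynomial.coeff_eq_zero_of_natDegree_lt]
      simp at h1; omega
  · refine Finset.sum_congr rfl fun x _ => ?_
    have h2 := sq_homog x E
    rw [sq_apply] at h2
    rw [homogeneousComponent_of_mem h2]
    split_ifs with h3 h4 h4
    · rw [h4]; rfl
    · omega
    · omega
    · rfl
theorem homog_le_span (n : ℕ) (f : P4) (hf : f ∈ homog n) :
    f ∈ Submodule.span kk {p | ∃ E : Fin 4 → ℕ, ∑ i, E i = n ∧ p = xp E} := by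
  rw [f.as_sum]
  apply Submodule.sum_mem
  intro m hm
  have : monomial m (coeff m f) = (coeff m f) • xp m := by
    rw [xp_eq, smul_monomial]; simp
  rw [this]
  apply Submodule.smul_mem
  apply Submodule.subset_span
  refine ⟨m, ?_, rfl⟩
  have h1 : f.IsHomogeneous n := hf
  have := h1 (mem_support_iff.mp hm)
  rw [← this]
  simp [Finsupp.weight_apply, Finsupp.sum_fintype]
def HH : Submodule kk P4 := Submodule.span kk {p | ∃ k E, 0 < k ∧ p = Sq k (xp E)}
theorem kk_zero_or_one (a : kk) : a = 0 ∨ a = 1 := by revert a; decide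
theorem xp_span : (⊤ : Submodule kk P4) ≤ Submodule.span kk (Set.range xp) := by
  intro f _
  rw [f.as_sum]
  apply Submodule.sum_mem
  intro m hm
  have : monomial m (coeff m f) = (coeff m f) • xp m := by
    rw [xp_eq, smul_monomial]; simp
  rw [this]
  exact Submodule.smul_mem _ _ (Submodule.subset_span ⟨m, rfl⟩)
theorem xp_induction {p : P4 → Prop} (h0 : p 0) (hx : ∀ E, p (xp E))
    (ha : ∀ f g, p f → p g → p (f + g)) (f : P4) : p f := by
  have := xp_span (Submodule.mem_top (x := f))
  induction this using Submodule.span_induction with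
  | mem x h => obtain ⟨E, rfl⟩ := h; exact hx E
  | zero => exact h0
  | add x y _ _ h1 h2 => exact ha x y h1 h2
  | smul a x _ h => rcases kk_zero_or_one a with rfl | rfl <;> simpa using by assumption
theorem Sq_mem_HH (k : ℕ) (hk : 0 < k) (f : P4) : Sq k f ∈ HH := by
  induction f using xp_induction with
  | h0 => simp
  | hx E => exact Submodule.subset_span ⟨k, E, hk, rfl⟩
  | ha f g h1 h2 => rw [map_add]; exact Submodule.add_mem _ h1 h2
theorem separate (n : ℕ) (f : P4) (hf : f ∈ homog n) (hn : f ∉ hitSub n) :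
    ∃ l : P4 →ₗ[kk] kk, l f ≠ 0 ∧ HH ≤ LinearMap.ker l ∧
      ∀ E : Fin 4 → ℕ, ∑ i, E i ≠ n → l (xp E) = 0 := by
  obtain ⟨l0, h1, h2⟩ := Submodule.exists_le_ker_of_notMem hn
  have key : ∀ E : Fin 4 → ℕ, ∑ i, E i ≠ n → homogeneousComponent n (xp E) = 0 := by
    intro E hE
    rw [homogeneousComponent_of_mem (xp_homog E), if_neg (Ne.symm hE)]
  refine ⟨l0.comp (homogeneousComponent n), ?_, ?_, ?_⟩
  · rw [LinearMap.comp_apply, homogeneousComponent_of_mem (n := n) hf, if_pos rfl]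
    exact h1
  · rw [HH, Submodule.span_le]
    rintro _ ⟨k, E, hk, rfl⟩
    simp only [SetLike.mem_coe, LinearMap.mem_ker, LinearMap.comp_apply]
    rw [homogeneousComponent_of_mem (sq_homog k E)]
    split_ifs with h
    · apply h2
      apply Submodule.subset_span
      refine ⟨∑ i, E i, by omega, xp E, xp_homog E, ?_⟩
      rw [comp_sqTotal_xp _ _ (by omega)]
      rw [show n - ∑ i, E i = k by omega]
    · simp
  · intro E hE
    rw [LinearMap.comp_apply, key E hE, map_zero]
theorem hit_le_HH (n : ℕ) : hitSub n ≤ HH := by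
  rw [hitSub, Submodule.span_le]
  rintro _ ⟨d, hd, g, hg, rfl⟩
  have := homog_le_span d g hg
  clear hg
  induction this using Submodule.span_induction with
  | mem x h =>
    obtain ⟨E, hE, rfl⟩ := h
    rw [comp_sqTotal_xp _ _ (by omega)]
    exact Sq_mem_HH _ (by omega) _
  | zero => simp
  | add x y _ _ h1 h2 =>
    rw [map_add, map_add]; exact Submodule.add_mem _ h1 h2
  | smul a x _ h =>
    rw [map_smul, map_smul]; exact Submodule.smul_mem _ _ h
def wt (E : Fin 4 → ℕ) : ℕ := ∑ i, E i % 2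
def ltw : (Fin 4 → ℕ) → List ℕ → Prop
  | _, [] => False
  | E, a :: w => wt E < a ∨ (wt E = a ∧ ltw (fun i => E i / 2) w)
def Low (w : List ℕ) : Submodule kk P4 := Submodule.span kk {p | ∃ E, ltw E w ∧ p = xp E}
def NN (w : List ℕ) : Submodule kk P4 := HH ⊔ Low w
theorem low_xp {E : Fin 4 → ℕ} {w : List ℕ} (h : ltw E w) : xp E ∈ Low w :=
  Submodule.subset_span ⟨E, h, rfl⟩
theorem ltw_shift (u w : List ℕ) : ∀ (E F : Fin 4 → ℕ), ltw E u →
    ltw (E + (2 ^ u.length) • F) (u ++ w) := by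
  induction u with
  | nil => intro E F h; exact h.elim
  | cons a u ih =>
    intro E F h
    have h1 : wt (E + (2 ^ (a :: u).length) • F) = wt E := by
      unfold wt
      refine Finset.sum_congr rfl fun i _ => ?_
      simp only [List.length_cons, pow_succ, Pi.add_apply, Pi.smul_apply, smul_eq_mul]
      rw [mul_comm (2 ^ u.length), mul_assoc]; omega
    have h2 : (fun i => (E + (2 ^ (a :: u).length) • F) i / 2)
        = (fun i => E i / 2) + (2 ^ u.length) • F := by
      funext i
      simp only [List.length_cons, pow_succ, Pi.add_apply, Pi.smul_apply, smul_eq_mul]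
      rw [mul_comm (2 ^ u.length), mul_assoc]; omega
    simp only [List.cons_append, ltw]
    rw [h1, h2]
    rcases h with h | ⟨h, h'⟩
    · exact Or.inl h
    · exact Or.inr ⟨h, ih _ _ h'⟩
theorem wt_add2 (E F : Fin 4 → ℕ) : wt (E + 2 • F) = wt E := by
  unfold wt
  refine Finset.sum_congr rfl fun i _ => ?_
  simp only [Pi.add_apply, Pi.smul_apply, smul_eq_mul]; omega
theorem ltw_cons {c E : Fin 4 → ℕ} (hc : ∀ i, c i ≤ 1) {w : List ℕ} (h : ltw E w) :
    ltw (c + 2 • E) (wt c :: w) := by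
  refine Or.inr ⟨wt_add2 _ _, ?_⟩
  have : (fun i => (c + 2 • E) i / 2) = E := by
    funext i
    have := hc i
    simp only [Pi.add_apply, Pi.smul_apply, smul_eq_mul]; omega
  rwa [this]
theorem Sq_zero (f : P4) : Sq 0 f = f := by
  rw [sq_apply, Polynomial.coeff_zero_eq_eval_zero]
  have : ((Polynomial.aeval (R := P4) (0 : P4)).restrictScalars kk).comp SS = AlgHom.id kk P4 := by
    apply MvPolynomial.algHom_ext
    intro i
    simp [SS]
  have h2 := congrArg (fun g => g f) this
  simpa using h2
theorem coeff_sq (p : Polynomial P4) (j : ℕ) :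
    (p ^ 2).coeff j = if 2 ∣ j then (p.coeff (j / 2)) ^ 2 else 0 := by
  have : ExpChar P4 2 := ExpChar.prime Nat.prime_two
  rw [← Polynomial.map_frobenius_expand, Polynomial.coeff_map, Polynomial.coeff_expand (by norm_num)]
  split_ifs <;> simp [frobenius_def]
theorem coeff_pow2 (p : Polynomial P4) (r : ℕ) : ∀ j, j < 2 ^ r →
    (p ^ (2 ^ r)).coeff j = if j = 0 then (p.coeff 0) ^ (2 ^ r) else 0 := by
  induction r with
  | zero => intro j hj; have : j = 0 := by simpa using hj
            subst this; simp
  | succ r ih =>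
    intro j hj
    rw [pow_succ 2 r, pow_mul, coeff_sq]
    by_cases h : 2 ∣ j
    · rw [if_pos h, ih _ (by rw [pow_succ] at hj; omega)]
      by_cases h0 : j = 0
      · subst h0; simp [pow_mul]
      · rw [if_neg (by omega), if_neg h0]; simp
    · rw [if_neg h, if_neg (by rintro rfl; simp at h)]
theorem Sq_mul_pow (r k : ℕ) (hk : k < 2 ^ r) (g Y : P4) :
    Sq k (g * Y ^ (2 ^ r)) = Sq k g * Y ^ (2 ^ r) := by
  rw [sq_apply, map_mul, map_pow, Polynomial.coeff_mul]
  rw [Finset.sum_eq_single (k, 0)]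
  · rw [coeff_pow2 _ _ _ (by positivity), if_pos rfl, ← sq_apply, ← sq_apply, Sq_zero]
  · rintro ⟨i, j⟩ hij hne
    have hij' : i + j = k := by simpa using hij
    rw [coeff_pow2 _ _ _ (by dsimp; omega), if_neg, mul_zero]
    rintro h; dsimp at h; apply hne; ext <;> simp <;> omega
  · intro h; simp at h
theorem low_mul_sq (a : ℕ) (w : List ℕ) (E : Fin 4 → ℕ) (hE : wt E < a) (q : P4) :
    xp E * q ^ 2 ∈ Low (a :: w) := by
  induction q using xp_induction with
  | h0 => simp
  | hx F =>
    rw [← xp_pow, ← xp_add]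
    exact low_xp (Or.inl (by rw [wt_add2]; exact hE))
  | ha f g h1 h2 =>
    rw [CharTwo.add_sq, mul_add]; exact Submodule.add_mem _ h1 h2
theorem prefix_NN {c : Fin 4 → ℕ} (hc : ∀ i, c i ≤ 1) {w : List ℕ} {h : P4} (hh : h ∈ NN w) :
    xp c * h ^ 2 ∈ NN (wt c :: w) := by
  obtain ⟨a, ha, b, hb, rfl⟩ := Submodule.mem_sup.mp hh
  rw [CharTwo.add_sq, mul_add]
  refine Submodule.add_mem _ ?_ ?_
  · clear hh
    unfold HH at ha
    induction ha using Submodule.span_induction with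
    | mem x hx =>
      obtain ⟨k, E, hk, rfl⟩ := hx
      have h1 : Sq (2 * k) (xp c * xp E ^ 2) = xp c * (Sq k (xp E)) ^ 2 +
          ∑ p ∈ (Finset.HasAntidiagonal.antidiagonal (2 * k)).erase (0, 2 * k),
            Sq p.1 (xp c) * ((SS (xp E)) ^ 2).coeff p.2 := by
        rw [sq_apply, map_mul, map_pow, Polynomial.coeff_mul,
          ← Finset.add_sum_erase _ _ (show (0, 2 * k) ∈ Finset.HasAntidiagonal.antidiagonal (2 * k) by simp)]
        congr 1
        dsimp only
        rw [coeff_sq, if_pos (by simp), ← sq_apply, Sq_zero]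
        congr 3; omega
      have h2 : xp c * (Sq k (xp E)) ^ 2 = Sq (2 * k) (xp c * xp E ^ 2) -
          ∑ p ∈ (Finset.HasAntidiagonal.antidiagonal (2 * k)).erase (0, 2 * k),
            Sq p.1 (xp c) * ((SS (xp E)) ^ 2).coeff p.2 := by rw [h1]; ring
      rw [h2]
      refine Submodule.sub_mem _ (Submodule.mem_sup_left (Sq_mem_HH _ (by omega) _)) ?_
      refine Submodule.mem_sup_right (Submodule.sum_mem _ ?_)
      rintro ⟨i, j⟩ hij
      simp only [Finset.mem_erase, Finset.HasAntidiagonal.mem_antidiagonal, ne_eq, Prod.mk.injEq] at hij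
      dsimp only
      rw [coeff_sq]
      split_ifs with hj
      · rw [sq_xp, Finset.sum_mul]
        refine Submodule.sum_mem _ fun e he => ?_
        split_ifs with hs
        · by_cases hz : ((∏ i, (c i).choose (e i) : ℕ) : P4) = 0
          · rw [hz]; simp
          · have hce : ∀ i, e i ≤ c i := by
              intro i
              by_contra hlt
              apply hz
              rw [Finset.prod_eq_zero (Finset.mem_univ i) (Nat.choose_eq_zero_of_lt (not_le.mp hlt))]
              simp
            have hlt : wt (c + e) < wt c := by
              have h5 : wt (c + e) + i = wt c := by
                unfold wt
                rw [← hs, ← Finset.sum_add_distrib]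
                refine Finset.sum_congr rfl fun x _ => ?_
                have := hc x; have := hce x
                simp only [Pi.add_apply]; omega
              omega
            have := low_mul_sq (wt c) w (c + e) hlt (Polynomial.coeff (SS (xp E)) (j / 2))
            rw [mul_assoc, show ((∏ i, (c i).choose (e i) : ℕ) : P4) =
              C ((∏ i, (c i).choose (e i) : ℕ) : kk) by simp, ← smul_eq_C_mul]
            exact Submodule.smul_mem _ _ this
        · simp
      · simp
    | zero => simp
    | add x y _ _ h1 h2 => rw [CharTwo.add_sq, mul_add]; exact Submodule.add_mem _ h1 h2
    | smul t x _ h =>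
      rw [smul_pow, mul_smul_comm]; exact Submodule.smul_mem _ _ h
  · clear hh
    unfold Low at hb
    refine Submodule.mem_sup_right ?_
    induction hb using Submodule.span_induction with
    | mem x hx =>
      obtain ⟨E, hE, rfl⟩ := hx
      rw [← xp_pow, ← xp_add]
      exact low_xp (ltw_cons hc hE)
    | zero => simp
    | add x y _ _ h1 h2 => rw [CharTwo.add_sq, mul_add]; exact Submodule.add_mem _ h1 h2
    | smul t x _ h =>
      rw [smul_pow, mul_smul_comm]; exact Submodule.smul_mem _ _ h
def cb (c : ℕ) : Fin 4 → ℕ := fun i => c / 2 ^ (i : ℕ) % 2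
def ex : List ℕ → Fin 4 → ℕ
  | [] => 0
  | c :: l => cb c + 2 • ex l
def mono (l : List ℕ) : P4 := xp (ex l)
def pc (c : ℕ) : ℕ := c % 2 + c / 2 % 2 + c / 4 % 2 + c / 8 % 2
theorem cb_le (c : ℕ) (i : Fin 4) : cb c i ≤ 1 := by unfold cb; omega
theorem wt_cb (c : ℕ) : wt (cb c) = pc c := by
  simp [wt, cb, pc, Fin.sum_univ_four]
theorem ex_append (l m : List ℕ) : ex (l ++ m) = ex l + 2 ^ l.length • ex m := by
  induction l with
  | nil => simp [ex]
  | cons c l ih =>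
    simp only [List.cons_append, ex, ih, List.length_cons, pow_succ]
    rw [smul_add, add_assoc, ← mul_smul, mul_comm]
theorem mono_cons (c : ℕ) (l : List ℕ) : mono (c :: l) = xp (cb c) * mono l ^ 2 := by
  rw [mono, ex, xp_add, xp_pow]; rfl
theorem mono_sum_prefix (w : List ℕ) (L : List (List ℕ))
    (h : (L.map mono).sum ∈ NN w) : ∀ P : List ℕ,
    (L.map fun t => mono (P ++ t)).sum ∈ NN (P.map pc ++ w) := by
  intro P
  induction P with
  | nil => simpa using h
  | cons c P ih =>
    have h2 := prefix_NN (cb_le c) ih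
    rw [wt_cb] at h2
    have h3 : ∀ M : List (List ℕ), (M.map fun t => mono (c :: P ++ t)).sum
        = xp (cb c) * (M.map fun t => mono (P ++ t)).sum ^ 2 := by
      intro M
      induction M with
      | nil => simp
      | cons t M ih =>
        simp only [List.map_cons, List.sum_cons, CharTwo.add_sq, mul_add, ih]
        rw [List.cons_append, mono_cons]
    rw [h3]
    exact h2
def xl : List (Fin 4) → List ℕ → P4
  | v :: vs, a :: g => X v ^ a * xl vs g
  | _, _ => 1
def od (n k : ℕ) : Bool := Nat.land n k == k
theorem od_spec (f : ℕ) : ∀ n k, n < 2 ^ f → (n.choose k) % 2 = if od n k then 1 else 0 := by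
  induction f with
  | zero =>
    intro n k h
    have : n = 0 := by simpa using h
    subst this
    cases k <;> simp [od]
  | succ f ih =>
    intro n k h
    have h1 : n.choose k ≡ (n % 2).choose (k % 2) * (n / 2).choose (k / 2) [MOD 2] :=
      have : Fact (Nat.Prime 2) := ⟨Nat.prime_two⟩
      Choose.choose_modEq_choose_mod_mul_choose_div_nat
    unfold Nat.ModEq at h1
    rw [h1, Nat.mul_mod, ih (n / 2) (k / 2) (by rw [pow_succ] at h; omega)]
    have ho : od n k = ((Nat.ble (k % 2) (n % 2)) && od (n / 2) (k / 2)) := by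
      have e1 : (n &&& k) / 2 = n / 2 &&& k / 2 := Nat.and_div_two
      have e2 : (n &&& k) % 2 = n % 2 &&& k % 2 := by
        simpa using Nat.and_mod_two_pow (n := 1) (a := n) (b := k)
      rw [Bool.eq_iff_iff]
      simp only [od, beq_iff_eq, Bool.and_eq_true, Nat.ble_eq]
      change (n &&& k) = k ↔ _ ∧ (n / 2 &&& k / 2) = k / 2
      rw [← e1]
      clear e1 h1 ih h
      generalize (n &&& k) = x at e2 ⊢
      rcases Nat.mod_two_eq_zero_or_one n with hn | hn <;>
      rcases Nat.mod_two_eq_zero_or_one k with hk | hk <;> rw [hn, hk] at e2 <;> rw [hn, hk] <;>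
        norm_num at e2 ⊢ <;> omega
    rw [ho]
    rcases Nat.mod_two_eq_zero_or_one n with hn | hn <;>
    rcases Nat.mod_two_eq_zero_or_one k with hk | hk <;> rw [hn, hk] <;>
    by_cases h2 : od (n / 2) (k / 2) <;> simp [h2]
def sqv : ℕ → List ℕ → List (List ℕ)
  | k, [] => if k == 0 then [[]] else []
  | k, a :: g => (List.range (k + 1)).flatMap fun i =>
      if od a i then (sqv (k - i) g).map (fun m => (a + i) :: m) else []
theorem sum_fm {α : Type*} (L : List α) (f : α → List P4) :
    (L.flatMap f).sum = (L.map fun a => (f a).sum).sum := by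
  induction L with
  | nil => simp
  | cons a L ih => simp [ih]
theorem SS_Xpow (v : Fin 4) (a i : ℕ) : (SS (X v ^ a)).coeff i = ((a.choose i : ℕ) : P4) * X v ^ (a + i) := by
  have h : SS (X v ^ a) = (Polynomial.C (X v : P4) + Polynomial.C (X v ^ 2) * Polynomial.X) ^ a := by
    simp [SS]
  rw [h]
  have : (Polynomial.C (X v : P4) + Polynomial.C (X v ^ 2) * Polynomial.X) =
     Polynomial.C (X v) * (1 + Polynomial.C (X v) * Polynomial.X) := by
    rw [mul_add, mul_one, ← mul_assoc, ← Polynomial.C_mul, pow_two]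
  rw [this, mul_pow, ← Polynomial.C_pow, Polynomial.coeff_C_mul]
  have h2 : (1 + Polynomial.C (X v : P4) * Polynomial.X) ^ a
      = ((1 + Polynomial.X) ^ a : Polynomial P4).comp (Polynomial.C (X v) * Polynomial.X) := by simp
  rw [h2, Polynomial.comp_C_mul_X_coeff, Polynomial.coeff_one_add_X_pow]
  ring
theorem sqv_sound : ∀ (g : List ℕ) (vs : List (Fin 4)) (k : ℕ), (∀ a ∈ g, a < 32) →
    g.length ≤ vs.length → Sq k (xl vs g) = ((sqv k g).map (xl vs)).sum := by
  intro g
  induction g with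
  | nil =>
    intro vs k _ _
    have h1 : xl vs [] = 1 := by cases vs <;> rfl
    rw [h1, sq_apply, map_one, Polynomial.coeff_one, sqv]
    by_cases h : k = 0
    · subst h; simp [h1]
    · simp [h]
  | cons a g ih =>
    intro vs k hg hl
    cases vs with
    | nil => simp at hl
    | cons v vs =>
      rw [xl, sq_apply, map_mul, Polynomial.coeff_mul,
        Finset.Nat.sum_antidiagonal_eq_sum_range_succ_mk, sqv]
      have hr : ∀ (n : ℕ) (f : ℕ → P4), ∑ i ∈ Finset.range n, f i = ((List.range n).map f).sum := by
        intro n f; rfl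
      rw [hr, List.map_flatMap, sum_fm]
      congr 1
      refine List.map_congr_left fun i _ => ?_
      dsimp only
      have h2 := od_spec 5 a i (hg a (by simp))
      have h3 : ((a.choose i : ℕ) : P4) = if od a i then 1 else 0 := by
        have : ((a.choose i : ℕ) : P4) = ((a.choose i % 2 : ℕ) : P4) := by
          rw [← CharP.cast_eq_mod]
        rw [this, h2]; split_ifs <;> simp
      rw [SS_Xpow, h3, ← sq_apply, ih vs (k - i) (fun b hb => hg b (by simp [hb])) (by simpa using hl)]
      split_ifs with h4
      · rw [one_mul, List.map_map, ← List.sum_map_mul_left]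
        rfl
      · simp
def gx (g : List ℕ) : Fin 4 → ℕ := fun i => g.getD i 0
theorem xl_eq (g : List ℕ) (h : g.length = 4) : xl [0, 1, 2, 3] g = xp (gx g) := by
  match g, h with
  | [a, b, c, d], _ => simp [xl, xp, gx, Fin.prod_univ_four, mul_assoc]
def ltb : List ℕ → List ℕ → Bool
  | _, [] => false
  | g, a :: w => let s := (g.map (· % 2)).sum
                 Nat.blt s a || (s == a && ltb (g.map (· / 2)) w)
theorem ltb_sound (w : List ℕ) : ∀ g : List ℕ, g.length = 4 → ltb g w = true → ltw (gx g) w := by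
  induction w with
  | nil => intro g _ h; simp [ltb] at h
  | cons a w ih =>
    intro g hg h
    have h1 : wt (gx g) = (g.map (· % 2)).sum := by
      match g, hg with
      | [a, b, c, d], _ => simp [wt, gx, Fin.sum_univ_four]; ring
    have h2 : (fun i => gx g i / 2) = gx (g.map (· / 2)) := by
      match g, hg with
      | [a, b, c, d], _ => funext i; fin_cases i <;> simp [gx]
    simp only [ltb, Bool.or_eq_true, Bool.and_eq_true, beq_iff_eq] at h
    rcases h with h | ⟨h, h'⟩
    · refine Or.inl ?_
      rw [h1]
      simpa [Nat.blt_eq] using h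
    · refine Or.inr ⟨by rw [h1, h], ?_⟩
      rw [h2]
      exact ih _ (by simpa using hg) h'
def chk (u : List ℕ) (T : List (List ℕ)) (C : List (ℕ × List ℕ)) : Bool :=
  C.all (fun p => Nat.blt 0 p.1 && Nat.blt p.1 (2 ^ u.length) && p.2.length == 4
      && p.2.all (fun a => Nat.blt a 32)) &&
  (let R := T ++ C.flatMap fun p => sqv p.1 p.2
   R.all (fun m => m.length == 4) &&
   (let R' := R.filter fun m => !(ltb m u)
    R'.all fun m => R'.count m % 2 == 0))
theorem chk_sound {u : List ℕ} {T : List (List ℕ)} {C : List (ℕ × List ℕ)} (h : chk u T C = true)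
    (w : List ℕ) (F : Fin 4 → ℕ) :
    (T.map fun g => xp (gx g)).sum * xp F ^ (2 ^ u.length) ∈ NN (u ++ w) := by
  simp only [chk, Bool.and_eq_true, List.all_eq_true] at h
  obtain ⟨h1, h2, h3⟩ := h
  set R := T ++ C.flatMap fun p => sqv p.1 p.2 with hR
  set R' := R.filter (fun m => !(ltb m u)) with hR'
  have hlow : (R.map fun g => xp (gx g)).sum * xp F ^ (2 ^ u.length) ∈ Low (u ++ w) := by
    have h0 : ∀ Z : List (List ℕ), (∀ m ∈ Z, m.length = 4) → ((Z.map fun g => xp (gx g)).sum -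
        ((Z.filter (fun m => !(ltb m u))).map fun g => xp (gx g)).sum) * xp F ^ (2 ^ u.length)
          ∈ Low (u ++ w) := by
      intro Z
      induction Z with
      | nil => simp
      | cons m Z ih =>
        intro hZ
        have i1 := ih fun x hx => hZ x (by simp [hx])
        by_cases h4 : ltb m u = true
        · have i2 : xp (gx m) * xp F ^ (2 ^ u.length) ∈ Low (u ++ w) := by
            rw [← xp_pow, ← xp_add]
            exact low_xp (ltw_shift u w _ _ (ltb_sound u m (hZ m (by simp)) h4))
          simpa [h4, add_sub_assoc, add_mul] using Submodule.add_mem _ i2 i1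
        · simpa [h4] using i1
    have h5 : (R'.map fun g => xp (gx g)).sum = 0 := by
      rw [Finset.sum_list_map_count]
      refine Finset.sum_eq_zero fun m hm => ?_
      have : List.count m R' % 2 = 0 := by simpa using h3 m (by simpa using hm)
      have h6 : ∀ n : ℕ, n = List.count m R' → (n : P4) = 0 := by
        rintro n rfl; rw [CharP.cast_eq_mod P4 2, this]; simp
      rw [nsmul_eq_mul, h6 _ (by congr!), zero_mul]
    have h7 := h0 R (fun m hm => by simpa using h2 m hm)
    rwa [← hR', h5, sub_zero] at h7
  have hhit : ((C.flatMap fun p => sqv p.1 p.2).map fun g => xp (gx g)).sum * xp F ^ (2 ^ u.length) ∈ HH := by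
    rw [List.map_flatMap, sum_fm, ← List.sum_map_mul_right]
    refine list_sum_mem ?_
    intro x hx
    obtain ⟨p, hp, rfl⟩ := List.mem_map.mp hx
    obtain ⟨⟨⟨h3, h4⟩, h5⟩, h6⟩ := h1 p hp
    have h5' : p.2.length = 4 := by simpa using h5
    have h6' : ∀ a ∈ p.2, a < 32 := by simpa [Nat.blt_eq] using h6
    have h7 := sqv_sound p.2 [0, 1, 2, 3] p.1 h6' (by simp [h5'])
    have h8 : ((sqv p.1 p.2).map fun g => xp (gx g)).sum = ((sqv p.1 p.2).map (xl [0, 1, 2, 3])).sum := by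
      congr 1
      refine List.map_congr_left fun m hm => ?_
      rw [xl_eq]
      have := (h2 m (by rw [hR]; exact List.mem_append_right _ (List.mem_flatMap.mpr ⟨p, hp, hm⟩)))
      simpa using this
    rw [h8, ← h7, ← Sq_mul_pow _ _ (by simpa [Nat.blt_eq] using h4)]
    exact Sq_mem_HH _ (by simpa [Nat.blt_eq] using h3) _
  have : (T.map fun g => xp (gx g)).sum * xp F ^ (2 ^ u.length) =
      (R.map fun g => xp (gx g)).sum * xp F ^ (2 ^ u.length) -
      ((C.flatMap fun p => sqv p.1 p.2).map fun g => xp (gx g)).sum * xp F ^ (2 ^ u.length) := by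
    rw [hR, List.map_append, List.sum_append]; ring
  rw [this]
  exact Submodule.sub_mem _ (Submodule.mem_sup_right hlow) (Submodule.mem_sup_left hhit)
def exi : List ℕ → ℕ → ℕ
  | [], _ => 0
  | c :: l, i => c / 2 ^ i % 2 + 2 * exi l i
def exl (t : List ℕ) : List ℕ := [exi t 0, exi t 1, exi t 2, exi t 3]
theorem exi_eq (t : List ℕ) (i : Fin 4) : exi t i = ex t i := by
  induction t with
  | nil => rfl
  | cons c l ih => simp [exi, ex, cb, ih]
theorem gx_exl (t : List ℕ) : gx (exl t) = ex t := by
  funext i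
  rw [← exi_eq]
  fin_cases i <;> rfl
def RR (τ : Equiv.Perm (Fin 4)) : P4 →ₐ[kk] P4 := rename τ.symm
theorem RR_xp (τ : Equiv.Perm (Fin 4)) (E : Fin 4 → ℕ) : RR τ (xp E) = xp (E ∘ τ) := by
  unfold xp RR
  rw [map_prod, ← Equiv.prod_comp τ]
  simp
theorem RR_SS (τ : Equiv.Perm (Fin 4)) (f : P4) :
    SS (RR τ f) = (SS f).map (RR τ : P4 →+* P4) := by
  have : SS.comp (RR τ) = (Polynomial.mapAlgHom (RR τ)).comp SS := by
    apply MvPolynomial.algHom_ext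
    intro i
    simp [SS, RR]
  exact congrArg (fun g => g f) this
theorem RR_HH (τ : Equiv.Perm (Fin 4)) {f : P4} (h : f ∈ HH) : RR τ f ∈ HH := by
  unfold HH at h
  induction h using Submodule.span_induction with
  | mem x hx =>
    obtain ⟨k, E, hk, rfl⟩ := hx
    have : RR τ (Sq k (xp E)) = Sq k (RR τ (xp E)) := by
      rw [sq_apply, sq_apply, RR_SS, Polynomial.coeff_map]; rfl
    rw [this]; exact Sq_mem_HH _ hk _
  | zero => simp
  | add x y _ _ h1 h2 => rw [map_add]; exact Submodule.add_mem _ h1 h2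
  | smul t x _ h => rw [map_smul]; exact Submodule.smul_mem _ _ h
theorem ltw_comp (τ : Equiv.Perm (Fin 4)) (w : List ℕ) : ∀ E, ltw E w → ltw (E ∘ τ) w := by
  induction w with
  | nil => intro E h; exact h.elim
  | cons a w ih =>
    intro E h
    have h1 : wt (E ∘ τ) = wt E := Equiv.sum_comp τ fun i => E i % 2
    rcases h with h | ⟨h, h'⟩
    · exact Or.inl (by rw [h1]; exact h)
    · exact Or.inr ⟨by rw [h1]; exact h, ih _ h'⟩
theorem RR_NN (τ : Equiv.Perm (Fin 4)) {w : List ℕ} {f : P4} (h : f ∈ NN w) : RR τ f ∈ NN w := by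
  obtain ⟨a, ha, b, hb, rfl⟩ := Submodule.mem_sup.mp h
  rw [map_add]
  refine Submodule.add_mem _ (Submodule.mem_sup_left (RR_HH τ ha)) (Submodule.mem_sup_right ?_)
  clear h
  unfold Low at hb
  induction hb using Submodule.span_induction with
  | mem x hx =>
    obtain ⟨E, hE, rfl⟩ := hx
    rw [RR_xp]; exact low_xp (ltw_comp τ w _ hE)
  | zero => simp
  | add x y _ _ h1 h2 => rw [map_add]; exact Submodule.add_mem _ h1 h2
  | smul t x _ h => rw [map_smul]; exact Submodule.smul_mem _ _ h
abbrev RD := List ℕ × List (List ℕ) × List (ℕ × List ℕ)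
def pm (p : List ℕ) (c : ℕ) : ℕ :=
  c / 2 ^ (p.getD 0 0) % 2 + 2 * (c / 2 ^ (p.getD 1 0) % 2) + 4 * (c / 2 ^ (p.getD 2 0) % 2)
    + 8 * (c / 2 ^ (p.getD 3 0) % 2)
def pfun (p : List ℕ) (i : Fin 4) : Fin 4 := ⟨p.getD i 0 % 4, Nat.mod_lt _ (by norm_num)⟩
def prms : List (List ℕ) := [[0,1,2,3],[0,1,3,2],[0,2,1,3],[0,2,3,1],[0,3,1,2],[0,3,2,1],[1,0,2,3],
  [1,0,3,2],[1,2,0,3],[1,2,3,0],[1,3,0,2],[1,3,2,0],[2,0,1,3],[2,0,3,1],[2,1,0,3],[2,1,3,0],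
  [2,3,0,1],[2,3,1,0],[3,0,1,2],[3,0,2,1],[3,1,0,2],[3,1,2,0],[3,2,0,1],[3,2,1,0]]
theorem prms_ok : ∀ p ∈ prms, Function.Injective (pfun p) ∧ ∀ i ∈ List.range 4, p.getD i 0 < 4 := by
  decide +kernel
theorem cb_pm {p : List ℕ} (hp : p ∈ prms) (c : ℕ) : cb (pm p c) = cb c ∘ pfun p := by
  obtain ⟨-, h⟩ := prms_ok p hp
  have h0 := Nat.mod_eq_of_lt (h 0 (by simp))
  have h1 := Nat.mod_eq_of_lt (h 1 (by simp))
  have h2 := Nat.mod_eq_of_lt (h 2 (by simp))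
  have h3 := Nat.mod_eq_of_lt (h 3 (by simp))
  funext i
  fin_cases i
  · change pm p c / 1 % 2 = c / 2 ^ (p.getD 0 0 % 4) % 2
    rw [h0, pm]; omega
  · change pm p c / 2 % 2 = c / 2 ^ (p.getD 1 0 % 4) % 2
    rw [h1, pm]; omega
  · change pm p c / 4 % 2 = c / 2 ^ (p.getD 2 0 % 4) % 2
    rw [h2, pm]; omega
  · change pm p c / 8 % 2 = c / 2 ^ (p.getD 3 0 % 4) % 2
    rw [h3, pm]; omega
theorem ex_pm {p : List ℕ} (hp : p ∈ prms) (t : List ℕ) : ex (t.map (pm p)) = ex t ∘ pfun p := by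
  induction t with
  | nil => rfl
  | cons c t ih =>
    rw [List.map_cons, ex, ex, ih, cb_pm hp]; rfl
def ckd (d : RD) : Bool := (d.2.1.all fun t => t.length == d.1.length) && chk d.1 (d.2.1.map exl) d.2.2
theorem rel_perm {d : RD} (h : ckd d = true) {p : List ℕ} (hp : p ∈ prms) (P Q w : List ℕ) :
    (d.2.1.map fun t => mono (P ++ (t.map (pm p) ++ Q))).sum ∈ NN (P.map pc ++ (d.1 ++ w)) := by
  obtain ⟨u, L, C⟩ := d
  simp only [ckd, Bool.and_eq_true, List.all_eq_true, beq_iff_eq] at h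
  obtain ⟨hL, h⟩ := h
  let τ : Equiv.Perm (Fin 4) := Equiv.ofBijective (pfun p)
    (Finite.injective_iff_bijective.mp (prms_ok p hp).1)
  have h1 := RR_NN τ (chk_sound h w (ex Q ∘ τ.symm))
  have h2 : ((L.map fun t => t.map (pm p) ++ Q).map mono).sum ∈ NN (u ++ w) := by
    convert h1 using 1
    rw [map_mul, map_list_sum, map_pow, RR_xp, ← List.sum_map_mul_right, List.map_map, List.map_map,
      List.map_map]
    congr 1
    refine List.map_congr_left fun t ht => ?_
    simp only [Function.comp, gx_exl, mono, RR_xp]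
    rw [ex_append, xp_add, xp_pow, List.length_map, hL t ht, ex_pm hp]
    congr 3
    funext i; simp
  have h3 := mono_sum_prefix _ _ h2 P
  rw [List.map_map] at h3
  exact h3
/-! coverage -/
def bs : List ℕ → ℕ
  | [] => 0
  | c :: l => Nat.lor (Nat.shiftLeft 1 c) (bs l)
theorem bs_mem (L : List ℕ) (c : ℕ) (h : (bs L).testBit c = true) : c ∈ L := by
  induction L with
  | nil => simp [bs] at h
  | cons a L ih =>
    have : (1 <<< a ||| bs L).testBit c = true := h
    rw [Nat.testBit_or, Bool.or_eq_true, Nat.testBit_shiftLeft] at this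
    rcases this with h | h
    · simp only [Bool.and_eq_true, decide_eq_true_eq, Nat.testBit_one_eq_true_iff_self_eq_zero] at h
      exact List.mem_cons.mpr (Or.inl (by omega))
    · exact List.mem_cons_of_mem _ (ih h)
def msk (k : ℕ) : List ℕ := (List.range 16).filter fun c => pc c == k
def tup : List ℕ → List (List ℕ)
  | [] => [[]]
  | k :: u => (msk k).flatMap fun c => (tup u).map fun t => c :: t
theorem mem_tup (t : List ℕ) (h : ∀ c ∈ t, c < 16) : t ∈ tup (t.map pc) := by
  induction t with
  | nil => simp [tup]
  | cons c t ih =>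
    simp only [List.map_cons, tup, List.mem_flatMap, List.mem_map]
    exact ⟨c, by simp [msk, h c], t, ih (fun x hx => h x (by simp [hx])), rfl⟩
def cds (D : List RD) (u : List ℕ) : List ℕ :=
  D.flatMap fun d => if d.1 == u then (match d.2.1 with
    | [t] => prms.map fun p => Nat.ofDigits 16 (t.map (pm p))
    | _ => []) else []
def kcov (D : List RD) (u : List ℕ) : Bool :=
  let b := bs (cds D u); (tup u).all fun t => b.testBit (Nat.ofDigits 16 t)
theorem pm_lt (p : List ℕ) (c : ℕ) : pm p c < 16 := by unfold pm; omega
theorem kill {D : List RD} (hD : D.all ckd = true) {u : List ℕ} (hu : kcov D u = true)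
    (P t Q w : List ℕ) (ht : t.map pc = u) (hl : ∀ c ∈ t, c < 16) :
    mono (P ++ (t ++ Q)) ∈ NN (P.map pc ++ (u ++ w)) := by
  simp only [kcov, List.all_eq_true] at hu hD
  have h1 := bs_mem _ _ (hu t (ht ▸ mem_tup t hl))
  unfold cds at h1
  obtain ⟨d, hd, h2⟩ := List.mem_flatMap.mp h1
  by_cases he : d.1 = u
  · rw [if_pos (by simpa using he)] at h2
    have hc := hD d hd
    obtain ⟨du, dL, dC⟩ := d
    dsimp only at h2 he
    subst he
    match dL, hc, h2 with
    | [], _, h2 => simp at h2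
    | _ :: _ :: _, _, h2 => simp at h2
    | [t'], hc, h2 =>
      obtain ⟨p, hp, h3⟩ := List.mem_map.mp h2
      have hlen : t'.length = du.length := by
        simp only [ckd, Bool.and_eq_true, List.all_eq_true, beq_iff_eq] at hc
        exact hc.1 t' (by simp)
      have h4 : t'.map (pm p) = t := by
        refine Nat.ofDigits_inj_of_len_eq (b := 16) (by norm_num) ?_ ?_ hl h3
        · rw [List.length_map, hlen, ← ht, List.length_map]
        · intro x hx
          obtain ⟨y, _, rfl⟩ := List.mem_map.mp hx
          exact pm_lt _ _
      have := rel_perm hc hp P Q w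
      simpa [h4] using this
  · rw [if_neg (by simpa using he)] at h2
    simp at h2
def dgt : ℕ → ℕ → List ℕ
  | 0, _ => []
  | f + 1, n => if n = 0 then [] else n % 16 :: dgt f (n / 16)
def dtm (n : ℕ) : ℕ × List ℕ := (n / 1048576, [n % 32, n / 32 % 32, n / 1024 % 32, n / 32768 % 32])
def rdec (l : List (List ℕ × List ℕ)) : List RD :=
  l.map fun h => ((dgt 5 (h.1.headD 0)).map pc, h.1.map (dgt 5), h.2.map dtm)
def kd : List RD := rdec [
([49],[1048611]),([97],[1049634,2098209]),([241],[1116195]),([243],[1115235]),([247],[1084515]),([1809],[1052775]),([3601],[2230310,3280931,2232387]),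
([1825],[2101443]),([3361],[2230310,1183781]),([3617],[2230465]),([881],[1050791]),([1649],[1054883]),([2417],[1181735]),([2673],[1181859]),
([993],[3213413,2164838]),([1761],[3214529,1084612,2165954]),([16],[1048577]),([48],[1048641]),([112],[1050689]),([240],[1116225]),([13171],[1050095]),
([21363],[1058031]),([37747],[1311983]),([50035],[1320167]),([13683],[1054063]),([21875],[1061999]),([25971],[1062247]),([38259],[1315951]),
([42355],[1316199]),([50547],[1324135]),([14707],[1181039]),([22899],[1188975]),([26995],[1189223]),([39283],[1442927]),([43379],[1443175]),
([51571],[1451111]),([15475],[1185131]),([23667],[1193067]),([40051],[1447019]),([52339],[1455203]),([13267],[1181039,1085807,2165103]),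
([21459],[1188975,1093743,2173039]),([25555],[1189223,1093991,2173287]),([50131],[1451111,1355879,2435175]),([13779],[1089775,1185007,2169071]),
([21971],[1190959,1092751,1127471,2174031]),([26067],[1191207,1092999,1127719,2174279]),([38355],[1444911,1346703,1381423,2427983]),
([42451],[1445159,1346951,1381671,2428231]),([50643],[1453095,1354887,1389607,2436167]),([14035],[1189223,1093991,4266407,2173287]),
([22227],[1191207,1092999,1127719,4274343,2174279]),([26323],[12625123,4240739,14720227,2147557,1127843,1191331,2174403,1093030]),
([38611],[1451111,1355879,1445159,1346951,1381671,2435175,2428231,4528295]),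
([42707],[1451235,1356003,1447267,1445097,1346796,1381609,2435299,2431331,2428138,4528357]),
([50899],[1453219,1449251,1351043,1449065,1350764,1389731,1383593,2436291,2432323,2432106,4529349]),
([15571],[1346951,1156487,1445159,1159463,1250603,1349927,1381671,1217867,2428231,2206023,4364615]),
([23763],[1453095,1354887,1389607,4405287,2436167]),([27859],[4500643,10656933,2403493,6462633,12754083,1226051]),
([52435],[1289260,1422467,1289353,1488931,1422405,4437062,2337866,2472003])]
def rd : List RD := rdec [
([33,18],[1048609]),([83,53],[1049635]),([195,60],[2130977,1115169,1083425]),([195,165,150],[1115169]),([183,123],[1082467]),([529,290],[1048675]),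
([1331,853],[1051751]),([2935,1979],[1150183]),
([52275,52419],[1481985,1416451,1481768,1416296,2567233,2567202,2465026,2464840,4660353,4594819,4660260,4594788,1520673,1453155]),
([23603,23747],[1324071,1322087,2308135,2370631,4337767]),([22,37,67],[1049633]),([30,45,75,135],[1082401]),([61,91,151],[1082403]),
([494,733,1211,2167],[1150051]),([7918,11741,19387,34679],[1285351]),([126702,187869,310203,554871],[1555951])]
theorem kd_ok : kd.all ckd = true := by decide +kernel
theorem rd_ok : rd.all ckd = true := by decide +kernel
def kus : List (List ℕ) := [[0,1],[0,2],[0,3],[0,4],[1,2],[1,4],[2,4],[3,4],[1,1,3],[1,3,2],[2,3,2,2]]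
theorem kus_ok : kus.all (kcov kd) = true := by decide +kernel
def Kn (w : List ℕ) : Prop := ∀ l : List ℕ, l.map pc = w → (∀ c ∈ l, c < 16) → mono l ∈ NN w
theorem Kn_infix {u w : List ℕ} (hu : u ∈ kus) (h : u <:+: w) : Kn w := by
  obtain ⟨p, q, rfl⟩ := h
  intro l hl hc
  rw [List.append_assoc, List.map_eq_append_iff] at hl
  obtain ⟨P, l', rfl, rfl, hl⟩ := hl
  rw [List.map_eq_append_iff] at hl
  obtain ⟨t, Q, rfl, rfl, rfl⟩ := hl
  rw [List.append_assoc]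
  exact kill kd_ok (List.all_eq_true.mp kus_ok _ hu) P t Q _ rfl
    (fun c h => hc c (by simp [h]))
def DD : List ℕ → ℕ
  | [] => 0
  | a :: w => a + 2 * DD w
structure NK (w : List ℕ) : Prop where
  nk : ∀ u ∈ kus, ¬ u <:+: w
  le : ∀ a ∈ w, a ≤ 4
theorem NK.tail {a : ℕ} {w : List ℕ} (h : NK (a :: w)) : NK w :=
  ⟨fun u hu h' => h.nk u hu (h'.trans (List.suffix_cons a w).isInfix), fun x hx => h.le x (by simp [hx])⟩
theorem NK.pre {w q : List ℕ} (h : NK w) (u : List ℕ) (hw : w = u ++ q) (hu : u ∈ kus) : False :=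
  h.nk u hu ⟨[], q, by simp [hw]⟩
def Z (w : List ℕ) : Prop := ∃ k, w = List.replicate k 0
theorem nkz (w : List ℕ) (h : NK (0 :: w)) : DD w = 0 ∧ Z w := by
  induction w with
  | nil => exact ⟨rfl, 0, rfl⟩
  | cons a w ih =>
    have ha := h.le a (by simp)
    have : a = 0 := by
      interval_cases a
      · rfl
      · exact (h.pre (q := w) [0, 1] rfl (by decide)).elim
      · exact (h.pre (q := w) [0, 2] rfl (by decide)).elim
      · exact (h.pre (q := w) [0, 3] rfl (by decide)).elim
      · exact (h.pre (q := w) [0, 4] rfl (by decide)).elim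
    subst this
    obtain ⟨h1, k, h2⟩ := ih h.tail
    exact ⟨by simp [DD, h1], k + 1, by rw [h2]; rfl⟩
theorem dd0 (w : List ℕ) (h : DD w = 0) : Z w := by
  induction w with
  | nil => exact ⟨0, rfl⟩
  | cons a w ih =>
    simp only [DD] at h
    obtain ⟨k, hk⟩ := ih (by omega)
    exact ⟨k + 1, by rw [hk, show a = 0 by omega]; rfl⟩
theorem nkhd {w : List ℕ} (h : NK w) (hD : DD w ≠ 0) : ∃ a w', w = a :: w' ∧ NK w' ∧ a ≠ 0 ∧ a ≤ 4 ∧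
    DD w = a + 2 * DD w' := by
  cases w with
  | nil => exact (hD rfl).elim
  | cons a w =>
    refine ⟨a, w, rfl, h.tail, ?_, h.le a (by simp), rfl⟩
    rintro rfl
    exact hD (by simp [DD, (nkz w h).1])
theorem one_even {w : List ℕ} (h : NK (1 :: w)) (hD : DD w % 2 = 0) : DD w = 0 := by
  by_contra h0
  obtain ⟨a, w', rfl, -, ha, ha4, h1⟩ := nkhd h.tail h0
  have : a = 2 ∨ a = 4 := by omega
  rcases this with rfl | rfl
  · exact h.pre (q := w') [1, 2] rfl (by decide)
  · exact h.pre (q := w') [1, 4] rfl (by decide)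
theorem clsC (m : ℕ) : ∀ w, NK w → DD w + 3 = 2 ^ (m + 2) →
    ∃ z, Z z ∧ w = List.replicate m 3 ++ (List.replicate 1 1 ++ z) := by
  induction m with
  | zero =>
    intro w h hD
    obtain ⟨a, w', rfl, h', ha, ha4, h1⟩ := nkhd h (by omega)
    have : a = 1 := by omega
    subst this
    exact ⟨w', dd0 _ (by omega), by simp⟩
  | succ m ih =>
    intro w h hD
    have hp : 2 ^ (m + 1 + 2) = 2 * 2 ^ (m + 2) := by ring
    have hq : 4 ≤ 2 ^ (m + 2) := by rw [pow_add]; have := Nat.one_le_two_pow (n := m); omega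
    have hr : 2 ^ (m + 2) % 2 = 0 := by rw [pow_succ]; omega
    obtain ⟨a, w', rfl, h', ha, ha4, h1⟩ := nkhd h (by omega)
    have : a = 1 ∨ a = 3 := by omega
    rcases this with rfl | rfl
    · have := one_even h (by omega); omega
    · obtain ⟨z, hz, rfl⟩ := ih w' h' (by omega)
      exact ⟨z, hz, by simp [List.replicate_succ]⟩
theorem clsA11 (r : ℕ) : ∀ w, NK (1 :: 1 :: w) → DD w + 1 = 2 ^ r →
    ∃ z, Z z ∧ w = List.replicate r 1 ++ z := by
  induction r with
  | zero => intro w h hD; exact ⟨w, dd0 _ (by simpa using hD), by simp⟩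
  | succ r ih =>
    intro w h hD
    have hp : 2 ^ (r + 1) = 2 * 2 ^ r := by ring
    have := Nat.one_le_two_pow (n := r)
    obtain ⟨a, w', rfl, h', ha, ha4, h1⟩ := nkhd h.tail.tail (by omega)
    have : a = 1 ∨ a = 3 := by omega
    rcases this with rfl | rfl
    · obtain ⟨z, hz, rfl⟩ := ih w' h.tail (by omega)
      exact ⟨z, hz, by simp [List.replicate_succ]⟩
    · exact (h.pre (q := w') [1, 1, 3] rfl (by decide)).elim
theorem clsA1 (r : ℕ) (hr : 3 ≤ r) (w : List ℕ) (h : NK (1 :: w)) (hD : DD w + 1 = 2 ^ r) :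
    ∃ z, Z z ∧ w = List.replicate r 1 ++ z := by
  obtain ⟨r, rfl⟩ := Nat.exists_eq_add_of_le' hr
  have hp : 2 ^ (r + 3) = 8 * 2 ^ r := by ring
  have := Nat.one_le_two_pow (n := r)
  obtain ⟨a, w', rfl, h', ha, ha4, h1⟩ := nkhd h.tail (by omega)
  have : a = 1 ∨ a = 3 := by omega
  rcases this with rfl | rfl
  · obtain ⟨z, hz, rfl⟩ := clsA11 (r + 2) w' h (by rw [show 2 ^ (r + 2) = 4 * 2 ^ r by ring]; omega)
    exact ⟨z, hz, by simp [List.replicate_succ]⟩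
  · obtain ⟨b, w'', rfl, -, hb, hb4, h2⟩ := nkhd h' (by omega)
    have : b = 2 ∨ b = 4 := by omega
    rcases this with rfl | rfl
    · exact (h.pre (q := w'') [1, 3, 2] rfl (by decide)).elim
    · exact (h.tail.pre (q := w'') [3, 4] rfl (by decide)).elim
theorem clsB0 (m : ℕ) : ∀ a w, (a = 2 ∨ a = 3) → NK (a :: w) → DD w + 2 = 2 ^ (m + 1) →
    ∃ z, Z z ∧ w = List.replicate m 2 ++ z := by
  induction m with
  | zero => intro a w _ h hD; exact ⟨w, dd0 _ (by omega), by simp⟩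
  | succ m ih =>
    intro a w ha h hD
    have hp : 2 ^ (m + 1 + 1) = 4 * 2 ^ m := by ring
    have hp' : 2 ^ (m + 1) = 2 * 2 ^ m := by ring
    have := Nat.one_le_two_pow (n := m)
    obtain ⟨b, w', rfl, h', hb, hb4, h1⟩ := nkhd h.tail (by omega)
    have : b = 2 ∨ b = 4 := by omega
    rcases this with rfl | rfl
    · obtain ⟨z, hz, rfl⟩ := ih 2 w' (Or.inl rfl) h.tail (by omega)
      exact ⟨z, hz, by simp [List.replicate_succ]⟩
    · rcases ha with rfl | rfl
      · exact (h.pre (q := w') [2, 4] rfl (by decide)).elim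
      · exact (h.pre (q := w') [3, 4] rfl (by decide)).elim
theorem clsA2 (t : ℕ) (ht : 5 ≤ t) (s : ℕ) : ∀ w, NK (2 :: w) → DD w + 2 = 2 ^ (s + t) + 2 ^ s →
    ∃ z, Z z ∧ w = List.replicate s 2 ++ (List.replicate t 1 ++ z) := by
  obtain ⟨t, rfl⟩ := Nat.exists_eq_add_of_le' ht
  have := Nat.one_le_two_pow (n := t)
  induction s with
  | zero =>
    intro w h hD
    have hp : 2 ^ (0 + (t + 5)) = 32 * 2 ^ t := by ring
    rw [pow_zero] at hD
    obtain ⟨a, w', rfl, h', ha, ha4, h1⟩ := nkhd h.tail (by omega)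
    have : a = 1 ∨ a = 3 := by omega
    rcases this with rfl | rfl
    · obtain ⟨z, hz, rfl⟩ := clsA1 (t + 4) (by omega) w' h.tail
        (by rw [show 2 ^ (t + 4) = 16 * 2 ^ t by ring]; omega)
      exact ⟨z, hz, by simp [List.replicate_succ]⟩
    · obtain ⟨b, w'', rfl, h'', hb, hb4, h2⟩ := nkhd h' (by omega)
      have : b = 2 ∨ b = 4 := by omega
      rcases this with rfl | rfl
      · obtain ⟨c, w3, rfl, -, hc, hc4, h3⟩ := nkhd h'' (by omega)
        have : c = 2 ∨ c = 4 := by omega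
        rcases this with rfl | rfl
        · exact (h.pre (q := w3) [2, 3, 2, 2] rfl (by decide)).elim
        · exact (h'.pre (q := w3) [2, 4] rfl (by decide)).elim
      · exact (h.tail.pre (q := w'') [3, 4] rfl (by decide)).elim
  | succ s ih =>
    intro w h hD
    have hp : 2 ^ (s + 1 + (t + 5)) = 2 * 2 ^ (s + (t + 5)) := by ring
    have hp' : 2 ^ (s + 1) = 2 * 2 ^ s := by ring
    have := Nat.one_le_two_pow (n := s)
    have := Nat.one_le_two_pow (n := s + (t + 5))
    obtain ⟨a, w', rfl, h', ha, ha4, h1⟩ := nkhd h.tail (by omega)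
    have : a = 2 ∨ a = 4 := by omega
    rcases this with rfl | rfl
    · obtain ⟨z, hz, rfl⟩ := ih w' h.tail (by omega)
      exact ⟨z, hz, by simp [List.replicate_succ]⟩
    · exact (h.pre (q := w') [2, 4] rfl (by decide)).elim
theorem clsB (t : ℕ) (ht : 5 ≤ t) (s : ℕ) : ∀ w, NK w → DD w + 3 = 2 ^ (s + 1 + t) + 2 ^ (s + 1) →
    ∃ z, Z z ∧ (w = List.replicate s 3 ++ (List.replicate (t + 1) 1 ++ z) ∨
      w = List.replicate (s + 1) 3 ++ (List.replicate (t - 1) 2 ++ z)) := by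
  obtain ⟨t, rfl⟩ := Nat.exists_eq_add_of_le' ht
  have := Nat.one_le_two_pow (n := t)
  induction s with
  | zero =>
    intro w h hD
    have hp : 2 ^ (0 + 1 + (t + 5)) = 64 * 2 ^ t := by ring
    obtain ⟨a, w', rfl, h', ha, ha4, h1⟩ := nkhd h (by omega)
    have : a = 1 ∨ a = 3 := by omega
    rcases this with rfl | rfl
    · obtain ⟨z, hz, rfl⟩ := clsA1 (t + 5) (by omega) w' h
        (by rw [show 2 ^ (t + 5) = 32 * 2 ^ t by ring]; omega)
      exact ⟨z, hz, Or.inl (by simp [List.replicate_succ])⟩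
    · obtain ⟨z, hz, rfl⟩ := clsB0 (t + 4) 3 w' (Or.inr rfl) h
        (by rw [show 2 ^ (t + 4 + 1) = 32 * 2 ^ t by ring]; omega)
      exact ⟨z, hz, Or.inr (by simp [List.replicate_succ])⟩
  | succ s ih =>
    intro w h hD
    have hp : 2 ^ (s + 1 + 1 + (t + 5)) = 2 * 2 ^ (s + 1 + (t + 5)) := by ring
    have hp1 : 2 ^ (s + 1 + (t + 5)) = 2 * 2 ^ (s + (t + 5)) := by ring
    have hp' : 2 ^ (s + 1 + 1) = 4 * 2 ^ s := by ring
    have hp3 : 2 ^ (s + 1) = 2 * 2 ^ s := by ring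
    have := Nat.one_le_two_pow (n := s)
    have := Nat.one_le_two_pow (n := s + (t + 5))
    obtain ⟨a, w', rfl, h', ha, ha4, h1⟩ := nkhd h (by omega)
    have : a = 1 ∨ a = 3 := by omega
    rcases this with rfl | rfl
    · have := one_even h (by omega); omega
    · obtain ⟨z, hz, hw⟩ := ih w' h' (by omega)
      refine ⟨z, hz, ?_⟩
      rcases hw with rfl | rfl
      · exact Or.inl (by simp [List.replicate_succ])
      · exact Or.inr (by simp [List.replicate_succ])
def gI (s t : ℕ) : List ℕ := List.replicate s 2 ++ List.replicate t 1
def gII (s t : ℕ) : List ℕ := 4 :: (List.replicate (s - 2) 3 ++ List.replicate (t + 1) 1)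
def gIII (s t : ℕ) : List ℕ := 4 :: (List.replicate (s - 1) 3 ++ List.replicate (t - 1) 2)
def gIV (t : ℕ) : List ℕ := 4 :: 4 :: (List.replicate (t - 3) 3 ++ List.replicate 1 1)
theorem classify (s t : ℕ) (hs : 1 ≤ s) (ht : 5 ≤ t) (w : List ℕ) (h4 : ∀ a ∈ w, a ≤ 4)
    (hD : DD w + 2 = 2 ^ (s + t) + 2 ^ s) : Kn w ∨ ∃ z, Z z ∧
      (w = gI s t ++ z ∨ (2 ≤ s ∧ w = gII s t ++ z) ∨ w = gIII s t ++ z ∨ (s = 1 ∧ w = gIV t ++ z)) := by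
  by_cases hk : ∃ u ∈ kus, u <:+: w
  · obtain ⟨u, hu, h⟩ := hk; exact Or.inl (Kn_infix hu h)
  have h : NK w := ⟨fun u hu h => hk ⟨u, hu, h⟩, h4⟩
  refine Or.inr ?_
  obtain ⟨s, rfl⟩ := Nat.exists_eq_add_of_le' hs
  have hp : 2 ^ (s + 1 + t) = 2 * 2 ^ (s + t) := by ring
  have hp' : 2 ^ (s + 1) = 2 * 2 ^ s := by ring
  have h1 := Nat.one_le_two_pow (n := s)
  have h2 := Nat.one_le_two_pow (n := s + t)
  obtain ⟨a, w', rfl, h', ha, ha4, h3⟩ := nkhd h (by omega)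
  have : a = 2 ∨ a = 4 := by omega
  rcases this with rfl | rfl
  · obtain ⟨z, hz, rfl⟩ := clsA2 t ht s w' h (by omega)
    exact ⟨z, hz, Or.inl (by simp [gI, List.replicate_succ])⟩
  · cases s with
    | zero =>
      obtain ⟨t, rfl⟩ := Nat.exists_eq_add_of_le' ht
      have := Nat.one_le_two_pow (n := t)
      have hq : 2 ^ (0 + (t + 5)) = 32 * 2 ^ t := by ring
      obtain ⟨b, w'', rfl, h'', hb, hb4, h4⟩ := nkhd h' (by omega)
      have : b = 2 ∨ b = 4 := by omega
      rcases this with rfl | rfl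
      · obtain ⟨z, hz, rfl⟩ := clsB0 (t + 3) 2 w'' (Or.inl rfl) h'
          (by rw [show 2 ^ (t + 3 + 1) = 16 * 2 ^ t by ring]; omega)
        exact ⟨z, hz, Or.inr (Or.inr (Or.inl (by simp [gIII, List.replicate_succ])))⟩
      · obtain ⟨z, hz, rfl⟩ := clsC (t + 2) w'' h''
          (by rw [show 2 ^ (t + 2 + 2) = 16 * 2 ^ t by ring]; omega)
        exact ⟨z, hz, Or.inr (Or.inr (Or.inr ⟨rfl, by simp [gIV]⟩))⟩
    | succ s =>
      obtain ⟨z, hz, hw⟩ := clsB t ht s w' h' (by omega)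
      refine ⟨z, hz, Or.inr ?_⟩
      rcases hw with rfl | rfl
      · exact Or.inl ⟨by omega, by simp [gII]⟩
      · exact Or.inr (Or.inl (by simp [gIII]))
theorem HH_hit (n : ℕ) (f : P4) (hf : f ∈ homog n) (h : f ∈ HH) : f ∈ hitSub n := by
  by_contra hn
  obtain ⟨l, h1, h2, -⟩ := separate n f hf hn
  exact h1 (h2 h)
def cf (E : Fin 4 → ℕ) : P4 →ₗ[kk] kk := lcoeff kk (Finsupp.equivFunOnFinite.symm E)
theorem cf_xp (E F : Fin 4 → ℕ) : cf E (xp F) = if E = F then 1 else 0 := by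
  classical
  rw [cf, xp_eq, lcoeff_apply, coeff_monomial]
  simp [eq_comm]
open Classical in
theorem cf_mul_xp (E F : Fin 4 → ℕ) (g : P4) :
    cf E (g * xp F) = if F ≤ E then cf (E - F) g else 0 := by
  rw [cf, xp_eq, lcoeff_apply, coeff_mul_monomial', mul_one]
  have : Finsupp.equivFunOnFinite.symm F ≤ Finsupp.equivFunOnFinite.symm E ↔ F ≤ E := Iff.rfl
  by_cases h : F ≤ E
  · rw [if_pos (this.mpr h), if_pos h, cf, lcoeff_apply]
    congr 1
    ext i; simp
  · rw [if_neg (fun h' => h (this.mp h')), if_neg h]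
theorem cf_homog {g : P4} {m : ℕ} (hg : g.IsHomogeneous m) (E : Fin 4 → ℕ) (h : ∑ i, E i ≠ m) :
    cf E g = 0 := by
  rw [cf, lcoeff_apply]
  apply hg.coeff_eq_zero
  simpa [Finsupp.degree_eq_sum] using h
theorem cf_sq {g : P4} {m : ℕ} (hg : g.IsHomogeneous m) (S σ : Fin 4 → ℕ) (hS : ∀ i, S i ≤ 1)
    (hm : m < ∑ i, S i + 2) (h : P4) : cf (S + 2 • σ) (g * h ^ 2) = cf S g * cf σ h := by
  induction h using xp_induction with
  | h0 => simp
  | hx E =>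
    rw [← xp_pow, cf_mul_xp, cf_xp]
    by_cases hE : σ = E
    · subst hE
      rw [if_pos (show 2 • σ ≤ S + 2 • σ from fun i => by simp), if_pos rfl, mul_one, add_tsub_cancel_right]
    · rw [if_neg hE, mul_zero]
      split_ifs with hle
      · apply cf_homog hg
        have h1 : ∀ i, E i ≤ σ i := by
          intro i
          have := hle i; have := hS i
          simp at *; omega
        have h2 : ∃ i, E i < σ i := by
          by_contra hc
          push Not at hc
          exact hE (funext fun i => le_antisymm (hc i) (h1 i))
        obtain ⟨i, hi⟩ := h2
        have h3 : ∑ i, (S i + 2) ≤ ∑ i, (S i) + 2 * 4 := by simp [Finset.sum_add_distrib]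
        have h4 : ∑ j, S j + ∑ j, 2 * (σ j - E j) = ∑ j, (S + 2 • σ - 2 • E) j := by
          rw [← Finset.sum_add_distrib]
          refine Finset.sum_congr rfl fun j _ => ?_
          have := h1 j
          simp; omega
        have h5 : 2 * (σ i - E i) ≤ ∑ j, 2 * (σ j - E j) :=
          Finset.single_le_sum (f := fun j => 2 * (σ j - E j)) (fun _ _ => Nat.zero_le _) (Finset.mem_univ i)
        omega
      · rfl
  | ha a b h1 h2 => rw [CharTwo.add_sq, mul_add, map_add, map_add, h1, h2, mul_add]
theorem substM_homog (M : Matrix (Fin 4) (Fin 4) kk) (E : Fin 4 → ℕ) :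
    (substM M (xp E)).IsHomogeneous (∑ i, E i) := by
  rw [xp, map_prod]
  apply IsHomogeneous.prod
  intro i _
  rw [map_pow, substM, aeval_X]
  have : (∑ j, M i j • X j : P4).IsHomogeneous 1 := by
    apply IsHomogeneous.sum
    intro j _
    rw [smul_eq_C_mul]
    simpa using (isHomogeneous_C (Fin 4) (M i j)).mul (isHomogeneous_X kk j)
  simpa using this.pow (E i)
def pl (M : Matrix (Fin 4) (Fin 4) kk) (S c : ℕ) : kk := cf (cb S) (substM M (xp (cb c)))
def ph (M : Matrix (Fin 4) (Fin 4) kk) (σ : List ℕ) : P4 →ₗ[kk] kk :=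
  (cf (ex σ)).comp (substM M).toLinearMap
theorem sum_cb (c : ℕ) : ∑ i, cb c i = pc c := by simp [cb, pc, Fin.sum_univ_four]
theorem pl_ne (M : Matrix (Fin 4) (Fin 4) kk) {S c : ℕ} (h : pc c ≠ pc S) : pl M S c = 0 :=
  cf_homog (substM_homog M (cb c)) _ (by rw [sum_cb, sum_cb]; exact h.symm)
theorem ph_cons (M : Matrix (Fin 4) (Fin 4) kk) (S : ℕ) (σ : List ℕ) (c : ℕ) (f : P4)
    (h : pc c ≤ pc S) : ph M (S :: σ) (xp (cb c) * f ^ 2) = pl M S c * ph M σ f := by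
  simp only [ph, LinearMap.comp_apply, AlgHom.toLinearMap_apply, map_mul, map_pow, ex]
  refine cf_sq (substM_homog M (cb c)) _ _ (cb_le S) ?_ _
  rw [sum_cb, sum_cb]; omega
theorem ph_mono (M : Matrix (Fin 4) (Fin 4) kk) (σ : List ℕ) : ∀ l : List ℕ, l.map pc = σ.map pc →
    ph M σ (mono l) = (List.zipWith (pl M) σ l).prod := by
  induction σ with
  | nil => intro l h; have : l = [] := by simpa using h
           subst this; simp only [ph, mono, ex, xp_zero, LinearMap.comp_apply, AlgHom.toLinearMap_apply, map_one]
           rw [← xp_zero, cf_xp, if_pos rfl]; rfl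
  | cons S σ ih =>
    intro l h
    cases l with
    | nil => simp at h
    | cons c l =>
      simp only [List.map_cons, List.cons.injEq] at h
      rw [mono_cons, ph_cons _ _ _ _ _ h.1.le, ih l h.2]; simp
theorem split2 (E : Fin 4 → ℕ) : ∃ c, c < 16 ∧ pc c = wt E ∧ E = cb c + 2 • (fun i => E i / 2) := by
  refine ⟨E 0 % 2 + 2 * (E 1 % 2) + 4 * (E 2 % 2) + 8 * (E 3 % 2), by omega, ?_, ?_⟩
  · simp [pc, wt, Fin.sum_univ_four]; omega
  · funext i
    fin_cases i <;> simp [cb] <;> omega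
theorem ph_low (M : Matrix (Fin 4) (Fin 4) kk) (σ : List ℕ) (z : List ℕ) (hz : Z z) : ∀ E : Fin 4 → ℕ,
    ltw E (σ.map pc ++ z) → ph M σ (xp E) = 0 := by
  induction σ with
  | nil =>
    intro E h
    obtain ⟨k, rfl⟩ := hz
    exfalso
    simp only [List.map_nil, List.nil_append] at h
    induction k generalizing E with
    | zero => exact h
    | succ k ih =>
      rcases h with h | ⟨_, h⟩
      · omega
      · exact ih _ h
  | cons S σ ih =>
    intro E h
    obtain ⟨c, -, hc, hE⟩ := split2 E
    have e : xp E = xp (cb c) * xp (fun i => E i / 2) ^ 2 := by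
      conv_lhs => rw [hE, xp_add, xp_pow]
    rcases h with h | ⟨h, h'⟩
    · rw [e, ph_cons _ _ _ _ _ (by omega), pl_ne M (by omega), zero_mul]
    · rw [e, ph_cons _ _ _ _ _ (by omega), ih _ h', mul_zero]
theorem choose_spike (a : ℕ) : ∀ n k, n + k + 1 = 2 ^ a → 0 < k → n.choose k % 2 = 0 := by
  induction a with
  | zero => intro n k h hk; rw [pow_zero] at h; omega
  | succ a ih =>
    intro n k h hk
    have h1 : n.choose k ≡ (n % 2).choose (k % 2) * (n / 2).choose (k / 2) [MOD 2] :=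
      have : Fact (Nat.Prime 2) := ⟨Nat.prime_two⟩
      Choose.choose_modEq_choose_mod_mul_choose_div_nat
    unfold Nat.ModEq at h1
    rw [pow_succ] at h
    rw [h1]
    rcases Nat.mod_two_eq_zero_or_one n with hn | hn
    · rw [hn, show k % 2 = 1 by omega]; simp
    · rw [Nat.mul_mod, ih (n / 2) (k / 2) (by omega) (by omega)]; simp
theorem cf_spike (σ : Fin 4 → ℕ) (hσ : ∀ i, ∃ a, σ i + 1 = 2 ^ a) (k : ℕ) (hk : 0 < k) (f : P4) :
    cf σ (Sq k f) = 0 := by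
  induction f using xp_induction with
  | h0 => simp
  | hx E =>
    rw [sq_xp, map_sum]
    refine Finset.sum_eq_zero fun e _ => ?_
    split_ifs with h
    · have h0 : ((∏ i, (E i).choose (e i) : ℕ) : P4) = C ((∏ i, (E i).choose (e i) : ℕ) : kk) := by simp
      rw [h0, ← smul_eq_C_mul, map_smul, cf_xp]
      split_ifs with h1
      · obtain ⟨i, hi⟩ : ∃ i, 0 < e i := by
          by_contra hc
          push Not at hc
          have : ∑ i, e i = 0 := Finset.sum_eq_zero fun i _ => by have := hc i; omega
          omega
        obtain ⟨a, ha⟩ := hσ i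
        have h2 := choose_spike a (E i) (e i) (by rw [← ha, h1]; simp) hi
        have h3 : (∏ i, (E i).choose (e i)) % 2 = 0 := by
          have := Finset.dvd_prod_of_mem (fun i => (E i).choose (e i)) (Finset.mem_univ i)
          exact Nat.mod_eq_zero_of_dvd (dvd_trans (Nat.dvd_of_mod_eq_zero h2) this)
        have h4 : ((∏ i, (E i).choose (e i) : ℕ) : kk) = 0 := by
          rw [ZMod.natCast_eq_zero_iff]; exact Nat.dvd_of_mod_eq_zero h3
        rw [h4, zero_smul]
      · simp
    · simp
  | ha a b h1 h2 => rw [map_add, map_add, h1, h2, add_zero]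
theorem substM_SS (M : Matrix (Fin 4) (Fin 4) kk) (f : P4) :
    SS (substM M f) = (SS f).map (substM M : P4 →+* P4) := by
  have : SS.comp (substM M) = (Polynomial.mapAlgHom (substM M)).comp SS := by
    apply MvPolynomial.algHom_ext
    intro i
    simp only [SS, substM, AlgHom.comp_apply, aeval_X, map_sum, map_smul, map_add, map_mul,
      Polynomial.coe_mapAlgHom, Polynomial.map_C,
      Polynomial.map_X, RingHom.coe_coe, map_pow, sum_pow_char]
    rw [Finset.sum_mul, ← Finset.sum_add_distrib]
    refine Finset.sum_congr rfl fun j _ => ?_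
    rcases kk_zero_or_one (M i j) with h | h <;> simp [h]
  exact congrArg (fun g => g f) this
theorem substM_Sq (M : Matrix (Fin 4) (Fin 4) kk) (k : ℕ) (f : P4) :
    substM M (Sq k f) = Sq k (substM M f) := by
  rw [sq_apply, sq_apply, substM_SS, Polynomial.coeff_map]; rfl
def sp (w : List ℕ) : List ℕ := w.map fun k => 2 ^ k - 1
theorem pc_sp : ∀ k ≤ 4, pc (2 ^ k - 1) = k := by decide
theorem cb_sp : ∀ k ≤ 4, ∀ i : Fin 4, cb (2 ^ k - 1) i = if (i : ℕ) < k then 1 else 0 := by decide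
theorem sp_spike (w : List ℕ) (h4 : ∀ k ∈ w, k ≤ 4) (hw : w.Pairwise (· ≥ ·)) (i : Fin 4) :
    (∃ a, ex (sp w) i + 1 = 2 ^ a) ∧ ((∀ k ∈ w, k ≤ (i : ℕ)) → ex (sp w) i = 0) := by
  induction w with
  | nil => exact ⟨⟨0, by simp [sp, ex]⟩, fun _ => rfl⟩
  | cons k w ih =>
    rw [List.pairwise_cons] at hw
    obtain ⟨⟨a, ha⟩, h2⟩ := ih (fun k hk => h4 k (by simp [hk])) hw.2
    have e : ex (sp (k :: w)) i = (if (i : ℕ) < k then 1 else 0) + 2 * ex (sp w) i := by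
      rw [← cb_sp k (h4 k (by simp)) i]; rfl
    by_cases hi : (i : ℕ) < k
    · rw [e, if_pos hi]
      refine ⟨⟨a + 1, by rw [pow_succ]; omega⟩, fun h => ?_⟩
      have := h k (by simp); omega
    · have h3 := h2 fun j hj => by have := hw.1 j hj; omega
      rw [e, if_neg hi, h3]
      exact ⟨⟨0, rfl⟩, fun _ => rfl⟩
theorem ph_HH (M : Matrix (Fin 4) (Fin 4) kk) (w : List ℕ) (h4 : ∀ k ∈ w, k ≤ 4)
    (hw : w.Pairwise (· ≥ ·)) : HH ≤ LinearMap.ker (ph M (sp w)) := by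
  rw [HH, Submodule.span_le]
  rintro _ ⟨k, E, hk, rfl⟩
  simp only [SetLike.mem_coe, LinearMap.mem_ker, ph, LinearMap.comp_apply, AlgHom.toLinearMap_apply,
    substM_Sq]
  exact cf_spike _ (fun i => (sp_spike w h4 hw i).1) k hk _
theorem pc_zero : ∀ c, c < 16 → pc c = 0 → c = 0 := by
  have : ∀ c ∈ List.range 16, pc c = 0 → c = 0 := by decide
  intro c hc; exact this c (by simpa using hc)
def wl : ℕ → (Fin 4 → ℕ) → List ℕ
  | 0, _ => []
  | L + 1, E => wt E :: wl L (fun i => E i / 2)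
def num : List ℕ → ℕ
  | [] => 0
  | a :: w => a * 5 ^ w.length + num w
theorem wt_le (E : Fin 4 → ℕ) : wt E ≤ 4 := by simp [wt, Fin.sum_univ_four]; omega
theorem wl_len (L : ℕ) : ∀ E, (wl L E).length = L := by
  induction L with
  | zero => intro E; rfl
  | succ L ih => intro E; simp [wl, ih]
theorem wl_le (L : ℕ) : ∀ E, ∀ a ∈ wl L E, a ≤ 4 := by
  induction L with
  | zero => intro E; simp [wl]
  | succ L ih => intro E; simpa [wl, wt_le] using ih _
theorem num_lt (w : List ℕ) (h : ∀ a ∈ w, a ≤ 4) : num w < 5 ^ w.length := by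
  induction w with
  | nil => simp [num]
  | cons a w ih =>
    have h1 := ih fun x hx => h x (by simp [hx])
    have h2 := h a (by simp)
    simp only [num, List.length_cons, pow_succ]
    nlinarith
theorem num_cmp (L : ℕ) : ∀ E w, w.length = L → (∀ a ∈ w, a ≤ 4) →
    (ltw E w ↔ num (wl L E) < num w) ∧ (num (wl L E) = num w → wl L E = w) := by
  induction L with
  | zero => intro E w hw _; have : w = [] := by simpa using hw
            subst this; simp [ltw, wl]
  | succ L ih =>
    intro E w hw h4
    cases w with
    | nil => simp at hw
    | cons a w =>
      have hw' : w.length = L := by simpa using hw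
      obtain ⟨h1, h2⟩ := ih (fun i => E i / 2) w hw' fun x hx => h4 x (by simp [hx])
      have h3 := num_lt _ (wl_le L fun i => E i / 2)
      have h5 := num_lt w fun x hx => h4 x (by simp [hx])
      simp only [wl, num, ltw, wl_len, hw', h1] at h3 h5 ⊢
      have tri := lt_trichotomy (wt E) a
      generalize num (wl L fun i => E i / 2) = x at *
      generalize 5 ^ L = q at *
      rcases tri with h | h | h
      · have : (wt E + 1) * q ≤ a * q := Nat.mul_le_mul_right _ h
        refine ⟨⟨fun _ => by nlinarith, fun _ => Or.inl h⟩, fun h' => by nlinarith⟩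
      · subst h
        refine ⟨⟨fun h => by rcases h with h | h <;> omega, fun h => Or.inr ⟨rfl, by omega⟩⟩, fun h => ?_⟩
        rw [h2 (by omega)]
      · have : (a + 1) * q ≤ wt E * q := Nat.mul_le_mul_right _ h
        refine ⟨⟨fun h => by rcases h with h | h <;> omega, fun _ => by nlinarith⟩, fun h' => by nlinarith⟩
theorem masks (L : ℕ) : ∀ E : Fin 4 → ℕ, (∀ i, E i < 2 ^ L) → ∃ l : List ℕ, l.map pc = wl L E ∧
    (∀ c ∈ l, c < 16) ∧ ex l = E ∧ DD (wl L E) = ∑ i, E i := by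
  induction L with
  | zero =>
    intro E h
    refine ⟨[], rfl, by simp, ?_, ?_⟩
    · funext i; have := h i; simp [ex] at *; omega
    · rw [Finset.sum_eq_zero]; · rfl
      intro i _; have := h i; simpa using this
  | succ L ih =>
    intro E h
    obtain ⟨l, h1, h2, h3, h4⟩ := ih (fun i => E i / 2) fun i => by have := h i; rw [pow_succ] at this; omega
    obtain ⟨c, hc, hp, he⟩ := split2 E
    refine ⟨c :: l, by simp [wl, h1, hp], by simpa [hc] using h2, ?_, ?_⟩
    · rw [ex, h3]; exact he.symm
    · simp only [wl, DD, h4, wt, Finset.mul_sum, ← Finset.sum_add_distrib]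
      refine Finset.sum_congr rfl fun i _ => ?_
      omega
theorem mono_zeros (l : List ℕ) (k : ℕ) : mono (l ++ List.replicate k 0) = mono l := by
  have : ex (List.replicate k 0) = 0 := by
    induction k with
    | zero => rfl
    | succ k ih => rw [List.replicate_succ, ex, ih]; funext i; simp [cb]
  rw [mono, ex_append, this]; simp [mono]
def AA (n L N : ℕ) : Submodule kk P4 :=
  Submodule.span kk {p | ∃ E, ∑ i, E i = n ∧ num (wl L E) < N ∧ p = xp E}
theorem NN_comp (n L : ℕ) (w : List ℕ) (hw : w.length = L) (h4 : ∀ a ∈ w, a ≤ 4) (f : P4) (hf : f ∈ NN w) :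
    homogeneousComponent n f ∈ HH ⊔ AA n L (num w) := by
  obtain ⟨a, ha, b, hb, rfl⟩ := Submodule.mem_sup.mp hf
  rw [map_add]
  refine Submodule.add_mem _ (Submodule.mem_sup_left ?_) (Submodule.mem_sup_right ?_)
  · have : HH ≤ HH.comap (homogeneousComponent n) := by
      conv_lhs => rw [HH]
      rw [Submodule.span_le]
      rintro _ ⟨k, E, hk, rfl⟩
      simp only [SetLike.mem_coe, Submodule.mem_comap]
      rw [homogeneousComponent_of_mem (sq_homog k E)]
      split_ifs
      · exact Sq_mem_HH k hk _
      · exact Submodule.zero_mem _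
    exact this ha
  · have : Low w ≤ (AA n L (num w)).comap (homogeneousComponent n) := by
      rw [Low, Submodule.span_le]
      rintro _ ⟨E, hE, rfl⟩
      simp only [SetLike.mem_coe, Submodule.mem_comap]
      rw [homogeneousComponent_of_mem (xp_homog E)]
      split_ifs with h
      · exact Submodule.subset_span ⟨E, h.symm, ((num_cmp L E w hw h4).1).mp hE, rfl⟩
      · exact Submodule.zero_mem _
    exact this hb
abbrev Mat := Matrix (Fin 4) (Fin 4) kk
def Spn (τ : List ℕ) (B : List ℕ → kk) : Prop :=
  ∃ Ms : List Mat, (∀ M ∈ Ms, IsUnit M) ∧ ∀ l, l.map pc = τ → (∀ c ∈ l, c < 16) →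
    B l = (Ms.map fun M => (List.zipWith (pl M) (sp τ) l).prod).sum
theorem sp_pc (τ : List ℕ) (h : ∀ k ∈ τ, k ≤ 4) : (sp τ).map pc = τ := by
  rw [sp, List.map_map]
  conv_rhs => rw [← List.map_id τ]
  exact List.map_congr_left fun k hk => pc_sp k (h k hk)
theorem mainU (n : ℕ) (Gd : List ℕ → Prop)
    (hcls : ∀ w, (∀ a ∈ w, a ≤ 4) → DD w = n → Kn w ∨ ∃ τ z, Gd τ ∧ Z z ∧ w = τ ++ z)
    (hgd : ∀ τ, Gd τ → (∀ k ∈ τ, k ≤ 4) ∧ τ.Pairwise (· ≥ ·))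
    (hsp : ∀ τ z, Gd τ → ∀ lam : P4 →ₗ[kk] kk, NN (τ ++ z) ≤ LinearMap.ker lam →
      Spn τ fun l => lam (mono l))
    (f : P4) (hf : f ∈ homog n) (h0 : ∀ τ, Gd τ → ∀ M : Mat, IsUnit M → ph M (sp τ) f = 0) :
    f ∈ hitSub n := by
  apply HH_hit n f hf
  have key : ∀ N, ∀ f ∈ AA n (n + 1) N,
      (∀ τ, Gd τ → ∀ M : Mat, IsUnit M → ph M (sp τ) f = 0) → f ∈ HH := by
    clear h0 hf f
    intro N
    induction N with
    | zero =>
      intro f hf _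
      have : AA n (n + 1) 0 = ⊥ := by
        rw [AA, Submodule.span_eq_bot]
        rintro _ ⟨E, _, h, _⟩; omega
      rw [this, Submodule.mem_bot] at hf
      rw [hf]; exact Submodule.zero_mem _
    | succ N ih =>
      intro f hf h0
      have h1 : f ∈ Submodule.span kk {p | ∃ E, ∑ i, E i = n ∧ num (wl (n + 1) E) = N ∧ p = xp E} ⊔
          AA n (n + 1) N := by
        rw [AA, ← Submodule.span_union]
        refine Submodule.span_mono ?_ hf
        rintro _ ⟨E, h, h', rfl⟩
        rcases Nat.lt_succ_iff_lt_or_eq.mp h' with h' | h'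
        · exact Or.inr ⟨E, h, h', rfl⟩
        · exact Or.inl ⟨E, h, h', rfl⟩
      obtain ⟨f1, hf1, f2, hf2, rfl⟩ := Submodule.mem_sup.mp h1
      by_cases hE : ∃ E0 : Fin 4 → ℕ, ∑ i, E0 i = n ∧ num (wl (n + 1) E0) = N
      · obtain ⟨E0, hE0, hN⟩ := hE
        set w := wl (n + 1) E0 with hw
        have hlt : ∀ E : Fin 4 → ℕ, ∑ i, E i = n → ∀ i, E i < 2 ^ (n + 1) := by
          intro E h i
          have h2 : E i ≤ ∑ i, E i := Finset.single_le_sum (fun _ _ => Nat.zero_le _) (Finset.mem_univ i)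
          have h3 : n + 1 < 2 ^ (n + 1) := Nat.lt_two_pow_self
          omega
        have hwlen : w.length = n + 1 := wl_len _ _
        have hw4 : ∀ a ∈ w, a ≤ 4 := wl_le _ _
        have hD : DD w = n := by
          obtain ⟨_, _, _, _, h⟩ := masks (n + 1) E0 (hlt E0 hE0)
          rw [hw, h, hE0]
        have hl : ∀ E : Fin 4 → ℕ, ∑ i, E i = n → num (wl (n + 1) E) = N →
            ∃ l : List ℕ, l.map pc = w ∧ (∀ c ∈ l, c < 16) ∧ xp E = mono l := by
          intro E h h'
          obtain ⟨l, h2, h3, h4, -⟩ := masks (n + 1) E (hlt E h)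
          refine ⟨l, ?_, h3, by rw [mono, h4]⟩
          rw [h2]; exact (num_cmp (n + 1) E w hwlen hw4).2 (by rw [h', hN])
        have hNN : f1 ∈ NN w := by
          rcases hcls w hw4 hD with hk | ⟨τ, z, hg, hz, hwz⟩
          · have : Submodule.span kk {p | ∃ E, ∑ i, E i = n ∧ num (wl (n + 1) E) = N ∧ p = xp E} ≤ NN w := by
              rw [Submodule.span_le]
              rintro _ ⟨E, h, h', rfl⟩
              obtain ⟨l, h2, h3, h4⟩ := hl E h h'
              rw [h4]; exact hk l h2 h3
            exact this hf1
          · by_contra hnot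
            obtain ⟨lam, hne, hker⟩ := Submodule.exists_le_ker_of_notMem hnot
            rw [hwz] at hker
            obtain ⟨Ms, hMs, hB⟩ := hsp τ z hg lam hker
            obtain ⟨hg4, hgp⟩ := hgd τ hg
            have e1 : lam f1 = (Ms.map fun M => ph M (sp τ) f1).sum := by
              have e2 : Submodule.span kk {p | ∃ E, ∑ i, E i = n ∧ num (wl (n + 1) E) = N ∧ p = xp E} ≤
                  LinearMap.ker (lam - (Ms.map fun M => ph M (sp τ)).sum) := by
                rw [Submodule.span_le]
                rintro _ ⟨E, h, h', rfl⟩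
                obtain ⟨l, h2, h3, h4⟩ := hl E h h'
                rw [hwz, List.map_eq_append_iff] at h2
                obtain ⟨l', z', rfl, h5, h6⟩ := h2
                have hz' : z' = List.replicate z'.length 0 := by
                  rw [List.eq_replicate_iff]
                  refine ⟨rfl, fun c hc => ?_⟩
                  have h7 : pc c ∈ z := by rw [← h6]; exact List.mem_map_of_mem hc
                  obtain ⟨k, rfl⟩ := hz
                  have h8 := List.eq_of_mem_replicate h7
                  have h9 := h3 c (by simp [hc])
                  exact pc_zero c h9 h8
                have h7 : xp E = mono l' := by rw [h4, hz', mono_zeros]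
                have h8 : lam (mono l') = _ := hB l' h5 fun c hc => h3 c (by simp [hc])
                simp only [SetLike.mem_coe, LinearMap.mem_ker, LinearMap.sub_apply, h7]
                rw [h8, sub_eq_zero]
                have : ∀ Ms : List Mat, (Ms.map fun M => ph M (sp τ)).sum (mono l') =
                    (Ms.map fun M => ph M (sp τ) (mono l')).sum := by
                  intro Ms
                  induction Ms with
                  | nil => simp
                  | cons a Ms ih => simp [ih]
                rw [this]
                congr 1
                refine List.map_congr_left fun M _ => ?_
                rw [ph_mono M (sp τ) l' (by rw [h5, sp_pc τ hg4])]
              have e3 := e2 hf1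
              rw [LinearMap.mem_ker, LinearMap.sub_apply, sub_eq_zero] at e3
              rw [e3]
              clear e3 e2 hB hMs
              induction Ms with
              | nil => simp
              | cons a Ms ih => simp [ih]
            apply hne
            rw [e1]
            apply List.sum_eq_zero
            intro x hx
            obtain ⟨M, hM, rfl⟩ := List.mem_map.mp hx
            have e4 := h0 τ hg M (hMs M hM)
            have e5 : ph M (sp τ) f2 = 0 := by
              have : AA n (n + 1) N ≤ LinearMap.ker (ph M (sp τ)) := by
                rw [AA, Submodule.span_le]
                rintro _ ⟨E, h, h', rfl⟩
                refine ph_low M (sp τ) z hz E ?_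
                rw [sp_pc τ hg4, ← hwz]
                exact ((num_cmp (n + 1) E w hwlen hw4).1).mpr (by rw [hN]; exact h')
              exact this hf2
            rw [map_add, e5, add_zero] at e4
            exact e4
        have h2 := NN_comp n (n + 1) w hwlen hw4 f1 hNN
        have h3 : homogeneousComponent n f1 = f1 := by
          have : f1 ∈ homog n := by
            refine (Submodule.span_le.mpr ?_ : _ ≤ homog n) hf1
            rintro _ ⟨E, h, h', rfl⟩
            rw [← h]; exact xp_homog E
          rw [homogeneousComponent_of_mem this, if_pos rfl]
        rw [h3, hN] at h2
        obtain ⟨a, ha, b, hb, rfl⟩ := Submodule.mem_sup.mp h2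
        rw [add_assoc]
        refine Submodule.add_mem _ ha (ih _ (Submodule.add_mem _ hb hf2) ?_)
        intro τ hg M hM
        have e1 := h0 τ hg M hM
        obtain ⟨hg4, hgp⟩ := hgd τ hg
        have e2 : ph M (sp τ) a = 0 := ph_HH M τ hg4 hgp ha
        rw [add_assoc, map_add, e2, zero_add] at e1
        exact e1
      · have : f1 = 0 := by
          have h3 : {p | ∃ E, ∑ i, E i = n ∧ num (wl (n + 1) E) = N ∧ p = xp E} = (∅ : Set P4) := by
            ext p; simp only [Set.mem_setOf_eq, Set.mem_empty_iff_false, iff_false]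
            rintro ⟨E, h, h', _⟩; exact hE ⟨E, h, h'⟩
          rw [h3, Submodule.span_empty, Submodule.mem_bot] at hf1
          exact hf1
        subst this
        rw [zero_add] at h0 ⊢
        exact ih f2 hf2 h0
  refine key (5 ^ (n + 1)) f ?_ h0
  have h1 := homog_le_span n f hf
  refine Submodule.span_mono ?_ h1
  rintro _ ⟨E, h, rfl⟩
  refine ⟨E, h, ?_, rfl⟩
  have := num_lt _ (wl_le (n + 1) E)
  rwa [wl_len] at this
def kb (b : Bool) : kk := if b then 1 else 0
theorem kb_xor (a b : Bool) : kb (a ^^ b) = kb a + kb b := by cases a <;> cases b <;> decide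
theorem kb_and (a b : Bool) : kb (a && b) = kb a * kb b := by cases a <;> cases b <;> decide
def tb (c i : ℕ) : Bool := c / 2 ^ i % 2 == 1
def rows (c : ℕ) : List ℕ := [0, 1, 2, 3].filter (tb c)
def Mm (cl : List ℕ) : Mat := fun i j => kb (tb (cl.getD j 0) i)
def pb (cl : List ℕ) : List ℕ → ℕ → Bool
  | [], S => S == 0
  | i :: r, S => [0, 1, 2, 3].foldl
      (fun acc j => acc ^^ (tb S j && (tb (cl.getD j 0) i && pb cl r (S - 2 ^ j)))) false
def pbc (cl : List ℕ) (S c : ℕ) : Bool := pb cl (rows c) S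
def lf (M : Mat) (i : Fin 4) : P4 := ∑ j, M i j • X j
theorem cf_lf (M : Mat) (i : Fin 4) (g : P4) (E : Fin 4 → ℕ) :
    cf E (lf M i * g) = ∑ j, if 1 ≤ E j then M i j * cf (E - Pi.single j 1) g else 0 := by
  classical
  rw [lf, Finset.sum_mul, map_sum]
  refine Finset.sum_congr rfl fun j _ => ?_
  rw [smul_mul_assoc, map_smul]
  have h : (X j : P4) = xp (Pi.single j 1) := by
    rw [xp, Finset.prod_eq_single j]
    · simp
    · intro b _ hb; rw [Pi.single_eq_of_ne hb, pow_zero]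
    · simp
  rw [mul_comm, h, cf_mul_xp]
  have h2 : Pi.single j 1 ≤ E ↔ 1 ≤ E j := by
    constructor
    · intro h; simpa using h j
    · intro h k
      by_cases hk : k = j
      · subst hk; simpa using h
      · rw [Pi.single_eq_of_ne hk]; exact Nat.zero_le _
  by_cases h3 : 1 ≤ E j
  · rw [if_pos (h2.mpr h3), if_pos h3]; rfl
  · rw [if_neg (fun h => h3 (h2.mp h)), if_neg h3]; simp
theorem cb_sub : ∀ S < 16, ∀ j : Fin 4, (1 ≤ cb S j ↔ tb S j = true) ∧
    (tb S j = true → cb S - Pi.single j 1 = cb (S - 2 ^ (j : ℕ))) := by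
  decide +kernel
theorem cb_zero : ∀ S < 16, (cb S = 0 ↔ S = 0) := by decide +kernel
theorem pb_sound (cl : List ℕ) (r : List ℕ) (hr : ∀ i ∈ r, i < 4) : ∀ S < 16,
    cf (cb S) ((r.map fun i => lf (Mm cl) (Fin.ofNat 4 i)).prod) = kb (pb cl r S) := by
  induction r with
  | nil =>
    intro S hS
    have : (1 : P4) = xp 0 := xp_zero.symm
    rw [List.map_nil, List.prod_nil, this, cf_xp, pb]
    have := cb_zero S hS
    by_cases h : S = 0
    · rw [if_pos (this.mpr h)]; subst h; rfl
    · rw [if_neg (fun h' => h (this.mp h'))]; simp [kb, h]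
  | cons i r ih =>
    intro S hS
    have ih := ih fun i hi => hr i (by simp [hi])
    have hi := hr i (by simp)
    rw [List.map_cons, List.prod_cons, cf_lf]
    have key : ∀ j : Fin 4, (if 1 ≤ cb S j then Mm cl (Fin.ofNat 4 i) j *
        cf (cb S - Pi.single j 1) ((r.map fun i => lf (Mm cl) (Fin.ofNat 4 i)).prod) else 0) =
        kb (tb S j && (tb (cl.getD j 0) i && pb cl r (S - 2 ^ (j : ℕ)))) := by
      intro j
      obtain ⟨h1, h2⟩ := cb_sub S hS j
      by_cases h : tb S j = true
      · rw [if_pos (h1.mpr h), h2 h, ih _ (lt_of_le_of_lt (Nat.sub_le _ _) hS), h, kb_and, kb_and, Mm]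
        simp [kb, Nat.mod_eq_of_lt hi]
      · rw [if_neg (fun h' => h (h1.mp h'))]
        simp [h, kb]
    rw [Finset.sum_congr rfl fun j _ => key j, Fin.sum_univ_four]
    simp only [pb, List.foldl, kb_xor]
    have : kb false = 0 := rfl
    rw [this, zero_add]
    rfl
theorem rows_lt (c : ℕ) : ∀ i ∈ rows c, i < 4 := by
  intro i hi
  have := (List.mem_filter.mp hi).1
  simp at this; omega
theorem cb_rows : ∀ c < 16, ∀ i : Fin 4, cb c i = if tb c i = true then 1 else 0 := by decide +kernel
theorem pl_pb (cl : List ℕ) (S c : ℕ) (hS : S < 16) (hc : c < 16) : pl (Mm cl) S c = kb (pbc cl S c) := by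
  rw [pbc, ← pb_sound cl (rows c) (rows_lt c) S hS, pl]
  congr 1
  rw [xp, map_prod, Fin.prod_univ_four]
  simp only [map_pow, substM, aeval_X, cb_rows c hc, rows]
  simp only [List.filter]
  have h : ∀ i : Fin 4, (∑ j, Mm cl i j • X j : P4) = lf (Mm cl) i := fun i => rfl
  simp only [h]
  have e0 : Fin.ofNat 4 0 = (0 : Fin 4) := rfl
  have e1 : Fin.ofNat 4 1 = (1 : Fin 4) := rfl
  have e2 : Fin.ofNat 4 2 = (2 : Fin 4) := rfl
  have e3 : Fin.ofNat 4 3 = (3 : Fin 4) := rfl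
  have f0 : ((0 : Fin 4) : ℕ) = 0 := rfl
  have f1 : ((1 : Fin 4) : ℕ) = 1 := rfl
  have f2 : ((2 : Fin 4) : ℕ) = 2 := rfl
  have f3 : ((3 : Fin 4) : ℕ) = 3 := rfl
  rw [f0, f1, f2, f3]
  cases tb c 0 <;> cases tb c 1 <;> cases tb c 2 <;> cases tb c 3 <;> 
    simp only [List.map_cons, List.map_nil, List.prod_cons, List.prod_nil, e0, e1, e2, e3, if_true,
      pow_one, pow_zero, one_mul, mul_one, mul_assoc, reduceIte, Bool.false_eq_true]
theorem pl_det (M : Mat) : pl M 15 15 = M.det := by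
  have hc : ∀ i, cb 15 i = 1 := by decide
  have : pl M 15 15 = cf (cb 15) (lf M 0 * (lf M 1 * (lf M 2 * (lf M 3 * 1)))) := by
    rw [pl]
    congr 1
    rw [xp, map_prod, Fin.prod_univ_four]
    simp only [substM, aeval_X, hc, pow_one, mul_one, mul_assoc]
    rfl
  rw [this, Matrix.det_succ_row_zero]
  have h1 : ∀ E, cf E 1 = if E = 0 then 1 else 0 := by
    intro E; rw [← xp_zero, cf_xp]
  have hcb : cb 15 = ![1,1,1,1] := by decide
  have s0 : (Pi.single (0 : Fin 4) 1 : Fin 4 → ℕ) = ![1,0,0,0] := by decide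
  have s1 : (Pi.single (1 : Fin 4) 1 : Fin 4 → ℕ) = ![0,1,0,0] := by decide
  have s2 : (Pi.single (2 : Fin 4) 1 : Fin 4 → ℕ) = ![0,0,1,0] := by decide
  have s3 : (Pi.single (3 : Fin 4) 1 : Fin 4 → ℕ) = ![0,0,0,1] := by decide
  simp only [cf_lf, Fin.sum_univ_four, h1, hcb, s0, s1, s2, s3]
  simp [Matrix.det_fin_three, Matrix.submatrix, Fin.succAbove]
  have n2 : ∀ x y : kk, x - y = x + y := fun x y => CharTwo.sub_eq_add x y
  simp [n2]
  ring
def unitb (cl : List ℕ) : Bool := pbc cl 15 15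
theorem unit_iff (M : Mat) : IsUnit M ↔ pl M 15 15 = 1 := by
  rw [pl_det, Matrix.isUnit_iff_isUnit_det, isUnit_iff_ne_zero]
  rcases kk_zero_or_one M.det with h | h <;> simp [h]
theorem unitb_unit {cl : List ℕ} (h : unitb cl = true) : IsUnit (Mm cl) := by
  rw [unit_iff, pl_pb _ _ _ (by norm_num) (by norm_num)]
  rw [unitb] at h; rw [h]; rfl
theorem exists_cl (M : Mat) : ∃ a < 16, ∃ b < 16, ∃ c < 16, ∃ d < 16, M = Mm [a, b, c, d] := by
  have key : ∀ v : Fin 4 → kk, ∃ a < 16, ∀ i : Fin 4, v i = kb (tb a i) := by decide +kernel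
  obtain ⟨a, ha, ha'⟩ := key fun i => M i 0
  obtain ⟨b, hb, hb'⟩ := key fun i => M i 1
  obtain ⟨c, hc, hc'⟩ := key fun i => M i 2
  obtain ⟨d, hd, hd'⟩ := key fun i => M i 3
  refine ⟨a, ha, b, hb, c, hc, d, hd, ?_⟩
  funext i j
  fin_cases j
  · exact ha' i
  · exact hb' i
  · exact hc' i
  · exact hd' i
def PermInv (Al : Finset ℕ) (a : ℕ) (F : List ℕ → kk) : Prop :=
  ∀ l l' : List ℕ, l.Perm l' → (∀ c ∈ l, c ∈ Al) → l.length = a → F l = F l'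
theorem perm_of_swap (Al : Finset ℕ) (a : ℕ) (F : List ℕ → kk)
    (h : ∀ P Q c d, (∀ x ∈ P, x ∈ Al) → (∀ x ∈ Q, x ∈ Al) → c ∈ Al → d ∈ Al → c ≠ d →
      P.length + Q.length + 2 = a → F (P ++ c :: d :: Q) = F (P ++ d :: c :: Q)) : PermInv Al a F := by
  have : ∀ l l' : List ℕ, l.Perm l' → ∀ P, (∀ c ∈ P, c ∈ Al) → (∀ c ∈ l, c ∈ Al) →
      P.length + l.length = a → F (P ++ l) = F (P ++ l') := by
    intro l l' hp
    induction hp with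
    | nil => intros; rfl
    | cons x _ ih =>
      intro P hP hl hlen
      have := ih (P ++ [x]) (by
        intro c hc; rcases List.mem_append.mp hc with hc | hc
        · exact hP c hc
        · rw [List.mem_singleton] at hc; subst hc; exact hl _ (by simp)) (fun c hc => hl c (by simp [hc]))
        (by simp at hlen ⊢; omega)
      simpa using this
    | swap x y l =>
      intro P hP hl hlen
      by_cases hxy : y = x
      · rw [hxy]
      · exact h P l y x hP (fun c hc => hl c (by simp [hc])) (hl _ (by simp)) (hl _ (by simp)) hxy
          (by simp at hlen; omega)
    | trans h1 _ ih1 ih2 =>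
      intro P hP hl hlen
      rw [ih1 P hP hl hlen]
      exact ih2 P hP (fun c hc => hl c (h1.mem_iff.mpr hc)) (by rw [← h1.length_eq]; exact hlen)
  intro l l' hp hl hlen
  simpa using this l l' hp [] (by simp) hl (by simpa using hlen)
theorem nodup_iff (l : List ℕ) : l.Nodup ↔ l.toFinset.card = l.length := by
  refine ⟨List.toFinset_card_of_nodup, fun h => ?_⟩
  rw [List.card_toFinset] at h
  have := (List.dedup_sublist l).eq_of_length h
  rw [← this]; exact List.nodup_dedup l
theorem supp_inv (Al : Finset ℕ) : ∀ (a : ℕ) (F : List ℕ → kk), PermInv Al a F →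
    (∀ c d Q, c ∈ Al → d ∈ Al → c ≠ d → (∀ x ∈ Q, x ∈ Al) → Q.length + 3 = a →
      F (c :: c :: d :: Q) = F (d :: d :: c :: Q)) →
    ∀ l l' : List ℕ, (∀ x ∈ l, x ∈ Al) → (∀ x ∈ l', x ∈ Al) → l.length = a → l'.length = a →
      l.toFinset = l'.toFinset → F l = F l' := by
  intro a
  induction a with
  | zero => intro F _ _ l l' _ _ h1 h2 _; simp at h1 h2; rw [h1, h2]
  | succ a ih =>
    intro F hp ht l l' hl hl' h1 h2 hs
    by_cases hn : l.Nodup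
    · have hn' : l'.Nodup := by
        rw [nodup_iff] at hn ⊢; rw [← hs, hn, h1, h2]
      exact hp l l' (List.perm_of_nodup_nodup_toFinset_eq hn hn' hs) hl h1
    · have hn' : ¬ l'.Nodup := by
        intro hn'; apply hn
        rw [nodup_iff] at hn' ⊢; rw [hs, hn', h1, h2]
      have dup : ∀ l : List ℕ, ¬ l.Nodup → ∃ c l0, l.Perm (c :: l0) ∧ c ∈ l0 := by
        intro l h
        rw [← List.exists_duplicate_iff_not_nodup] at h
        obtain ⟨c, hc⟩ := h
        refine ⟨c, l.erase c, List.perm_cons_erase hc.mem, ?_⟩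
        rw [← List.count_pos_iff, List.count_erase_self]
        have := List.duplicate_iff_two_le_count.mp hc
        omega
      obtain ⟨c, l0, hc, hc0⟩ := dup l hn
      obtain ⟨d, l0', hd, hd0⟩ := dup l' hn'
      have k1 : ∀ x ∈ l0, x ∈ Al := fun x hx => hl x (hc.mem_iff.mpr (by simp [hx]))
      have k2 : ∀ x ∈ l0', x ∈ Al := fun x hx => hl' x (hd.mem_iff.mpr (by simp [hx]))
      have s0 : l.toFinset = l0.toFinset := by
        rw [List.toFinset_eq_of_perm _ _ hc, List.toFinset_cons, Finset.insert_eq_of_mem (by simpa using hc0)]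
      have s0' : l'.toFinset = l0'.toFinset := by
        rw [List.toFinset_eq_of_perm _ _ hd, List.toFinset_cons, Finset.insert_eq_of_mem (by simpa using hd0)]
      have ll0 : l0.length = a := by have := hc.length_eq; simp at this; omega
      have ll0' : l0'.length = a := by have := hd.length_eq; simp at this; omega
      rw [hp l _ hc hl h1, hp l' _ hd hl' h2]
      have e : F (d :: l0') = F (c :: l0') := by
        by_cases hcd : c = d
        · rw [hcd]
        · have hc' : c ∈ l0' := by
            have : c ∈ l0'.toFinset := by rw [← s0', ← hs, s0]; simpa using hc0
            simpa using this
          have p1 : l0'.Perm (d :: c :: (l0'.erase d).erase c) :=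
            (List.perm_cons_erase hd0).trans ((List.perm_cons_erase ((List.mem_erase_of_ne hcd).mpr hc')).cons d)
          set l2 := (l0'.erase d).erase c
          have k3 : ∀ x ∈ l2, x ∈ Al := fun x hx => k2 x (p1.mem_iff.mpr (by simp [hx]))
          have len := p1.length_eq
          simp only [List.length_cons] at len
          have m1 : ∀ x ∈ d :: l0', x ∈ Al := fun x hx => hl' x (hd.mem_iff.mpr hx)
          have m2 : ∀ x ∈ c :: l0', x ∈ Al := by
            intro x hx
            rcases List.mem_cons.mp hx with rfl | hx
            · exact k2 _ hc'
            · exact k2 _ hx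
          rw [hp (d :: l0') _ (p1.cons d) m1 (by simp [ll0']),
            hp (c :: l0') (c :: c :: d :: l2) ((p1.trans (List.Perm.swap c d l2)).cons c) m2 (by simp [ll0'])]
          exact (ht c d l2 (k2 _ hc') (k2 _ hd0) hcd k3 (by omega)).symm
      rw [e]
      have hcA : c ∈ Al := k1 c hc0
      refine ih (fun l => F (c :: l)) ?_ ?_ l0 l0' k1 k2 ll0 ll0' (by rw [← s0, hs, s0'])
      · intro m m' hm hA hlen
        exact hp _ _ (hm.cons c) (by
          intro x hx
          rcases List.mem_cons.mp hx with rfl | hx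
          · exact hcA
          · exact hA _ hx) (by simp [hlen])
      · intro x y Q hx hy hxy hQ hlen
        have q : ∀ x y, x ∈ Al → y ∈ Al → F (c :: x :: x :: y :: Q) = F (x :: x :: y :: c :: Q) := by
          intro x y hx hy
          refine hp _ _ ?_ ?_ (by simp; omega)
          · have := (List.perm_middle (a := c) (l₁ := [x, x, y]) (l₂ := Q)).symm
            simpa using this
          · intro u hu
            simp only [List.mem_cons] at hu
            rcases hu with rfl | rfl | rfl | rfl | hu
            all_goals first | assumption | exact hQ _ hu
        show F (c :: x :: x :: y :: Q) = F (c :: y :: y :: x :: Q)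
        rw [q x y hx hy, q y x hy hx]
        exact ht x y (c :: Q) hx hy hxy (by
          intro u hu; rcases List.mem_cons.mp hu with rfl | hu
          · exact hcA
          · exact hQ _ hu) (by simp; omega)
def ind (z : Finset ℕ) (c : ℕ) : kk := if c ∈ z then 1 else 0
def Bz (Al : Finset ℕ) (G : Finset ℕ → kk) (z : Finset ℕ) : kk :=
  ∑ T ∈ Al.powerset.filter (fun T => z ⊆ T), G T
theorem prod_ind (z : Finset ℕ) (l : List ℕ) : (l.map (ind z)).prod = if l.toFinset ⊆ z then 1 else 0 := by
  induction l with
  | nil => simp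
  | cons c l ih =>
    rw [List.map_cons, List.prod_cons, ih, ind, List.toFinset_cons]
    by_cases h : c ∈ z <;> by_cases h' : l.toFinset ⊆ z <;> simp [h, h', Finset.insert_subset_iff]
theorem moebius (Al : Finset ℕ) (G : Finset ℕ → kk) (S : Finset ℕ) (hS : S ⊆ Al) :
    G S = ∑ z ∈ Al.powerset, (if S ⊆ z then 1 else 0) * Bz Al G z := by
  simp only [Bz, Finset.sum_filter, Finset.mul_sum]
  rw [Finset.sum_comm]
  rw [Finset.sum_eq_single S]
  · rw [Finset.sum_eq_single S]
    · simp
    · intro z _ hz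
      by_cases h : S ⊆ z
      · rw [if_neg (fun h' => hz (Finset.Subset.antisymm h' h)), mul_zero]
      · rw [if_neg h, zero_mul]
    · intro h; exact absurd (Finset.mem_powerset.mpr hS) h
  · intro T hT hne
    rw [Finset.mem_powerset] at hT
    have e : ∀ z, (if S ⊆ z then (1 : kk) else 0) * (if z ⊆ T then G T else 0) =
        if S ⊆ z ∧ z ⊆ T then G T else 0 := by
      intro z; by_cases h1 : S ⊆ z <;> by_cases h2 : z ⊆ T <;> simp [h1, h2]
    simp only [e]
    rw [← Finset.sum_filter, Finset.sum_const]
    have e2 : Al.powerset.filter (fun z => S ⊆ z ∧ z ⊆ T) = Finset.Icc S T := by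
      ext z
      simp only [Finset.mem_filter, Finset.mem_powerset, Finset.mem_Icc]
      exact ⟨fun h => h.2, fun h => ⟨h.2.trans hT, h⟩⟩
    rw [e2]
    by_cases hST : S ⊆ T
    · rw [Finset.card_Icc_finset hST]
      have : T.card - S.card ≠ 0 := by
        have := Finset.card_lt_card (Finset.ssubset_iff_subset_ne.mpr ⟨hST, Ne.symm hne⟩)
        omega
      obtain ⟨k, hk⟩ := Nat.exists_eq_succ_of_ne_zero this
      rw [hk, pow_succ, mul_smul, two_nsmul, CharTwo.add_self_eq_zero, smul_zero]
    · rw [Finset.Icc_eq_empty (by simpa using hST)]; simp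
  · intro h; exact absurd (Finset.mem_powerset.mpr hS) h
theorem Bz_insert (Al : Finset ℕ) (G : Finset ℕ → kk) (z : Finset ℕ) (c : ℕ) (hc : c ∈ Al) :
    Bz Al (fun T => G (insert c T)) z = ind z c * Bz Al G z := by
  by_cases h : c ∈ z
  · rw [ind, if_pos h, one_mul]
    refine Finset.sum_congr rfl fun T hT => ?_
    show G (insert c T) = G T
    rw [Finset.insert_eq_of_mem ((Finset.mem_filter.mp hT).2 h)]
  · rw [ind, if_neg h, zero_mul, Bz]
    refine Finset.sum_involution (fun T _ => if c ∈ T then T.erase c else insert c T) ?_ ?_ ?_ ?_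
    · intro T _
      by_cases hT : c ∈ T
      · simp [hT, Finset.insert_erase hT, CharTwo.add_self_eq_zero]
      · simp [hT, CharTwo.add_self_eq_zero]
    · intro T _ _ he
      by_cases hT : c ∈ T
      · rw [if_pos hT] at he; rw [← he] at hT; simp at hT
      · rw [if_neg hT] at he; apply hT; rw [← he]; simp
    · intro T hT
      rw [Finset.mem_filter, Finset.mem_powerset] at hT ⊢
      split_ifs with hcT
      · exact ⟨(Finset.erase_subset _ _).trans hT.1, fun x hx => Finset.mem_erase.mpr
          ⟨fun he => h (he ▸ hx), hT.2 hx⟩⟩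
      · exact ⟨Finset.insert_subset hc hT.1, hT.2.trans (Finset.subset_insert _ _)⟩
    · intro T _
      by_cases hT : c ∈ T
      · simp [hT, Finset.insert_erase hT]
      · simp [hT]
theorem Bz_union (Al : Finset ℕ) (z : Finset ℕ) (t : List ℕ) : ∀ (G : Finset ℕ → kk), (∀ c ∈ t, c ∈ Al) →
    Bz Al (fun T => G (t.toFinset ∪ T)) z = (t.map (ind z)).prod * Bz Al G z := by
  induction t with
  | nil => intro G _; simp
  | cons c t ih =>
    intro G h
    have h1 := ih (fun T => G (insert c T)) fun x hx => h x (by simp [hx])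
    rw [Bz_insert Al G z c (h c (by simp))] at h1
    rw [List.map_cons, List.prod_cons, mul_comm (ind z c), mul_assoc, ← h1]
    simp [List.toFinset_cons, Finset.insert_union]
theorem Bz_zero (Al : Finset ℕ) (z : Finset ℕ) (hz : z.Nonempty) (ι : List (Finset ℕ → kk))
    (h : ∀ T ⊆ Al, T.Nonempty → (ι.map fun G => G T).sum = 0) : (ι.map fun G => Bz Al G z).sum = 0 := by
  have : (ι.map fun G => Bz Al G z).sum = Bz Al (fun T => (ι.map fun G => G T).sum) z := by
    clear h
    induction ι with
    | nil => simp [Bz]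
    | cons a ι ih => rw [List.map_cons, List.sum_cons, ih]; simp only [List.map_cons, List.sum_cons, Bz, Finset.sum_add_distrib]
  rw [this, Bz]
  refine Finset.sum_eq_zero fun T hT => ?_
  rw [Finset.mem_filter, Finset.mem_powerset] at hT
  exact h T hT.1 (hz.mono hT.2)
theorem oneblock (Al fr : Finset ℕ) (a : ℕ) (B : List ℕ → kk) (π : ℕ → Finset ℕ) (hfr : fr ⊆ Al)
    (hne : fr.Nonempty)
    (hπ : ∀ c ∈ Al, π c ⊆ fr) (hπ' : ∀ c ∈ fr, π c = {c}) (hp : PermInv Al a B)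
    (h1 : ∀ c Q, c ∈ Al → (∀ x ∈ Q, x ∈ Al) → Q.length + 1 = a → B (c :: Q) = ∑ j ∈ π c, B (j :: Q))
    (h3 : ∀ c d Q, c ∈ fr → d ∈ fr → c ≠ d → (∀ x ∈ Q, x ∈ Al) → Q.length + 3 = a →
      B (c :: c :: d :: Q) = B (d :: d :: c :: Q)) :
    ∃ m : Finset ℕ → kk, ∀ l, (∀ x ∈ l, x ∈ Al) → l.length = a →
      B l = ∑ y ∈ fr.powerset.erase ∅, m y * (l.map fun c => ∑ j ∈ π c, ind y j).prod := by
  classical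
  cases a with
  | zero =>
    refine ⟨fun y => if y = fr then B [] else 0, ?_⟩
    intro l _ hl
    have : l = [] := by simpa using hl
    subst this
    rw [Finset.sum_eq_single fr]
    · simp
    · intro b _ hb; simp [hb]
    · intro h; exfalso; apply h; simp [hne.ne_empty]
  | succ a =>
  have hs := supp_inv fr (a + 1) B (fun l l' hll hl hlen => hp l l' hll (fun x hx => hfr (hl x hx)) hlen)
    (fun c d Q hc hd hcd hQ hlen => h3 c d Q hc hd hcd (fun x hx => hfr (hQ x hx)) hlen)
  let G : Finset ℕ → kk := fun S => if h : ∃ l : List ℕ, (∀ x ∈ l, x ∈ fr) ∧ l.length = a + 1 ∧ l.toFinset = S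
    then B h.choose else 0
  have hG : ∀ l : List ℕ, (∀ x ∈ l, x ∈ fr) → l.length = a + 1 → B l = G l.toFinset := by
    intro l hl hlen
    have h : ∃ l' : List ℕ, (∀ x ∈ l', x ∈ fr) ∧ l'.length = a + 1 ∧ l'.toFinset = l.toFinset := ⟨l, hl, hlen, rfl⟩
    have e : G l.toFinset = B h.choose := dif_pos h
    rw [e]
    obtain ⟨q1, q2, q3⟩ := h.choose_spec
    exact hs _ _ hl q1 hlen q2 q3.symm
  refine ⟨Bz fr G, ?_⟩
  have key : ∀ l P, (∀ x ∈ P, x ∈ fr) → (∀ x ∈ l, x ∈ Al) → P.length + l.length = a + 1 →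
      B (P ++ l) = ∑ y ∈ fr.powerset.erase ∅, Bz fr G y * ((P ++ l).map fun c => ∑ j ∈ π c, ind y j).prod := by
    intro l
    induction l with
    | nil =>
      intro P hP _ hlen
      rw [List.append_nil, hG P hP (by simpa using hlen), moebius fr G P.toFinset (fun x hx => hP x (by simpa using hx))]
      have hz : Bz fr G ∅ * (if P.toFinset ⊆ ∅ then 1 else 0) = 0 := by
        rw [if_neg, mul_zero]
        intro h
        rw [Finset.subset_empty, List.toFinset_eq_empty_iff] at h
        subst h; simp at hlen
      rw [← Finset.sum_erase (a := ∅) _ (by rw [mul_comm]; exact hz)]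
      refine Finset.sum_congr rfl fun y _ => ?_
      rw [mul_comm, ← prod_ind]
      congr 2
      refine List.map_congr_left fun c hc => ?_
      rw [hπ' c (hP c hc)]; simp
    | cons c l ih =>
      intro P hP hl hlen
      have hc : c ∈ Al := hl c (by simp)
      have hl' : ∀ x ∈ l, x ∈ Al := fun x hx => hl x (by simp [hx])
      have hPl : ∀ x ∈ P ++ l, x ∈ Al := by
        intro x hx; rcases List.mem_append.mp hx with hx | hx
        · exact hfr (hP x hx)
        · exact hl' x hx
      have mid : ∀ j ∈ Al, B (P ++ j :: l) = B (j :: (P ++ l)) := by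
        intro j hj
        refine hp _ _ List.perm_middle ?_ (by simp at hlen ⊢; omega)
        intro x hx
        rw [List.mem_append, List.mem_cons] at hx
        rcases hx with hx | rfl | hx
        · exact hfr (hP x hx)
        · exact hj
        · exact hl' x hx
      rw [mid c hc, h1 c (P ++ l) hc hPl (by simp at hlen ⊢; omega)]
      have step : ∀ j ∈ π c, B (j :: (P ++ l)) = ∑ y ∈ fr.powerset.erase ∅, Bz fr G y *
          (ind y j * ((P ++ l).map fun c => ∑ j ∈ π c, ind y j).prod) := by
        intro j hj
        have hjf := hπ c hc hj
        rw [← mid j (hfr hjf)]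
        have := ih (P ++ [j]) (by
          intro x hx; rcases List.mem_append.mp hx with hx | hx
          · exact hP x hx
          · rw [List.mem_singleton] at hx; subst hx; exact hjf) hl' (by simp at hlen ⊢; omega)
        rw [List.append_assoc, List.singleton_append] at this
        rw [this]
        refine Finset.sum_congr rfl fun y _ => ?_
        rw [(List.perm_middle.map _).prod_eq]
        simp [hπ' j hjf]
      rw [Finset.sum_congr rfl step, Finset.sum_comm]
      refine Finset.sum_congr rfl fun y _ => ?_
      rw [← Finset.mul_sum, ← Finset.sum_mul, (List.perm_middle.map _).prod_eq]
      simp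
  intro l hl hlen
  simpa using key l [] (by simp) hl (by simpa using hlen)
def alp (k : ℕ) : List ℕ := (List.range 16).filter fun c => pc c == k
def Al (k : ℕ) : Finset ℕ := (alp k).toFinset
theorem mem_Al {k c : ℕ} : c ∈ Al k ↔ c < 16 ∧ pc c = k := by simp [Al, alp]
def frl (ki : ℕ) (zl : List ℕ) : List ℕ :=
  (alp ki).filter fun c => Nat.land c (zl.headD 0) == c || Nat.land c (zl.headD 0) == zl.headD 0
def qz (zl : List ℕ) (r : List (ℕ × ℕ)) : List ℕ := (r.filter fun x => zl.contains x.2).map (·.1)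
def okr (zl fr : List ℕ) (c : ℕ) (r : List (ℕ × ℕ)) : Bool :=
  (qz zl r).contains c && decide (qz zl r).Nodup && ((qz zl r).erase c).all fr.contains
def piv (rels : List (List (ℕ × ℕ))) (zl fr : List ℕ) (c : ℕ) : List ℕ :=
  if fr.contains c then [c] else (qz zl ((rels.find? (okr zl fr c)).getD [])).erase c
def R15 : List ℕ := [1, 2, 4, 8, 3, 5, 6, 9, 10, 12, 7, 11, 13, 14, 15]
def tst (k : ℕ) (fi : ℕ → Bool) (cl : List ℕ) : Bool := (alp k).all fun c => pbc cl (2 ^ k - 1) c == fi c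
def fcl (ki ko : ℕ) (fi fo : ℕ → Bool) : Bool :=
  let t := fun k cl => (k != ki || tst ki fi cl) && (k != ko || tst ko fo cl)
  R15.any fun a => t 1 [a] && R15.any fun b => t 2 [a, b] && R15.any fun c => t 3 [a, b, c] &&
    [1, 2, 4, 8].any fun d => unitb [a, b, c, d] && tst ki fi [a, b, c, d] && tst ko fo [a, b, c, d]
def odl (l : List ℕ) : Bool := l.length % 2 == 1
def chkz (ki ko : ℕ) (rels : List (List (ℕ × ℕ))) (krels : List (List (List ℕ))) (zl : List ℕ) : Bool :=
  zl.isEmpty || (krels.any fun r => (r.filter fun t => t.all zl.contains).length % 2 == 1) ||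
  (!(frl ki zl).isEmpty && ((frl ki zl).all fun c => (frl ki zl).all fun d => c + d != 15) &&
    ((alp ki).all fun c => (frl ki zl).contains c || rels.any (okr zl (frl ki zl) c)) &&
    ((frl ki zl).sublists.all fun yl => yl.isEmpty ||
      fcl ki ko (fun c => odl ((piv rels zl (frl ki zl) c).filter yl.contains)) zl.contains))
theorem fcl_sound {ki ko : ℕ} {fi fo : ℕ → Bool} (h : fcl ki ko fi fo = true) : ∃ cl, unitb cl = true ∧
    (∀ c ∈ Al ki, pbc cl (2 ^ ki - 1) c = fi c) ∧ (∀ c ∈ Al ko, pbc cl (2 ^ ko - 1) c = fo c) := by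
  simp only [fcl, List.any_eq_true, Bool.and_eq_true, tst, List.all_eq_true, beq_iff_eq] at h
  obtain ⟨a, _, _, b, _, _, c, _, _, d, _, ⟨h1, h2⟩, h3⟩ := h
  exact ⟨_, h1, fun c hc => h2 c (by simpa [Al] using hc), fun c hc => h3 c (by simpa [Al] using hc)⟩
def Rp (ki ko a b : ℕ) (A : List ℕ → List ℕ → kk) : Prop :=
  ∃ L : List (List ℕ), (∀ cl ∈ L, unitb cl = true) ∧ ∀ li lo, (∀ c ∈ li, c ∈ Al ki) → (∀ c ∈ lo, c ∈ Al ko) →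
    li.length = a → lo.length = b → A li lo = (L.map fun cl =>
      (li.map fun c => kb (pbc cl (2 ^ ki - 1) c)).prod * (lo.map fun c => kb (pbc cl (2 ^ ko - 1) c)).prod).sum
theorem Rp_zero (ki ko a b : ℕ) : Rp ki ko a b fun _ _ => 0 := ⟨[], by simp, by simp⟩
theorem Rp_add {ki ko a b : ℕ} {A A' : List ℕ → List ℕ → kk} (h : Rp ki ko a b A) (h' : Rp ki ko a b A') :
    Rp ki ko a b fun x y => A x y + A' x y := by
  obtain ⟨L, h1, h2⟩ := h
  obtain ⟨L', h1', h2'⟩ := h'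
  refine ⟨L ++ L', ?_, ?_⟩
  · intro cl hcl; rcases List.mem_append.mp hcl with h | h
    · exact h1 _ h
    · exact h1' _ h
  · intro li lo a1 a2 a3 a4
    show A li lo + A' li lo = _
    rw [h2 li lo a1 a2 a3 a4, h2' li lo a1 a2 a3 a4, List.map_append, List.sum_append]
theorem Rp_smul {ki ko a b : ℕ} {A : List ℕ → List ℕ → kk} (m : kk) (h : Rp ki ko a b A) :
    Rp ki ko a b fun x y => m * A x y := by
  rcases kk_zero_or_one m with rfl | rfl
  · simpa using Rp_zero ki ko a b
  · simpa using h
theorem Rp_sum {ι : Type*} {ki ko a b : ℕ} (s : Finset ι) (A : ι → List ℕ → List ℕ → kk)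
    (h : ∀ i ∈ s, Rp ki ko a b (A i)) : Rp ki ko a b fun x y => ∑ i ∈ s, A i x y := by
  classical
  induction s using Finset.induction_on with
  | empty => simpa using Rp_zero ki ko a b
  | insert i s hi ih =>
    simp only [Finset.sum_insert hi]
    exact Rp_add (h i (by simp)) (ih fun j hj => h j (by simp [hj]))
theorem Rp_congr {ki ko a b : ℕ} {A A' : List ℕ → List ℕ → kk} (h : Rp ki ko a b A)
    (he : ∀ li lo, (∀ c ∈ li, c ∈ Al ki) → (∀ c ∈ lo, c ∈ Al ko) → li.length = a → lo.length = b →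
      A' li lo = A li lo) : Rp ki ko a b A' := by
  obtain ⟨L, h1, h2⟩ := h
  exact ⟨L, h1, fun li lo a1 a2 a3 a4 => by rw [he li lo a1 a2 a3 a4, h2 li lo a1 a2 a3 a4]⟩
theorem kb_odl (y : List ℕ) (l : List ℕ) : kb (odl (l.filter y.contains)) = (l.map (ind y.toFinset)).sum := by
  induction l with
  | nil => rfl
  | cons c l ih =>
    rw [List.map_cons, List.sum_cons, ← ih, ind, List.filter_cons]
    by_cases h : c ∈ y
    · simp only [List.contains_iff_mem, h, if_true, List.mem_toFinset, odl, List.length_cons]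
      rcases Nat.mod_two_eq_zero_or_one (l.filter y.contains).length with h | h <;> simp [Nat.add_mod, h] <;> decide
    · simp [h]
theorem assemble (ki ko a b : ℕ) (rels : List (List (ℕ × ℕ))) (krels : List (List (List ℕ)))
    (hr : ∀ r ∈ rels, ∀ x ∈ r, x.1 ∈ Al ki ∧ x.2 ∈ Al ko) (hkr : ∀ r ∈ krels, ∀ t ∈ r, ∀ c ∈ t, c ∈ Al ko)
    (hchk : ((alp ko).sublists.all fun zl => chkz ki ko rels krels zl) = true)
    (hb : 1 ≤ b) (A : List ℕ → List ℕ → kk) (G : List ℕ → Finset ℕ → kk)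
    (hG : ∀ li lo, (∀ c ∈ li, c ∈ Al ki) → (∀ c ∈ lo, c ∈ Al ko) → li.length = a → lo.length = b →
      A li lo = G li lo.toFinset)
    (hp : ∀ T ⊆ Al ko, T.Nonempty → PermInv (Al ki) a fun l => G l T)
    (ht : ∀ T ⊆ Al ko, T.Nonempty → ∀ c d Q, c ∈ Al ki → d ∈ Al ki → c ≠ d → c + d ≠ 15 →
      (∀ x ∈ Q, x ∈ Al ki) → Q.length + 3 = a → G (c :: c :: d :: Q) T = G (d :: d :: c :: Q) T)
    (hrel : ∀ r ∈ rels, ∀ T ⊆ Al ko, T.Nonempty → ∀ Q, (∀ x ∈ Q, x ∈ Al ki) → Q.length + 1 = a →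
      (r.map fun x => G (x.1 :: Q) (insert x.2 T)).sum = 0)
    (hkill : ∀ r ∈ krels, ∀ T ⊆ Al ko, T.Nonempty → ∀ l, (∀ x ∈ l, x ∈ Al ki) → l.length = a →
      (r.map fun t => G l (t.toFinset ∪ T)).sum = 0) :
    Rp ki ko a b A := by
  classical
  have e1 : ∀ li lo, (∀ c ∈ li, c ∈ Al ki) → (∀ c ∈ lo, c ∈ Al ko) → li.length = a → lo.length = b →
      A li lo = ∑ z ∈ (Al ko).powerset.erase ∅, (lo.map (ind z)).prod * Bz (Al ko) (G li) z := by
    intro li lo a1 a2 a3 a4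
    rw [hG li lo a1 a2 a3 a4, moebius (Al ko) (G li) lo.toFinset (fun x hx => a2 x (by simpa using hx))]
    have h0 : (if lo.toFinset ⊆ ∅ then (1 : kk) else 0) * Bz (Al ko) (G li) ∅ = 0 := by
      rw [if_neg, zero_mul]
      intro h
      rw [Finset.subset_empty, List.toFinset_eq_empty_iff] at h
      subst h; simp at a4; omega
    rw [← Finset.sum_erase (a := ∅) _ h0]
    refine Finset.sum_congr rfl fun y _ => ?_
    rw [prod_ind]
  refine Rp_congr (Rp_sum ((Al ko).powerset.erase ∅)
    (fun z li lo => (lo.map (ind z)).prod * Bz (Al ko) (G li) z) ?_) e1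
  intro z hz
  rw [Finset.mem_erase, Finset.mem_powerset] at hz
  have hzn : z.Nonempty := Finset.nonempty_iff_ne_empty.mpr hz.1
  set zl := (alp ko).filter (· ∈ z) with hzl
  have hzz : zl.toFinset = z := by
    ext c; simp only [hzl, List.mem_toFinset, List.mem_filter, decide_eq_true_eq]
    exact ⟨fun h => h.2, fun h => ⟨by simpa [Al] using hz.2 h, h⟩⟩
  have hmz : ∀ c, zl.contains c = true ↔ c ∈ z := by
    intro c; rw [← hzz]; simp
  have hck : chkz ki ko rels krels zl = true := by
    rw [List.all_eq_true] at hchk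
    exact hchk zl (List.mem_sublists.mpr List.filter_sublist)
  have hne : zl.isEmpty = false := by
    rw [List.isEmpty_eq_false_iff]
    rintro h
    rw [h] at hzz; exact hz.1 hzz.symm
  rw [chkz, hne, Bool.false_or, Bool.or_eq_true] at hck
  rcases hck with hck | hck
  · -- killed
    rw [List.any_eq_true] at hck
    obtain ⟨r, hrm, hodd⟩ := hck
    refine Rp_congr (Rp_zero ki ko a b) ?_
    intro li lo a1 a2 a3 a4
    have h1 := Bz_zero (Al ko) z hzn (r.map fun t T => G li (t.toFinset ∪ T)) (by
      intro T hT hTn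
      have := hkill r hrm T hT hTn li a1 a3
      simpa [List.map_map, Function.comp_def] using this)
    rw [List.map_map] at h1
    have h2 : ∀ r' : List (List ℕ), (∀ t ∈ r', ∀ c ∈ t, c ∈ Al ko) →
        (r'.map ((fun G => Bz (Al ko) G z) ∘ fun t T => G li (t.toFinset ∪ T))).sum =
        ((r'.filter fun t => t.all zl.contains).length : kk) * Bz (Al ko) (G li) z := by
      intro r' hr'
      induction r' with
      | nil => simp
      | cons t r' ih =>
        rw [List.map_cons, List.sum_cons, ih fun t ht => hr' t (by simp [ht]), Function.comp,
          Bz_union (Al ko) z t (G li) (hr' t (by simp)), prod_ind, List.filter_cons]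
        have : (t.all zl.contains = true) ↔ t.toFinset ⊆ z := by
          rw [List.all_eq_true]
          constructor
          · intro h c hc; exact (hmz c).mp (h c (by simpa using hc))
          · intro h c hc; exact (hmz c).mpr (h (by simpa using hc))
        by_cases h : t.toFinset ⊆ z
        · rw [if_pos h, if_pos (this.mpr h), List.length_cons]; push_cast; ring
        · rw [if_neg h, if_neg (fun h' => h (this.mp h'))]; ring
    rw [h2 r (hkr r hrm)] at h1
    have h3 : ((r.filter fun t => t.all zl.contains).length : kk) = 1 := by
      rw [beq_iff_eq] at hodd
      rw [← ZMod.natCast_mod, hodd]; rfl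
    rw [h3, one_mul] at h1
    rw [h1, mul_zero]
  · simp only [Bool.and_eq_true, List.all_eq_true, bne_iff_ne, Bool.or_eq_true, List.any_eq_true,
      List.contains_iff_mem, Bool.not_eq_true', List.isEmpty_eq_false_iff] at hck
    obtain ⟨⟨⟨hf1, hf2⟩, hf3⟩, hf4⟩ := hck
    set fr := frl ki zl with hfr
    have hfrA : fr.toFinset ⊆ Al ki := by
      intro c hc
      rw [List.mem_toFinset, hfr, frl, List.mem_filter] at hc
      simpa [Al] using hc.1
    have hq : ∀ c ∈ Al ki, c ∉ fr → ∃ r ∈ rels, piv rels zl fr c = (qz zl r).erase c ∧ okr zl fr c r = true := by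
      intro c hc hcf
      obtain ⟨r, hr1, hr2⟩ := (hf3 c (by simpa [Al] using hc)).resolve_left hcf
      have : (rels.find? (okr zl fr c)).isSome := by
        rw [List.find?_isSome]; exact ⟨r, hr1, hr2⟩
      obtain ⟨r', hr'⟩ := Option.isSome_iff_exists.mp this
      refine ⟨r', List.mem_of_find?_eq_some hr', ?_, List.find?_some hr'⟩
      rw [piv, if_neg (by simpa using hcf), hr']; rfl
    have hnd : ∀ c ∈ Al ki, (piv rels zl fr c).Nodup ∧ ∀ x ∈ piv rels zl fr c, x ∈ fr := by
      intro c hc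
      by_cases hcf : c ∈ fr
      · rw [piv, if_pos (by simpa using hcf)]; simpa using hcf
      · obtain ⟨r, _, h1, h2⟩ := hq c hc hcf
        rw [okr, Bool.and_eq_true, Bool.and_eq_true, List.all_eq_true, decide_eq_true_eq] at h2
        rw [h1]
        exact ⟨h2.1.2.erase c, fun x hx => by simpa using h2.2 x hx⟩
    have hB := oneblock (Al ki) fr.toFinset a (fun l => Bz (Al ko) (G l) z)
      (fun c => (piv rels zl fr c).toFinset) hfrA (List.toFinset_nonempty_iff _ |>.mpr hf1)
      (fun c hc x hx => by rw [List.mem_toFinset] at hx ⊢; exact (hnd c hc).2 x hx)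
      (fun c hc => by
        rw [piv, if_pos (by simpa using hc)]; rfl)
      (by
        intro l l' hll hl hlen
        refine Finset.sum_congr rfl fun T hT => ?_
        rw [Finset.mem_filter, Finset.mem_powerset] at hT
        exact hp T hT.1 (hzn.mono hT.2) l l' hll hl hlen)
      (by
        intro c Q hc hQ hlen
        by_cases hcf : c ∈ fr
        · rw [piv, if_pos (by simpa using hcf)]; simp
        · obtain ⟨r, hrm, h1, h2⟩ := hq c hc hcf
          rw [okr, Bool.and_eq_true, Bool.and_eq_true, List.all_eq_true, decide_eq_true_eq] at h2
          have h3 := Bz_zero (Al ko) z hzn (r.map fun x T => G (x.1 :: Q) (insert x.2 T)) (by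
            intro T hT hTn
            have := hrel r hrm T hT hTn Q hQ hlen
            simpa [List.map_map, Function.comp_def] using this)
          rw [List.map_map] at h3
          have h4 : ∀ r' : List (ℕ × ℕ), (∀ x ∈ r', x.2 ∈ Al ko) →
              (r'.map ((fun G => Bz (Al ko) G z) ∘ fun x T => G (x.1 :: Q) (insert x.2 T))).sum =
              ((qz zl r').map fun i => Bz (Al ko) (G (i :: Q)) z).sum := by
            intro r' hr'
            induction r' with
            | nil => rfl
            | cons x r' ih =>
              rw [List.map_cons, List.sum_cons, ih fun x hx => hr' x (by simp [hx]), Function.comp,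
                Bz_insert (Al ko) (G (x.1 :: Q)) z x.2 (hr' x (by simp)), ind, qz, qz, List.filter_cons]
              by_cases hx : x.2 ∈ z
              · rw [if_pos hx, if_pos ((hmz _).mpr hx)]; simp
              · rw [if_neg hx, if_neg (fun h => hx ((hmz _).mp h))]; simp
          rw [h4 r fun x hx => (hr r hrm x hx).2] at h3
          have h5 : c ∈ qz zl r := by simpa using h2.1.1
          rw [((List.perm_cons_erase h5).map _).sum_eq, List.map_cons, List.sum_cons] at h3
          rw [List.sum_toFinset _ (hnd c hc).1, h1]
          exact CharTwo.add_eq_zero.mp h3)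
      (by
        intro c d Q hc hd hcd hQ hlen
        refine Finset.sum_congr rfl fun T hT => ?_
        rw [Finset.mem_filter, Finset.mem_powerset] at hT
        exact ht T hT.1 (hzn.mono hT.2) c d Q (hfrA hc) (hfrA hd) hcd
          (hf2 c (by simpa using hc) d (by simpa using hd)) hQ hlen)
    obtain ⟨m, hm⟩ := hB
    refine Rp_congr (Rp_sum (fr.toFinset.powerset.erase ∅) (fun y li lo => m y *
      ((li.map fun c => ∑ j ∈ (piv rels zl fr c).toFinset, ind y j).prod * (lo.map (ind z)).prod)) ?_) ?_
    · intro y hy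
      apply Rp_smul
      rw [Finset.mem_erase, Finset.mem_powerset] at hy
      set yl := fr.filter (· ∈ y) with hyl
      have hyy : yl.toFinset = y := by
        ext c; simp only [hyl, List.mem_toFinset, List.mem_filter, decide_eq_true_eq]
        exact ⟨fun h => h.2, fun h => ⟨by simpa using hy.2 h, h⟩⟩
      have h1 := (hf4 yl (List.mem_sublists.mpr List.filter_sublist)).resolve_left (by
        intro h
        rw [List.isEmpty_iff] at h
        rw [h] at hyy; exact hy.1 hyy.symm)
      obtain ⟨cl, g1, g2, g3⟩ := fcl_sound h1
      refine ⟨[cl], by simpa using g1, ?_⟩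
      intro li lo a1 a2 a3 a4
      simp only [List.map_cons, List.map_nil, List.sum_cons, List.sum_nil, add_zero]
      congr 2
      · refine List.map_congr_left fun c hc => ?_
        rw [g2 c (a1 c hc), kb_odl, hyy, List.sum_toFinset _ (hnd c (a1 c hc)).1]
      · refine List.map_congr_left fun c hc => ?_
        rw [g3 c (a2 c hc), ind, kb]
        by_cases h : c ∈ z
        · rw [if_pos h, if_pos ((hmz c).mpr h)]
        · rw [if_neg h, if_neg (fun h' => h ((hmz c).mp h'))]
    · intro li lo a1 a2 a3 a4
      have e : Bz (Al ko) (G li) z = _ := hm li a1 a3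
      rw [e, Finset.mul_sum]
      refine Finset.sum_congr rfl fun y _ => ?_
      ring
def isrel (w0 : List ℕ) (r : List (List ℕ)) : Bool :=
  rd.any fun d => d.1 == w0 && prms.any fun p => (d.2.1.map fun t => t.map (pm p)) == r
structure Cx where
  lam : P4 →ₗ[kk] kk
  f : ℕ
  k1 : ℕ
  a : ℕ
  k2 : ℕ
  b : ℕ
  z : List ℕ
  ker : NN (List.replicate f 4 ++ (List.replicate a k1 ++ List.replicate b k2) ++ z) ≤ LinearMap.ker lam
namespace Cx
variable (X : Cx)
def A (l1 l2 : List ℕ) : kk := X.lam (mono (List.replicate X.f 15 ++ (l1 ++ l2)))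
theorem relx {w0 : List ℕ} {r : List (List ℕ)} (h : isrel w0 r = true) (P Q w : List ℕ)
    (hw : P.map pc ++ (w0 ++ w) = List.replicate X.f 4 ++ (List.replicate X.a X.k1 ++ List.replicate X.b X.k2) ++ X.z) :
    (r.map fun t => X.lam (mono (P ++ (t ++ Q)))).sum = 0 := by
  simp only [isrel, List.any_eq_true, Bool.and_eq_true, beq_iff_eq] at h
  obtain ⟨d, hd, rfl, p, hp, rfl⟩ := h
  have h1 := rel_perm (List.all_eq_true.mp rd_ok d hd) hp P Q w
  rw [hw] at h1
  have h2 := X.ker h1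
  rw [LinearMap.mem_ker, map_list_sum] at h2
  rw [List.map_map] at h2 ⊢
  exact h2
theorem map_pc {l : List ℕ} {k : ℕ} (h : ∀ c ∈ l, c ∈ Al k) : l.map pc = List.replicate l.length k := by
  rw [List.eq_replicate_iff]
  refine ⟨by simp, fun x hx => ?_⟩
  obtain ⟨c, hc, rfl⟩ := List.mem_map.mp hx
  exact (mem_Al.mp (h c hc)).2
theorem rel1 {j : ℕ} {r : List (List ℕ)} (h : isrel (List.replicate j X.k1) r = true) {P Q l2 : List ℕ}
    (hP : ∀ c ∈ P, c ∈ Al X.k1) (hlen : P.length + j + Q.length = X.a) :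
    (r.map fun t => X.A (P ++ (t ++ Q)) l2).sum = 0 := by
  have := X.relx h (List.replicate X.f 15 ++ P) (Q ++ l2)
    (List.replicate Q.length X.k1 ++ (List.replicate X.b X.k2 ++ X.z)) (by
      rw [List.map_append, map_pc hP, List.map_replicate, ← hlen]
      simp only [List.replicate_add, List.append_assoc]
      rfl)
  simpa [A, List.append_assoc] using this
theorem rel2 {j : ℕ} {r : List (List ℕ)} (h : isrel (List.replicate j X.k2) r = true) {P Q l1 : List ℕ}
    (hl : ∀ c ∈ l1, c ∈ Al X.k1) (hl1 : l1.length = X.a)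
    (hP : ∀ c ∈ P, c ∈ Al X.k2) (hlen : P.length + j + Q.length = X.b) :
    (r.map fun t => X.A l1 (P ++ (t ++ Q))).sum = 0 := by
  have := X.relx h (List.replicate X.f 15 ++ (l1 ++ P)) Q
    (List.replicate Q.length X.k2 ++ X.z) (by
      rw [List.map_append, List.map_append, map_pc hP, map_pc hl, List.map_replicate, ← hlen, hl1]
      simp only [List.replicate_add, List.append_assoc]
      rfl)
  simpa [A, List.append_assoc] using this
theorem rel12 {i j : ℕ} {r : List (List ℕ × List ℕ)}
    (h : isrel (List.replicate i X.k1 ++ List.replicate j X.k2) (r.map fun t => t.1 ++ t.2) = true) {P Q : List ℕ}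
    (hP : ∀ c ∈ P, c ∈ Al X.k1) (h1 : P.length + i = X.a) (h2 : j + Q.length = X.b) :
    (r.map fun t => X.A (P ++ t.1) (t.2 ++ Q)).sum = 0 := by
  have := X.relx h (List.replicate X.f 15 ++ P) Q
    (List.replicate Q.length X.k2 ++ X.z) (by
      rw [List.map_append, map_pc hP, List.map_replicate, ← h1, ← h2]
      simp only [List.replicate_add, List.append_assoc]
      rfl)
  simpa [A, List.append_assoc, List.map_map, Function.comp_def] using this
theorem two {x y : kk} (h : [x, y].sum = 0) : x = y := by
  simp at h; exact CharTwo.add_eq_zero.mp h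
def swaps (k : ℕ) : Bool := (alp k).all fun c => (alp k).all fun d => c == d || isrel [k, k] [[c, d], [d, c]]
def trips (k : ℕ) : Bool := (alp k).all fun c => (alp k).all fun d => c == d || c + d == 15 ||
  isrel [k, k, k] [[c, c, d], [d, d, c]]
theorem swaps_ok : swaps 1 = true ∧ swaps 2 = true ∧ swaps 3 = true := by decide +kernel
theorem trips_ok : trips 1 = true ∧ trips 2 = true ∧ trips 3 = true := by decide +kernel
theorem swaps_k {k : ℕ} (h1 : 1 ≤ k) (h3 : k ≤ 3) : swaps k = true := by
  obtain ⟨a, b, c⟩ := swaps_ok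
  have : k = 1 ∨ k = 2 ∨ k = 3 := by omega
  rcases this with rfl | rfl | rfl
  · exact a
  · exact b
  · exact c
theorem trips_k {k : ℕ} (h1 : 1 ≤ k) (h3 : k ≤ 3) : trips k = true := by
  obtain ⟨a, b, c⟩ := trips_ok
  have : k = 1 ∨ k = 2 ∨ k = 3 := by omega
  rcases this with rfl | rfl | rfl
  · exact a
  · exact b
  · exact c
theorem swap_rel {k c d : ℕ} (h1 : 1 ≤ k) (h3 : k ≤ 3) (hc : c ∈ Al k) (hd : d ∈ Al k) (h : c ≠ d) :
    isrel (List.replicate 2 k) [[c, d], [d, c]] = true := by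
  have := swaps_k h1 h3
  simp only [swaps, List.all_eq_true, Bool.or_eq_true, beq_iff_eq] at this
  exact (this c (by simpa [Al] using hc) d (by simpa [Al] using hd)).resolve_left h
theorem trip_rel {k c d : ℕ} (h1 : 1 ≤ k) (h3 : k ≤ 3) (hc : c ∈ Al k) (hd : d ∈ Al k) (h : c ≠ d)
    (h' : c + d ≠ 15) : isrel (List.replicate 3 k) [[c, c, d], [d, d, c]] = true := by
  have := trips_k h1 h3
  simp only [trips, List.all_eq_true, Bool.or_eq_true, beq_iff_eq] at this
  exact (this c (by simpa [Al] using hc) d (by simpa [Al] using hd)).resolve_left (by tauto)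
theorem perm1 (h1 : 1 ≤ X.k1) (h3 : X.k1 ≤ 3) (l2 : List ℕ) : PermInv (Al X.k1) X.a fun l => X.A l l2 := by
  apply perm_of_swap
  intro P Q c d hP _ hc hd hcd hlen
  have := X.rel1 (j := 2) (swap_rel h1 h3 hc hd hcd) (P := P) (Q := Q) (l2 := l2) hP (by omega)
  exact two (by simpa using this)
theorem perm2 (h1 : 1 ≤ X.k2) (h3 : X.k2 ≤ 3) (l1 : List ℕ) (hl : ∀ c ∈ l1, c ∈ Al X.k1) (hl1 : l1.length = X.a) :
    PermInv (Al X.k2) X.b fun l => X.A l1 l := by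
  apply perm_of_swap
  intro P Q c d hP _ hc hd hcd hlen
  have := X.rel2 (j := 2) (swap_rel h1 h3 hc hd hcd) (P := P) (Q := Q) hl hl1 hP (by omega)
  exact two (by simpa using this)
theorem trip1 (h1 : 1 ≤ X.k1) (h3 : X.k1 ≤ 3) (l2 Q : List ℕ) {c d : ℕ} (hc : c ∈ Al X.k1) (hd : d ∈ Al X.k1)
    (h : c ≠ d) (h' : c + d ≠ 15) (hlen : Q.length + 3 = X.a) :
    X.A (c :: c :: d :: Q) l2 = X.A (d :: d :: c :: Q) l2 := by
  have := X.rel1 (j := 3) (trip_rel h1 h3 hc hd h h') (P := []) (Q := Q) (l2 := l2) (by simp) (by simp; omega)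
  exact two (by simpa using this)
theorem trip2 (h1 : 1 ≤ X.k2) (h3 : X.k2 ≤ 3) (l1 Q : List ℕ) (hl : ∀ c ∈ l1, c ∈ Al X.k1) (hl1 : l1.length = X.a)
    {c d : ℕ} (hc : c ∈ Al X.k2) (hd : d ∈ Al X.k2)
    (h : c ≠ d) (h' : c + d ≠ 15) (hlen : Q.length + 3 = X.b) :
    X.A l1 (c :: c :: d :: Q) = X.A l1 (d :: d :: c :: Q) := by
  have := X.rel2 (j := 3) (trip_rel h1 h3 hc hd h h') (P := []) (Q := Q) hl hl1 (by simp) (by simp; omega)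
  exact two (by simpa using this)
def pd (b : ℕ) (T : Finset ℕ) : List ℕ := T.toList ++ List.replicate (b - T.card) (T.toList.headD 0)
theorem pd_supp (b : ℕ) {T : Finset ℕ} (hT : T.Nonempty) : (pd b T).toFinset = T := by
  have h1 : T.toList.headD 0 ∈ T := by
    have h2 : T.toList ≠ [] := by simpa using hT.ne_empty
    rw [← Finset.mem_toList]
    cases h : T.toList with
    | nil => exact absurd h h2
    | cons a l => simp
  ext c
  simp only [pd, List.toFinset_append, Finset.toList_toFinset, Finset.mem_union, List.mem_toFinset, List.mem_replicate]
  constructor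
  · rintro (h | ⟨_, rfl⟩)
    · exact h
    · exact h1
  · exact Or.inl
theorem pd_len (b : ℕ) {T : Finset ℕ} (hT : T.card ≤ b) : (pd b T).length = b := by
  simp [pd]; omega
theorem pd_mem (b : ℕ) {T S : Finset ℕ} (hT : T.Nonempty) (hS : T ⊆ S) : ∀ c ∈ pd b T, c ∈ S := by
  intro c hc
  apply hS; rw [← pd_supp b hT]; simpa using hc
end Cx
theorem card_Al : (Al 1).card = 4 ∧ (Al 2).card = 6 ∧ (Al 3).card = 4 := by decide +kernel
def relsI : List (List (ℕ × ℕ)) := [[(6, 1), (5, 2), (3, 4)], [(10, 1), (9, 2), (3, 8)], [(12, 1), (9, 4), (5, 8)],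
  [(12, 2), (10, 4), (6, 8)]]
def relsII : List (List (ℕ × ℕ)) := [[(14, 1), (13, 2), (11, 4), (7, 8)]]
def relsIII : List (List (ℕ × ℕ)) := [[(13, 3), (11, 5), (7, 9)], [(14, 3), (11, 6), (7, 10)], [(14, 5), (13, 6), (7, 12)],
  [(14, 9), (13, 10), (11, 12)]]
def relsIV : List (List (ℕ × ℕ)) := [[(1, 14), (2, 13), (4, 11), (8, 7)]]
def krIII : List (List (List ℕ)) := [[[3, 12], [5, 10], [6, 9]]]
theorem chkI : ((alp 1).sublists.all fun zl => chkz 2 1 relsI [] zl) = true := by decide +kernel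
theorem chkII : ((alp 1).sublists.all fun zl => chkz 3 1 relsII [] zl) = true := by decide +kernel
theorem chkIII : ((alp 2).sublists.all fun zl => chkz 3 2 relsIII krIII zl) = true := by decide +kernel
theorem chkIV : ((alp 3).sublists.all fun zl => chkz 1 3 relsIV [] zl) = true := by decide +kernel
namespace Cx
variable (X : Cx)
def Sup2 : Prop := ∀ l1, (∀ c ∈ l1, c ∈ Al X.k1) → l1.length = X.a → ∀ l l' : List ℕ,
  (∀ x ∈ l, x ∈ Al X.k2) → (∀ x ∈ l', x ∈ Al X.k2) → l.length = X.b → l'.length = X.b →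
      l.toFinset = l'.toFinset → X.A l1 l = X.A l1 l'
theorem sup2 (h1 : 1 ≤ X.k2) (h3 : X.k2 ≤ 3) (h2 : X.k2 ≠ 2) : X.Sup2 := by
  intro l1 hl hl1
  refine supp_inv (Al X.k2) X.b _ (X.perm2 h1 h3 l1 hl hl1) ?_
  intro c d Q hc hd hcd _ hlen
  refine X.trip2 h1 h3 l1 Q hl hl1 hc hd hcd ?_ hlen
  have key : ∀ k ∈ [1, 3], ∀ c ∈ alp k, ∀ d ∈ alp k, c + d ≠ 15 := by decide
  exact key X.k2 (by simp; omega) c (by simpa [Al] using hc) d (by simpa [Al] using hd)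
theorem inc {r : List (ℕ × ℕ)} (hk1 : 1 ≤ X.k1) (hk3 : X.k1 ≤ 3) (hs : X.Sup2)
    (hr : ∀ x ∈ r, x.1 ∈ Al X.k1 ∧ x.2 ∈ Al X.k2)
    (h : isrel [X.k1, X.k2] (r.map fun x => [x.1, x.2]) = true) {T : Finset ℕ} (hT : T ⊆ Al X.k2) (hTn : T.Nonempty)
    (hc : T.card + 1 ≤ X.b) {Q : List ℕ} (hQ : ∀ x ∈ Q, x ∈ Al X.k1) (hlen : Q.length + 1 = X.a) :
    (r.map fun x => X.A (x.1 :: Q) (pd X.b (insert x.2 T))).sum = 0 := by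
  have h1 := X.rel12 (i := 1) (j := 1) (r := r.map fun x => ([x.1], [x.2])) (P := Q) (Q := pd (X.b - 1) T)
    (by rw [List.map_map]; exact h) hQ hlen (by rw [pd_len _ (by omega)]; omega)
  rw [← h1, List.map_map]
  congr 1
  refine List.map_congr_left fun x hx => ?_
  obtain ⟨hx1, hx2⟩ := hr x hx
  have hxQ : ∀ c ∈ x.1 :: Q, c ∈ Al X.k1 := by
    intro c hc; rcases List.mem_cons.mp hc with rfl | hc
    · exact hx1
    · exact hQ c hc
  have hcard : (insert x.2 T).card ≤ X.b := (Finset.card_insert_le _ _).trans hc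
  have hins : insert x.2 T ⊆ Al X.k2 := Finset.insert_subset hx2 hT
  have e1 : X.A (x.1 :: Q) (pd X.b (insert x.2 T)) = X.A (x.1 :: Q) (x.2 :: pd (X.b - 1) T) := by
    refine hs _ hxQ (by simpa using hlen) _ _ (pd_mem _ (by simp) hins) ?_ (pd_len _ hcard) ?_ ?_
    · intro c hc; rcases List.mem_cons.mp hc with rfl | hc
      · exact hx2
      · exact pd_mem _ hTn hT c hc
    · rw [List.length_cons, pd_len _ (by omega)]; omega
    · rw [pd_supp _ (by simp), List.toFinset_cons, pd_supp _ hTn]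
  rw [e1]
  exact X.perm1 hk1 hk3 _ (x.1 :: Q) (Q ++ [x.1]) (List.perm_append_comm (l₁ := [x.1])) hxQ (by simpa using hlen)
theorem typeA (hk1 : 1 ≤ X.k1) (hk3 : X.k1 ≤ 3) (hk2 : X.k2 = 1) (hb : 5 ≤ X.b)
    (rels : List (List (ℕ × ℕ)))
    (hr : (rels.all fun r => (r.all fun x => (alp X.k1).contains x.1 && (alp 1).contains x.2) &&
      isrel [X.k1, 1] (r.map fun x => [x.1, x.2])) = true)
    (hchk : ((alp 1).sublists.all fun zl => chkz X.k1 1 rels [] zl) = true) : Rp X.k1 X.k2 X.a X.b X.A := by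
  have hs := X.sup2 (by omega) (by omega) (by omega)
  simp only [List.all_eq_true, Bool.and_eq_true, List.contains_iff_mem] at hr
  have hr' : ∀ r ∈ rels, ∀ x ∈ r, x.1 ∈ Al X.k1 ∧ x.2 ∈ Al X.k2 := by
    intro r hrm x hx
    rw [hk2]
    obtain ⟨g1, g2⟩ := (hr r hrm).1 x hx
    exact ⟨by simpa [Al] using g1, by simpa [Al] using g2⟩
  have hcard : ∀ T ⊆ Al X.k2, T.card ≤ 4 := by
    intro T hT
    rw [hk2] at hT
    exact (Finset.card_le_card hT).trans card_Al.1.le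
  refine assemble X.k1 X.k2 X.a X.b rels [] hr' (by simp) (by rw [hk2]; exact hchk) (by omega) X.A
    (fun l T => X.A l (pd X.b T)) ?_ ?_ ?_ ?_ (by simp)
  · intro li lo a1 a2 a3 a4
    have hne : lo.toFinset.Nonempty := by
      rw [List.toFinset_nonempty_iff]; rintro rfl; simp at a4; omega
    have hsub : lo.toFinset ⊆ Al X.k2 := fun x hx => a2 x (by simpa using hx)
    exact hs li a1 a3 _ _ a2 (pd_mem _ hne hsub) a4 (pd_len _ (by have := hcard _ hsub; omega)) (pd_supp _ hne).symm
  · intro T _ _; exact X.perm1 hk1 hk3 _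
  · intro T _ _ c d Q hc hd hcd h15 _ hlen
    exact X.trip1 hk1 hk3 _ Q hc hd hcd h15 hlen
  · intro r hrm T hT hTn Q hQ hlen
    refine X.inc hk1 hk3 hs (hr' r hrm) (by rw [hk2]; exact (hr r hrm).2) hT hTn ?_ hQ hlen
    have := hcard T hT; omega
end Cx
theorem Rp_Spn (X : Cx) (h : Rp X.k1 X.k2 X.a X.b X.A) (hk1 : X.k1 ≤ 4) (hk2 : X.k2 ≤ 4) :
    Spn (List.replicate X.f 4 ++ (List.replicate X.a X.k1 ++ List.replicate X.b X.k2)) fun l => X.lam (mono l) := by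
  obtain ⟨L, h1, h2⟩ := h
  refine ⟨L.map Mm, ?_, ?_⟩
  · intro M hM
    obtain ⟨cl, hcl, rfl⟩ := List.mem_map.mp hM
    exact unitb_unit (h1 cl hcl)
  · intro l hl hl16
    rw [List.map_eq_append_iff] at hl
    obtain ⟨l0, l12, rfl, e0, hl⟩ := hl
    rw [List.map_eq_append_iff] at hl
    obtain ⟨li, lo, rfl, e1, e2⟩ := hl
    have key : ∀ (m : List ℕ) (n k : ℕ), (∀ c ∈ m, c < 16) → m.map pc = List.replicate n k →
        (∀ c ∈ m, c ∈ Al k) ∧ m.length = n := by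
      intro m n k hm he
      refine ⟨fun c hc => mem_Al.mpr ⟨hm c hc, ?_⟩, ?_⟩
      · exact List.eq_of_mem_replicate (by rw [← he]; exact List.mem_map_of_mem hc)
      · have := congrArg List.length he; simpa using this
    obtain ⟨p0, q0⟩ := key l0 _ _ (fun c hc => hl16 c (by simp [hc])) e0
    obtain ⟨p1, q1⟩ := key li _ _ (fun c hc => hl16 c (by simp [hc])) e1
    obtain ⟨p2, q2⟩ := key lo _ _ (fun c hc => hl16 c (by simp [hc])) e2
    have r0 : l0 = List.replicate X.f 15 := by
      rw [List.eq_replicate_iff]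
      refine ⟨q0, fun c hc => ?_⟩
      have : ∀ c ∈ alp 4, c = 15 := by decide
      exact this c (by simpa [Al] using p0 c hc)
    subst r0
    have := h2 li lo p1 p2 q1 q2
    rw [Cx.A] at this
    show X.lam _ = _
    rw [this, List.map_map]
    congr 1
    refine List.map_congr_left fun cl hcl => ?_
    have zw : ∀ (k n : ℕ) (m : List ℕ), k ≤ 4 → (∀ c ∈ m, c ∈ Al k) → m.length = n →
        List.zipWith (pl (Mm cl)) (sp (List.replicate n k)) m = m.map fun c => kb (pbc cl (2 ^ k - 1) c) := by
      intro k n m hk hm hn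
      subst hn
      induction m with
      | nil => rfl
      | cons c m ih =>
        rw [List.length_cons, List.replicate_succ, sp, List.map_cons, List.zipWith_cons_cons, List.map_cons]
        rw [pl_pb _ _ _ (by interval_cases k <;> norm_num) (mem_Al.mp (hm c (by simp))).1]
        congr 1
        exact ih fun c hc => hm c (by simp [hc])
    have spa : ∀ x y, sp (x ++ y) = sp x ++ sp y := fun x y => List.map_append
    rw [Function.comp, spa, spa, List.zipWith_append (by simp [sp]), List.zipWith_append (by simp [sp, q1]),
      zw 4 _ _ (by norm_num) p0 q0, zw _ _ _ hk1 p1 q1, zw _ _ _ hk2 p2 q2, List.prod_append, List.prod_append]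
    have hu : kb (pbc cl 15 15) = 1 := by
      have := h1 cl hcl
      rw [unitb] at this
      rw [this]; rfl
    simp [hu]
def rok (k1 k2 : ℕ) (rels : List (List (ℕ × ℕ))) : Bool :=
  rels.all fun r => (r.all fun x => (alp k1).contains x.1 && (alp k2).contains x.2) &&
      isrel [k1, k2] (r.map fun x => [x.1, x.2])
theorem rokI : rok 2 1 relsI = true := by decide +kernel
theorem rokII : rok 3 1 relsII = true := by decide +kernel
theorem spnI (s t : ℕ) (ht : 5 ≤ t) (z : List ℕ) (lam : P4 →ₗ[kk] kk) (h : NN (gI s t ++ z) ≤ LinearMap.ker lam) :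
    Spn (gI s t) fun l => lam (mono l) :=
  let X : Cx := ⟨lam, 0, 2, s, 1, t, z, h⟩
  Rp_Spn X (X.typeA (show 1 ≤ 2 by decide) (show 2 ≤ 3 by decide) rfl ht relsI rokI chkI)
    (show 2 ≤ 4 by decide) (show 1 ≤ 4 by decide)
theorem spnII (s t : ℕ) (ht : 5 ≤ t) (z : List ℕ) (lam : P4 →ₗ[kk] kk) (h : NN (gII s t ++ z) ≤ LinearMap.ker lam) :
    Spn (gII s t) fun l => lam (mono l) :=
  let X : Cx := ⟨lam, 1, 3, s - 2, 1, t + 1, z, h⟩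
  Rp_Spn X (X.typeA (show 1 ≤ 3 by decide) (show 3 ≤ 3 by decide) rfl (show 5 ≤ t + 1 by omega) relsII rokII chkII)
    (show 3 ≤ 4 by decide) (show 1 ≤ 4 by decide)
def psi (g : ℕ → kk) (m : ℕ) : kk := ∑ i ∈ Finset.range 256, if m.testBit i then g i else 0
def mk (L : List ℕ) : ℕ := L.foldr (fun i m => (2 ^ i) ^^^ m) 0
def red (B : List ℕ) (m : ℕ) : ℕ := B.foldl (fun m r => bif m.testBit r.log2 then m ^^^ r else m) m
def ge (rows : List ℕ) : List ℕ := rows.foldl (fun B m => let r := red B m; bif r == 0 then B else B ++ [r]) []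
def spanchk (rows targets : List (List ℕ)) : Bool :=
  (rows ++ targets).all (fun L => L.all fun i => Nat.blt i 256) &&
  (let B := ge (rows.map mk)
   targets.all fun L => red B (mk L) == 0)
theorem psi_zero (g : ℕ → kk) : psi g 0 = 0 := by simp [psi]
theorem psi_xor (g : ℕ → kk) (m n : ℕ) : psi g (m ^^^ n) = psi g m + psi g n := by
  rw [psi, psi, psi, ← Finset.sum_add_distrib]
  refine Finset.sum_congr rfl fun i _ => ?_
  rw [Nat.testBit_xor]
  cases m.testBit i <;> cases n.testBit i <;> simp [CharTwo.add_self_eq_zero]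
theorem psi_pow (g : ℕ → kk) {i : ℕ} (h : i < 256) : psi g (2 ^ i) = g i := by
  rw [psi, Finset.sum_eq_single i]
  · simp
  · intro j _ hj; simp [Nat.testBit_two_pow, Ne.symm hj]
  · intro h'; simp at h'; omega
theorem psi_mk (g : ℕ → kk) (L : List ℕ) (h : ∀ i ∈ L, i < 256) : psi g (mk L) = (L.map g).sum := by
  induction L with
  | nil => exact psi_zero g
  | cons i L ih =>
    show psi g ((2 ^ i) ^^^ mk L) = _
    rw [psi_xor, psi_pow g (h i (by simp)), ih fun j hj => h j (by simp [hj])]; simp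
theorem psi_red (g : ℕ → kk) (B : List ℕ) (h : ∀ r ∈ B, psi g r = 0) : ∀ m, psi g (red B m) = psi g m := by
  induction B with
  | nil => intro m; rfl
  | cons r B ih =>
    intro m
    show psi g (red B (bif m.testBit r.log2 then m ^^^ r else m)) = _
    rw [ih fun x hx => h x (by simp [hx])]
    cases m.testBit r.log2
    · rfl
    · show psi g (m ^^^ r) = _
      rw [psi_xor, h r (by simp), add_zero]
theorem psi_ge (g : ℕ → kk) (rows : List ℕ) (h : ∀ r ∈ rows, psi g r = 0) : ∀ r ∈ ge rows, psi g r = 0 := by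
  have key : ∀ (rows B : List ℕ), (∀ r ∈ rows, psi g r = 0) → (∀ r ∈ B, psi g r = 0) →
      ∀ r ∈ rows.foldl (fun B m => let r := red B m; bif r == 0 then B else B ++ [r]) B, psi g r = 0 := by
    intro rows
    induction rows with
    | nil => intro B _ h; exact h
    | cons m rows ih =>
      intro B h1 h2
      refine ih _ (fun x hx => h1 x (by simp [hx])) ?_
      show ∀ r ∈ (bif red B m == 0 then B else B ++ [red B m]), _
      cases (red B m == 0)
      · intro r hr
        rcases List.mem_append.mp hr with hr | hr
        · exact h2 r hr
        · rw [List.mem_singleton.mp hr, psi_red g B h2, h1 m (by simp)]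
      · exact h2
  exact key rows [] h (by simp)
theorem span_sound {rows targets : List (List ℕ)} (h : spanchk rows targets = true) (g : ℕ → kk)
    (hr : ∀ L ∈ rows, (L.map g).sum = 0) : ∀ L ∈ targets, (L.map g).sum = 0 := by
  simp only [spanchk, Bool.and_eq_true, List.all_eq_true, Nat.blt_eq, beq_iff_eq] at h
  obtain ⟨h1, h2⟩ := h
  intro L hL
  rw [← psi_mk g L fun i hi => h1 L (by simp [hL]) i hi]
  have hB : ∀ r ∈ ge (rows.map mk), psi g r = 0 := by
    apply psi_ge
    intro r hr'
    obtain ⟨L', hL', rfl⟩ := List.mem_map.mp hr'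
    rw [psi_mk g L' fun i hi => h1 L' (by simp [hL']) i hi]
    exact hr L' hL'
  rw [← psi_red g _ hB, h2 L hL, psi_zero]
def ix (k c : ℕ) : ℕ := (alp k).idxOf c
def dec (k u : ℕ) : Finset ℕ := (Al k).filter fun c => u.testBit (ix k c) = true
def bt (k c : ℕ) : ℕ := 2 ^ ix k c
theorem ix_inj {k c d : ℕ} (hc : c ∈ Al k) (hd : d ∈ Al k) : ix k c = ix k d ↔ c = d := by
  unfold ix
  rw [List.idxOf_inj (by simpa [Al] using hc)]
theorem ix_lt {k c : ℕ} (hc : c ∈ Al k) : ix k c < (alp k).length :=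
  List.idxOf_lt_length_of_mem (by simpa [Al] using hc)
theorem dec_sub (k u : ℕ) : dec k u ⊆ Al k := Finset.filter_subset _ _
theorem dec_or (k u v : ℕ) : dec k (u ||| v) = dec k u ∪ dec k v := by
  ext c; simp [dec, Nat.testBit_or]; tauto
theorem dec_bt {k c : ℕ} (hc : c ∈ Al k) : dec k (bt k c) = {c} := by
  ext d
  simp only [dec, bt, Finset.mem_filter, Nat.testBit_two_pow, decide_eq_true_eq, Finset.mem_singleton]
  constructor
  · rintro ⟨h1, h2⟩; exact ((ix_inj hc h1).mp h2).symm
  · rintro rfl; exact ⟨hc, rfl⟩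
theorem dec_ins {k c : ℕ} (hc : c ∈ Al k) (u : ℕ) : dec k (u ||| bt k c) = insert c (dec k u) := by
  rw [dec_or, dec_bt hc]; ext; simp [or_comm]
theorem dec_surj {k : ℕ} {T : Finset ℕ} (hT : T ⊆ Al k) : ∃ u < 2 ^ (alp k).length, dec k u = T := by
  induction T using Finset.induction_on with
  | empty => exact ⟨0, by positivity, by simp [dec]⟩
  | insert c T _ ih =>
    obtain ⟨u, hu, rfl⟩ := ih fun x hx => hT (by simp [hx])
    have hc : c ∈ Al k := hT (by simp)
    exact ⟨u ||| bt k c, Nat.or_lt_two_pow hu (Nat.pow_lt_pow_right (by norm_num) (ix_lt hc)), dec_ins hc u⟩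
theorem dec_inj {k u v : ℕ} (hu : u < 2 ^ (alp k).length) (hv : v < 2 ^ (alp k).length) (h : dec k u = dec k v) :
    u = v := by
  apply Nat.eq_of_testBit_eq
  intro i
  by_cases hi : i < (alp k).length
  · have hn : (alp k).Nodup := List.Nodup.filter _ List.nodup_range
    have hm : (alp k)[i] ∈ Al k := by simp [Al]
    have e : ix k (alp k)[i] = i := hn.idxOf_getElem i hi
    have h1 : ∀ w, w.testBit i = true ↔ (alp k)[i] ∈ dec k w := by
      intro w
      simp only [dec, Finset.mem_filter, e, hm, true_and]
    rw [Bool.eq_iff_iff, h1, h1, h]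
  · have hp : 2 ^ (alp k).length ≤ 2 ^ i := Nat.pow_le_pow_right (by norm_num) (by omega)
    rw [Nat.testBit_lt_two_pow (by omega), Nat.testBit_lt_two_pow (by omega)]
open Classical in
def code (k : ℕ) (T : Finset ℕ) : ℕ := if h : ∃ u < 2 ^ (alp k).length, dec k u = T then h.choose else 0
theorem code_dec {k u : ℕ} (hu : u < 2 ^ (alp k).length) : code k (dec k u) = u := by
  have h : ∃ v < 2 ^ (alp k).length, dec k v = dec k u := ⟨u, hu, rfl⟩
  rw [code, dif_pos h]
  exact dec_inj h.choose_spec.1 hu h.choose_spec.2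
def pp (k u : ℕ) : ℕ := ((List.range (alp k).length).filter fun i => u.testBit i).length
theorem dec_card2 : ∀ u < 64, (dec 2 u).card = pp 2 u := by decide +kernel
theorem dec_card3 : ∀ u < 16, (dec 3 u).card = pp 3 u := by decide +kernel
theorem dec_ne {k u : ℕ} (h : 0 < u) (hu : u < 2 ^ (alp k).length) : (dec k u).Nonempty := by
  rw [Finset.nonempty_iff_ne_empty]
  intro h'
  have : dec k u = dec k 0 := by rw [h']; simp [dec]
  have := dec_inj hu (by positivity) this
  omega
theorem len_alp : (alp 1).length = 4 ∧ (alp 2).length = 6 ∧ (alp 3).length = 4 := by decide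
def gl3 (u : ℕ) : List ℕ :=
  bif Nat.ble (pp 2 u) 4 then [u] else bif u == 63 then [] else
    let i := (63 - u).log2
    let d := bif i == 0 || i == 5 then 1 else 0
    let m := 2 ^ d + 2 ^ (5 - d) + 2 ^ (5 - i)
    [m, m + 2 ^ i]
def us (k n j : ℕ) : List ℕ := (List.range n).filter fun u => Nat.blt 0 u && Nat.ble (pp k u) j
def incrow (W k : ℕ) (r : List (ℕ × ℕ)) (u : ℕ) : List ℕ := r.zipIdx.map fun y => y.2 * W + (u ||| bt k y.1.2)
def plms : List ℕ := [bt 2 3 ||| bt 2 12, bt 2 5 ||| bt 2 10, bt 2 6 ||| bt 2 9]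
def plrow (k u : ℕ) : List ℕ := plms.map fun m => k * 64 + (u ||| m)
def rows3 (r : List (ℕ × ℕ)) : List (List ℕ) :=
  (us 2 64 3).map (incrow 64 2 r) ++ [0, 1, 2].flatMap fun k => (us 2 64 2).map (plrow k)
def tg3 (r : List (ℕ × ℕ)) (u : ℕ) : List ℕ :=
  r.zipIdx.flatMap fun y => (gl3 (u ||| bt 2 y.1.2)).map fun v => y.2 * 64 + v
theorem sp3 : (relsIII.all fun r => r.length == 3 && spanchk (rows3 r) ((us 2 64 6).map (tg3 r))) = true := by
  decide +kernel
theorem sp3k : spanchk ((us 2 64 2).map (plrow 0)) ((us 2 64 6).map fun u => plms.flatMap fun m => gl3 (u ||| m)) = true := by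
  decide +kernel
theorem sp3g : ((us 2 64 6).all fun u => Nat.ble (pp 2 u) 4 && gl3 u == [u] || (us 2 64 (pp 2 u - 2)).any fun v =>
    spanchk [plrow 0 v] [u :: gl3 u]) = true := by
  decide +kernel
def quads : Bool := (alp 2).all fun c => (alp 2).all fun d => (alp 2).all fun e => c + d != 15 ||
  bif e == c then isrel [2, 2, 2, 2] [[d, d, c, c], [d, c, c, c]] else isrel [2, 2, 2, 2] [[c, c, d, e], [c, d, d, e]]
theorem quads_ok : quads = true := by decide +kernel
theorem gl3_ok : ((us 2 64 6).all fun u => (gl3 u).all fun v => Nat.blt 0 v && Nat.blt v 64 && Nat.ble (pp 2 v) 4) = true := by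
  decide +kernel
theorem rokIII : rok 3 2 relsIII = true := by decide +kernel
theorem mem_us {k n j u : ℕ} : u ∈ us k n j ↔ u < n ∧ 0 < u ∧ pp k u ≤ j := by simp [us]
theorem sumFM {α : Type} (L : List α) (f : α → List ℕ) (g : ℕ → kk) :
    ((L.flatMap f).map g).sum = (L.map fun x => ((f x).map g).sum).sum := by
  induction L with
  | nil => rfl
  | cons x L ih => rw [List.flatMap_cons, List.map_append, List.sum_append, ih, List.map_cons, List.sum_cons]
namespace Cx
variable (X : Cx)
theorem sup2' (hk : X.k2 = 2) (hb : 4 ≤ X.b) : X.Sup2 := by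
  intro l1 hl hl1
  have hp := X.perm2 (by omega) (by omega) l1 hl hl1
  refine supp_inv (Al X.k2) X.b _ hp ?_
  intro c d Q hc hd hcd hQ hlen
  by_cases h15 : c + d = 15
  · cases Q with
    | nil => simp at hlen; omega
    | cons e Q =>
      have he : e ∈ Al X.k2 := hQ e (by simp)
      have hQ' : ∀ x ∈ Q, x ∈ Al X.k2 := fun x hx => hQ x (by simp [hx])
      have h := quads_ok
      simp only [quads, List.all_eq_true] at h
      have h := h c (by rw [hk] at hc; simpa [Al] using hc) d (by rw [hk] at hd; simpa [Al] using hd) e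
        (by rw [hk] at he; simpa [Al] using he)
      simp only [List.length_cons] at hlen
      by_cases hec : e = c
      · subst hec
        simp only [h15, bne_self_eq_false, Bool.false_or, beq_self_eq_true, cond_true] at h
        have r := X.rel2 (j := 4) (r := [[d, d, e, e], [d, e, e, e]]) (P := []) (Q := Q) (by rw [hk]; exact h) hl hl1 (by simp) (by simp; omega)
        have r := two (by simpa using r)
        have p1 := hp (e :: e :: d :: e :: Q) (d :: e :: e :: e :: Q)
          (((List.Perm.swap d e (e :: Q)).cons e).trans (List.Perm.swap d e (e :: e :: Q))) (by simpa [hc, hd] using hQ') (by simp; omega)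
        show X.A l1 _ = X.A l1 _
        rw [r]; exact p1
      · have hec' : (e == c) = false := by simpa using hec
        simp only [h15, bne_self_eq_false, Bool.false_or, hec', cond_false] at h
        have r := X.rel2 (j := 4) (r := [[c, c, d, e], [c, d, d, e]]) (P := []) (Q := Q) (by rw [hk]; exact h) hl hl1 (by simp) (by simp; omega)
        have r := two (by simpa using r)
        have p1 := hp (c :: d :: d :: e :: Q) (d :: d :: c :: e :: Q)
          ((List.Perm.swap d c (d :: e :: Q)).trans ((List.Perm.swap d c (e :: Q)).cons d)) (by simpa [hc, hd, he] using hQ') (by simp; omega)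
        show X.A l1 _ = X.A l1 _
        rw [r]; exact p1
  · exact X.trip2 (by omega) (by omega) l1 Q hl hl1 hc hd hcd h15 hlen
def D2 (l : List ℕ) (u : ℕ) : kk := X.A l (pd X.b (dec 2 u))
theorem lt_or {u m : ℕ} (h : u < 64) (h' : m < 64) : u ||| m < 64 := Nat.or_lt_two_pow (n := 6) h h'
theorem pos_or {u m : ℕ} (h : 0 < u) : 0 < u ||| m := lt_of_lt_of_le h Nat.left_le_or
theorem bt_lt {c : ℕ} (hc : c ∈ Al 2) : bt 2 c < 64 := by
  have := ix_lt hc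
  exact Nat.pow_lt_pow_right (n := 6) (by norm_num) (by simpa [len_alp.2.1] using this)
theorem plk (hk : X.k2 = 2) (hb : 4 ≤ X.b) {l : List ℕ} (hl : ∀ c ∈ l, c ∈ Al X.k1) (hl1 : l.length = X.a)
    {u : ℕ} (hu : u < 64) (h0 : 0 < u) (hc : pp 2 u + 2 ≤ X.b) :
    (plms.map fun m => X.D2 l (u ||| m)).sum = 0 := by
  have hne : (dec 2 u).Nonempty := dec_ne h0 (by rw [len_alp.2.1]; exact hu)
  have hcd := dec_card2 u hu
  have r := X.rel2 (j := 2) (r := [[3, 12], [5, 10], [6, 9]]) (P := []) (Q := pd (X.b - 2) (dec 2 u))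
    (by rw [hk]; decide +kernel) hl hl1 (by simp) (by rw [pd_len _ (by omega)]; simp; omega)
  have key : ∀ x y, x ∈ Al 2 → y ∈ Al 2 → X.D2 l (u ||| (bt 2 x ||| bt 2 y)) = X.A l (x :: y :: pd (X.b - 2) (dec 2 u)) := by
    intro x y hx hy
    have e : dec 2 (u ||| (bt 2 x ||| bt 2 y)) = insert x (insert y (dec 2 u)) := by
      rw [dec_or, dec_or, dec_bt hx, dec_bt hy]; ext ; simp
    have hs : insert x (insert y (dec 2 u)) ⊆ Al 2 :=
      Finset.insert_subset hx (Finset.insert_subset hy (dec_sub 2 u))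
    have hcard : (insert x (insert y (dec 2 u))).card ≤ X.b := by
      have h1 := Finset.card_insert_le x (insert y (dec 2 u))
      have h2 := Finset.card_insert_le y (dec 2 u)
      omega
    rw [D2, e]
    refine X.sup2' hk hb l hl hl1 _ _ (pd_mem _ (by simp) (by rw [hk]; exact hs)) ?_ (pd_len _ hcard) ?_ ?_
    · rw [hk]
      intro c hc
      simp only [List.mem_cons] at hc
      rcases hc with rfl | rfl | hc
      · exact hx
      · exact hy
      · exact pd_mem _ hne (dec_sub 2 u) c hc
    · simp only [List.length_cons]; rw [pd_len _ (by omega)]; omega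
    · rw [pd_supp _ (by simp), List.toFinset_cons, List.toFinset_cons, pd_supp _ hne]
  simp only [plms, List.map_cons, List.map_nil]
  rw [key 3 12 (by decide) (by decide), key 5 10 (by decide) (by decide), key 6 9 (by decide) (by decide)]
  simpa using r
theorem typeIII (hk1 : X.k1 = 3) (hk : X.k2 = 2) (hb : 4 ≤ X.b) : Rp 3 2 X.a X.b X.A := by
  have hs := X.sup2' hk hb
  have hr := rokIII
  simp only [rok, List.all_eq_true, Bool.and_eq_true, List.contains_iff_mem] at hr
  have hr' : ∀ r ∈ relsIII, ∀ x ∈ r, x.1 ∈ Al 3 ∧ x.2 ∈ Al 2 := by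
    intro r hrm x hx
    obtain ⟨g1, g2⟩ := (hr r hrm).1 x hx
    exact ⟨by simpa [Al] using g1, by simpa [Al] using g2⟩
  have h6 : ∀ T ⊆ Al 2, T.Nonempty → ∃ u, u < 64 ∧ 0 < u ∧ dec 2 u = T := by
    intro T hT hn
    obtain ⟨u, hu, rfl⟩ := dec_surj hT
    rw [len_alp.2.1] at hu
    refine ⟨u, hu, ?_, rfl⟩
    rcases Nat.eq_zero_or_pos u with rfl | h
    · simp [dec] at hn
    · exact h
  have hcode : ∀ u, u < 64 → code 2 (dec 2 u) = u := fun u hu => code_dec (by rw [len_alp.2.1]; exact hu)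
  have p6 : ∀ u, pp 2 u ≤ 6 := by
    intro u; unfold pp
    refine (List.length_filter_le _ _).trans ?_
    rw [List.length_range, len_alp.2.1]
  refine assemble 3 2 X.a X.b relsIII krIII hr' (by decide) chkIII (by omega) X.A
    (fun l T => ((gl3 (code 2 T)).map fun v => X.D2 l v).sum) ?_ ?_ ?_ ?_ ?_
  · intro li lo a1 a2 a3 a4
    have hsub : lo.toFinset ⊆ Al 2 := fun x hx => a2 x (by simpa using hx)
    have hne : lo.toFinset.Nonempty := by
      rw [List.toFinset_nonempty_iff]; rintro rfl; simp at a4; omega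
    obtain ⟨u, hu, h0, hue⟩ := h6 _ hsub hne
    have hcard : (dec 2 u).card ≤ X.b := by rw [hue, ← a4]; exact List.toFinset_card_le lo
    have hne' := hne
    rw [← hue] at hne' ⊢
    rw [hcode u hu]
    have e1 : X.A li lo = X.D2 li u := by
      refine hs li (by rw [hk1]; exact a1) a3 _ _ (by rw [hk]; exact a2) ?_ a4 (pd_len _ hcard) ?_
      · rw [hk]; exact pd_mem _ hne' (dec_sub 2 u)
      · rw [pd_supp _ hne']; exact hue.symm
    rw [e1]
    have h := sp3g
    rw [List.all_eq_true] at h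
    have h := h u (mem_us.mpr ⟨hu, h0, p6 u⟩)
    rw [Bool.or_eq_true] at h
    rcases h with h | h
    · rw [Bool.and_eq_true, beq_iff_eq] at h
      rw [h.2]; simp
    · rw [List.any_eq_true] at h
      obtain ⟨v, hv, hc⟩ := h
      obtain ⟨v1, v2, v3⟩ := mem_us.mp hv
      have := span_sound hc (X.D2 li) (by
        intro L hL
        rw [List.mem_singleton.mp hL, plrow, List.map_map]
        simp only [Function.comp_def, zero_mul, zero_add]
        by_cases hp : pp 2 u ≤ 4
        · exact X.plk hk hb (by rw [hk1]; exact a1) a3 v1 v2 (by omega)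
        · have := dec_card2 u hu
          exact X.plk hk hb (by rw [hk1]; exact a1) a3 v1 v2 (by omega)) (u :: gl3 u) (by simp)
      rw [List.map_cons, List.sum_cons] at this
      exact CharTwo.add_eq_zero.mp this
  · intro T _ _ l l' hll h1 h2
    show (List.map _ _).sum = (List.map _ _).sum
    congr 1
    refine List.map_congr_left fun v _ => ?_
    exact X.perm1 (by omega) (by omega) _ l l' hll (by rw [hk1]; exact h1) h2
  · intro T _ _ c d Q hc hd hcd h15 hQ hlen
    show (List.map _ _).sum = (List.map _ _).sum
    congr 1
    refine List.map_congr_left fun v _ => ?_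
    exact X.trip1 (by omega) (by omega) _ Q (by rw [hk1]; exact hc) (by rw [hk1]; exact hd) hcd h15 hlen
  · intro r hrm T hT hTn Q hQ hlen
    obtain ⟨u, hu, h0, rfl⟩ := h6 T hT hTn
    have h := sp3
    rw [List.all_eq_true] at h
    have h := h r hrm
    rw [Bool.and_eq_true, beq_iff_eq] at h
    obtain ⟨hl3, h⟩ := h
    let g : ℕ → kk := fun i => X.D2 ((r.map fun x => x.1).getD (i / 64) 0 :: Q) (i % 64)
    have hg : ∀ y ∈ r.zipIdx, ∀ v < 64, g (y.2 * 64 + v) = X.D2 (y.1.1 :: Q) v := by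
      intro y hy v hv
      obtain ⟨x, k⟩ := y
      rw [List.mem_zipIdx_iff_getElem?] at hy
      have e1 : (k * 64 + v) / 64 = k := by omega
      have e2 : (k * 64 + v) % 64 = v := by omega
      simp only [g, e1, e2]
      rw [List.getD_eq_getElem?_getD, List.getElem?_map]
      simp only at hy
      rw [hy]; rfl
    have hmem : ∀ y ∈ r.zipIdx, y.1 ∈ r := by
      intro y hy
      exact List.fst_mem_of_mem_zipIdx hy
    have hz : ∀ f : ℕ × ℕ → kk, (r.zipIdx.map fun y => f y.1) = r.map f := by
      intro f
      have : r.zipIdx.map (fun y => f y.1) = (r.zipIdx.map Prod.fst).map f := by rw [List.map_map]; rfl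
      rw [this, List.zipIdx_map_fst]
    have hxQ : ∀ x ∈ r, ∀ c ∈ x.1 :: Q, c ∈ Al X.k1 := by
      intro x hx c hc
      rw [hk1]
      rcases List.mem_cons.mp hc with rfl | hc
      · exact (hr' r hrm x hx).1
      · exact hQ c hc
    have main := span_sound h g (by
      intro L hL
      rw [rows3, List.mem_append] at hL
      rcases hL with hL | hL
      · obtain ⟨v, hv, rfl⟩ := List.mem_map.mp hL
        obtain ⟨v1, v2, v3⟩ := mem_us.mp hv
        rw [incrow, List.map_map]
        have := X.inc (by omega) (by omega) hs (r := r) (by rw [hk1, hk]; exact hr' r hrm) (by rw [hk1, hk]; exact (hr r hrm).2)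
          (T := dec 2 v) (by rw [hk]; exact dec_sub 2 v) (dec_ne v2 (by rw [len_alp.2.1]; exact v1))
          (by rw [dec_card2 v v1]; omega) (Q := Q) (by rw [hk1]; exact hQ) hlen
        rw [← this, ← hz]
        congr 1
        refine List.map_congr_left fun y hy => ?_
        have h2 := (hr' r hrm _ (hmem y hy)).2
        rw [Function.comp, hg y hy _ (lt_or v1 (bt_lt h2)), D2, dec_ins h2]
      · obtain ⟨k, hk', hL⟩ := List.mem_flatMap.mp hL
        obtain ⟨v, hv, rfl⟩ := List.mem_map.mp hL
        obtain ⟨v1, v2, v3⟩ := mem_us.mp hv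
        have hk3 : k < r.length := by rw [hl3]; simp at hk'; omega
        have hkm : (r[k], k) ∈ r.zipIdx := by rw [List.mem_zipIdx_iff_getElem?]; simp [hk3]
        have := X.plk hk hb (hxQ r[k] (by simp)) (by simpa using hlen) v1 v2 (by omega)
        rw [plrow, List.map_map, ← this]
        congr 1
        refine List.map_congr_left fun m hm => ?_
        rw [Function.comp, hg _ hkm]
        have : ∀ m ∈ plms, m < 64 := by decide
        exact lt_or v1 (this m hm))
    have := main (tg3 r u) (List.mem_map_of_mem (mem_us.mpr ⟨hu, h0, p6 u⟩))
    rw [← this, tg3, sumFM, ← hz]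
    congr 1
    refine List.map_congr_left fun y hy => ?_
    have h2 := (hr' r hrm _ (hmem y hy)).2
    have hlt := lt_or hu (bt_lt h2)
    show (List.map _ (gl3 (code 2 (insert _ _)))).sum = _
    rw [← dec_ins h2, hcode _ hlt, List.map_map]
    congr 1
    refine List.map_congr_left fun v hv => ?_
    rw [Function.comp, hg y hy v]
    have h := gl3_ok
    simp only [List.all_eq_true, Bool.and_eq_true, Nat.blt_eq] at h
    exact (h _ (mem_us.mpr ⟨hlt, pos_or h0, p6 _⟩) v hv).1.2
  · intro r hr T hT hTn l hl hlen
    obtain ⟨u, hu, h0, rfl⟩ := h6 T hT hTn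
    have : r = [[3, 12], [5, 10], [6, 9]] := by simpa [krIII] using hr
    subst this
    have main := span_sound sp3k (X.D2 l) (by
      intro L hL
      obtain ⟨v, hv, rfl⟩ := List.mem_map.mp hL
      obtain ⟨v1, v2, v3⟩ := mem_us.mp hv
      rw [plrow, List.map_map]
      simp only [Function.comp_def, zero_mul, zero_add]
      exact X.plk hk hb (by rw [hk1]; exact hl) hlen v1 v2 (by omega)) _ (List.mem_map_of_mem (mem_us.mpr ⟨hu, h0, p6 u⟩))
    rw [← main, sumFM]
    have key : ∀ x y, x ∈ Al 2 → y ∈ Al 2 → code 2 ([x, y].toFinset ∪ dec 2 u) = u ||| (bt 2 x ||| bt 2 y) := by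
      intro x y hx hy
      rw [← hcode (u ||| (bt 2 x ||| bt 2 y)) (lt_or hu (lt_or (bt_lt hx) (bt_lt hy))), dec_or, dec_or, dec_bt hx, dec_bt hy]
      congr 1; ext; simp
    simp only [plms, List.map_cons, List.map_nil]
    rw [key 3 12 (by decide) (by decide), key 5 10 (by decide) (by decide), key 6 9 (by decide) (by decide)]
end Cx
theorem spnIII (s t : ℕ) (ht : 5 ≤ t) (z : List ℕ) (lam : P4 →ₗ[kk] kk) (h : NN (gIII s t ++ z) ≤ LinearMap.ker lam) :
    Spn (gIII s t) fun l => lam (mono l) :=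
  let X : Cx := ⟨lam, 1, 3, s - 1, 2, t - 1, z, h⟩
  Rp_Spn X (X.typeIII rfl rfl (show 4 ≤ t - 1 by omega)) (show 3 ≤ 4 by decide) (show 2 ≤ 4 by decide)
def r4 : List (ℕ × ℕ) := [(1, 14), (2, 13), (4, 11), (8, 7)]
def st (L : List ℕ) : ℕ := (L.map fun j => 2 ^ (3 - j)).sum
def tb3 : List (ℕ × List ℕ) := [(48 + st [0, 1, 3], [st [0, 1], 16 + st [0, 1]]), (48 + st [0, 2, 3], [st [0, 2], 32 + st [0, 2]]),
  (48 + st [1, 2, 3], [16 + st [1, 2], 32 + st [1, 2]]), (16 + st [0, 1, 3], [st [0, 3], 48 + st [0, 3]]),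
  (32 + st [1, 2, 3], [16 + st [1, 3], 48 + st [1, 3]]), (st [0, 2, 3], [32 + st [2, 3], 48 + st [2, 3]])]
def g43 (m i : ℕ) : List ℕ :=
  bif Nat.ble (pp 3 (i % 16)) m then [i] else (tb3.lookup i).getD []
def gl4 (m i : ℕ) : List ℕ :=
  bif i % 16 == 15 && Nat.blt m 4 then (List.range 4).flatMap fun j => bif j == i / 16 then [] else g43 m (j * 16 + (15 - 2 ^ (3 - i / 16)))
  else g43 m i
def rows4 (m : ℕ) : List (List ℕ) :=
  ((List.range 16).filter fun u => Nat.ble (pp 3 u) (m - 1) && (Nat.blt 0 u || Nat.blt m 5)).map (incrow 16 3 r4)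
def tg4 (m u : ℕ) : List ℕ := r4.zipIdx.flatMap fun y => gl4 m (y.2 * 16 + (u ||| bt 3 y.1.2))
theorem sp4 : ([2, 3, 4, 5].all fun m => spanchk (rows4 m) ((us 3 16 4).map (tg4 m))) = true := by decide +kernel
theorem gl4_ok : ([2, 3, 4, 5].all fun m => (us 3 16 4).all fun u => (List.range 4).all fun j => !(Nat.ble (pp 3 u) m) ||
  gl4 m (j * 16 + u) == [j * 16 + u]) = true := by decide +kernel
theorem rokIV : rok 3 1 [r4.map fun x => (x.2, x.1)] = true := by decide +kernel
theorem rokIV' : ([2, 3, 4].all fun a => isrel (List.replicate a 3 ++ List.replicate 1 1)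
    (r4.map fun x => List.replicate a x.2 ++ [x.1])) = true := by decide +kernel
namespace Cx
variable (X : Cx)
theorem sup1 (hk : X.k1 = 3) (l2 : List ℕ) : ∀ l l' : List ℕ,
  (∀ x ∈ l, x ∈ Al 3) → (∀ x ∈ l', x ∈ Al 3) → l.length = X.a → l'.length = X.a →
      l.toFinset = l'.toFinset → X.A l l2 = X.A l' l2 := by
  rw [← hk]
  refine supp_inv (Al X.k1) X.a _ (X.perm1 (by omega) (by omega) l2) ?_
  intro c d Q hc hd hcd _ hlen
  refine X.trip1 (by omega) (by omega) l2 Q hc hd hcd ?_ hlen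
  have key : ∀ c ∈ alp 3, ∀ d ∈ alp 3, c + d ≠ 15 := by decide
  rw [hk] at hc hd
  exact key c (by simpa [Al] using hc) d (by simpa [Al] using hd)
def D4 (i : ℕ) : kk := X.A (pd X.a (dec 3 (i % 16))) [2 ^ (i / 16)]
theorem typeIV (hk1 : X.k1 = 3) (hk : X.k2 = 1) (ha : 2 ≤ X.a) (hb : X.b = 1) : Rp 1 3 1 X.a fun li lo => X.A lo li := by
  have h4 : ∀ T ⊆ Al 3, T.Nonempty → ∃ u, u < 16 ∧ 0 < u ∧ dec 3 u = T := by
    intro T hT hn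
    obtain ⟨u, hu, rfl⟩ := dec_surj hT
    rw [len_alp.2.2] at hu
    refine ⟨u, hu, ?_, rfl⟩
    rcases Nat.eq_zero_or_pos u with rfl | h
    · simp [dec] at hn
    · exact h
  have hcode : ∀ u, u < 16 → code 3 (dec 3 u) = u := fun u hu => code_dec (by rw [len_alp.2.2]; exact hu)
  have p4 : ∀ u, pp 3 u ≤ 4 := by
    intro u; unfold pp
    refine (List.length_filter_le _ _).trans ?_
    rw [List.length_range, len_alp.2.2]
  obtain ⟨m, hm, hm1, hm2⟩ : ∃ m, m ∈ [2, 3, 4, 5] ∧ m ≤ X.a ∧ (m < 5 → m = X.a) := by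
    by_cases h : 5 ≤ X.a
    · exact ⟨5, by simp, h, by omega⟩
    · exact ⟨X.a, by simp; omega, le_rfl, fun _ => rfl⟩
  have hr4 : ∀ y ∈ r4.zipIdx, y.1.1 = 2 ^ y.2 ∧ y.1.1 ∈ Al 1 ∧ y.1.2 ∈ Al 3 ∧ bt 3 y.1.2 < 16 ∧ y.2 < 4 := by decide +kernel
  have hal : ∀ v ∈ alp 1, v = 2 ^ v.log2 ∧ v.log2 < 4 := by decide +kernel
  have hz : ∀ f : ℕ × ℕ → kk, (r4.zipIdx.map fun y => f y.1) = r4.map f := by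
    intro f
    have : r4.zipIdx.map (fun y => f y.1) = (r4.zipIdx.map Prod.fst).map f := by rw [List.map_map]; rfl
    rw [this, List.zipIdx_map_fst]
  have hlt : ∀ u v, u < 16 → v < 16 → u ||| v < 16 := fun u v h h' => Nat.or_lt_two_pow (n := 4) h h'
  refine assemble 1 3 1 X.a relsIV [] (by decide) (by simp) chkIV (by omega) _
    (fun l T => ((gl4 m ((l.headD 0).log2 * 16 + code 3 T)).map X.D4).sum) ?_ ?_ ?_ ?_ (by simp)
  · intro li lo a1 a2 a3 a4
    obtain ⟨v, rfl⟩ := List.length_eq_one_iff.mp a3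
    have hsub : lo.toFinset ⊆ Al 3 := fun x hx => a2 x (by simpa using hx)
    have hne : lo.toFinset.Nonempty := by
      rw [List.toFinset_nonempty_iff]; rintro rfl; simp at a4; omega
    obtain ⟨u, hu, h0, hue⟩ := h4 _ hsub hne
    have hcard : (dec 3 u).card ≤ X.a := by rw [hue, ← a4]; exact List.toFinset_card_le lo
    have hcard' := hcard
    have hne' := hne
    rw [← hue] at hne' ⊢
    obtain ⟨e1, e2⟩ := hal v (by have := a1 v (by simp); simpa [Al] using this)
    have hg := gl4_ok
    simp only [List.all_eq_true] at hg
    have hg := hg m hm u (mem_us.mpr ⟨hu, h0, p4 u⟩) v.log2 (by simpa using e2)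
    have hpm : pp 3 u ≤ m := by
      rw [dec_card3 u hu] at hcard'
      by_cases h5 : m < 5
      · rw [hm2 h5]; exact hcard'
      · have := p4 u; omega
    have hb' : Nat.ble (pp 3 u) m = true := Nat.ble_eq.mpr hpm
    rw [hb', Bool.not_true, Bool.false_or, beq_iff_eq] at hg
    simp only [List.headD_cons]
    rw [hcode u hu, hg]
    simp only [List.map_cons, List.map_nil, List.sum_cons, List.sum_nil, add_zero]
    rw [D4, show (v.log2 * 16 + u) % 16 = u by omega, show (v.log2 * 16 + u) / 16 = v.log2 by omega, ← e1]
    refine X.sup1 hk1 _ _ _ a2 (pd_mem _ hne' (dec_sub 3 u)) a4 (pd_len _ hcard) ?_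
    rw [pd_supp _ hne']; exact hue.symm
  · intro T _ _ l l' hll _ h2
    obtain ⟨v, rfl⟩ := List.length_eq_one_iff.mp h2
    rw [List.singleton_perm.mp hll]
  · intro T _ _ c d Q _ _ _ _ _ hlen; omega
  · intro r hrm T hT hTn Q _ hlen
    have hQ : Q = [] := List.length_eq_zero_iff.mp (by omega)
    subst hQ
    obtain ⟨u, hu, h0, rfl⟩ := h4 T hT hTn
    have : r = r4 := by simpa [relsIV, r4] using hrm
    subst this
    have h := sp4
    rw [List.all_eq_true] at h
    have h := h m hm
    have hD : ∀ y ∈ r4.zipIdx, ∀ v < 16, X.D4 (y.2 * 16 + v) = X.A (pd X.a (dec 3 v)) [y.1.1] := by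
      intro y hy v hv
      rw [D4, show (y.2 * 16 + v) % 16 = v by omega, show (y.2 * 16 + v) / 16 = y.2 by omega, ← (hr4 y hy).1]
    have main := span_sound h X.D4 (by
      intro L hL
      obtain ⟨v, hv, rfl⟩ := List.mem_map.mp hL
      simp only [List.mem_filter, List.mem_range, Bool.and_eq_true, Nat.ble_eq, Bool.or_eq_true, Nat.blt_eq] at hv
      obtain ⟨v1, v2, v3⟩ := hv
      rw [incrow, List.map_map]
      rcases Nat.eq_zero_or_pos v with rfl | v0
      · have hma : m = X.a := hm2 (by omega)
        have hh := rokIV'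
        rw [List.all_eq_true] at hh
        have hh := hh X.a (by rw [← hma]; simp at hm ⊢; omega)
        have := X.rel12 (i := X.a) (j := 1) (r := r4.map fun x => (List.replicate X.a x.2, [x.1])) (P := []) (Q := [])
          (by rw [hk1, hk, List.map_map]; exact hh) (by simp) (by simp) (by simp [hb])
        rw [← this, List.map_map, ← hz]
        congr 1
        refine List.map_congr_left fun y hy => ?_
        obtain ⟨q1, q2, q3, q4, q5⟩ := hr4 y hy
        rw [Function.comp, hD y hy _ (hlt _ _ v1 q4)]
        rw [dec_ins q3]
        show X.A _ [y.1.1] = X.A (List.replicate X.a y.1.2) [y.1.1]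
        have hd0 : dec 3 0 = ∅ := by simp [dec]
        have hsub : insert y.1.2 (dec 3 0) ⊆ Al 3 := Finset.insert_subset q3 (dec_sub 3 0)
        refine X.sup1 hk1 _ _ _ (pd_mem _ (by simp) hsub) ?_ (pd_len _ ?_) (by simp) ?_
        · intro c hc; rw [List.eq_of_mem_replicate hc]; exact q3
        · rw [hd0]; simp; omega
        · rw [pd_supp _ (by simp), hd0, List.toFinset_replicate_of_ne_zero (by omega)]; rfl
      · have hcd := dec_card3 v v1
        have hne : (dec 3 v).Nonempty := dec_ne v0 (by rw [len_alp.2.2]; exact v1)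
        have hle : (dec 3 v).card + 1 ≤ X.a := by
          have hm2' : 2 ≤ m := by simp at hm; omega
          omega
        have hk4 := rokIV
        simp only [rok, List.all_cons, Bool.and_eq_true] at hk4
        have := X.rel12 (i := 1) (j := 1) (r := r4.map fun x => ([x.2], [x.1])) (P := pd (X.a - 1) (dec 3 v)) (Q := [])
          (by rw [hk1, hk, List.map_map]; exact hk4.1.2) (by rw [hk1]; exact pd_mem _ hne (dec_sub 3 v))
          (by rw [pd_len _ (by omega)]; omega) (by simp [hb])
        rw [← this, List.map_map, ← hz]
        congr 1
        refine List.map_congr_left fun y hy => ?_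
        obtain ⟨q1, q2, q3, q4, q5⟩ := hr4 y hy
        rw [Function.comp, hD y hy _ (hlt _ _ v1 q4), dec_ins q3]
        have hsub : insert y.1.2 (dec 3 v) ⊆ Al 3 := Finset.insert_subset q3 (dec_sub 3 v)
        refine X.sup1 hk1 _ _ _ (pd_mem _ (by simp) hsub) ?_ (pd_len _ ?_) ?_ ?_
        · intro c hc
          rcases List.mem_append.mp hc with hc | hc
          · exact pd_mem _ hne (dec_sub 3 v) c hc
          · rw [List.mem_singleton.mp hc]; exact q3
        · exact (Finset.card_insert_le _ _).trans hle
        · rw [List.length_append, pd_len _ (by omega)]; simp; omega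
        · rw [pd_supp _ (by simp), List.toFinset_append, pd_supp _ hne]; ext; simp)
    have := main (tg4 m u) (List.mem_map_of_mem (mem_us.mpr ⟨hu, h0, p4 u⟩))
    rw [← this, tg4, sumFM, ← hz]
    congr 1
    refine List.map_congr_left fun y hy => ?_
    obtain ⟨q1, q2, q3, q4, q5⟩ := hr4 y hy
    rw [← dec_ins q3, hcode _ (hlt _ _ hu q4), List.headD_cons, q1, Nat.log2_two_pow]
end Cx
theorem spnIV (t : ℕ) (ht : 5 ≤ t) (z : List ℕ) (lam : P4 →ₗ[kk] kk) (h : NN (gIV t ++ z) ≤ LinearMap.ker lam) :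
    Spn (gIV t) fun l => lam (mono l) := by
  let X : Cx := ⟨lam, 2, 3, t - 3, 1, 1, z, h⟩
  refine Rp_Spn X ?_ (show 3 ≤ 4 by decide) (show 1 ≤ 4 by decide)
  obtain ⟨L, h1, h2⟩ := X.typeIV rfl rfl (show 2 ≤ t - 3 by omega) rfl
  refine ⟨L, h1, fun li lo a1 a2 a3 a4 => ?_⟩
  have := h2 lo li a2 a1 a4 a3
  refine Eq.trans this ?_
  congr 1
  exact List.map_congr_left fun cl _ => mul_comm _ _
def Gd (s t : ℕ) (τ : List ℕ) : Prop :=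
  τ = gI s t ∨ (2 ≤ s ∧ τ = gII s t) ∨ τ = gIII s t ∨ (s = 1 ∧ τ = gIV t)
theorem Gd_ok {s t : ℕ} {τ : List ℕ} (h : Gd s t τ) : (∀ k ∈ τ, k ≤ 4) ∧ τ.Pairwise (· ≥ ·) := by
  have key : ∀ (l : List ℕ) (a b p q : ℕ), b ≤ a → a ≤ 4 → (∀ k ∈ l, k = 4) → l.Pairwise (· ≥ ·) →
      (∀ k ∈ l ++ (List.replicate p a ++ List.replicate q b), k ≤ 4) ∧
      (l ++ (List.replicate p a ++ List.replicate q b)).Pairwise (· ≥ ·) := by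
    intro l a b p q hab ha hl hp
    constructor
    · intro k hk
      simp only [List.mem_append, List.mem_replicate] at hk
      rcases hk with hk | ⟨_, rfl⟩ | ⟨_, rfl⟩
      · exact (hl k hk).le
      · exact ha
      · omega
    · rw [List.pairwise_append, List.pairwise_append]
      refine ⟨hp, ⟨by simp [List.pairwise_replicate], by simp [List.pairwise_replicate], ?_⟩, ?_⟩
      · intro x hx y hy
        rw [List.mem_replicate] at hx hy
        omega
      · intro x hx y hy
        have := hl x hx
        simp only [List.mem_append, List.mem_replicate] at hy
        omega
  rcases h with rfl | ⟨_, rfl⟩ | rfl | ⟨_, rfl⟩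
  · exact key [] 2 1 s t (by omega) (by omega) (by simp) (by simp)
  · exact key [4] 3 1 _ _ (by omega) (by omega) (by simp) (by simp)
  · exact key [4] 3 2 _ _ (by omega) (by omega) (by simp) (by simp)
  · exact key [4, 4] 3 1 _ _ (by omega) (by omega) (by simp) (by simp)
theorem upper {s t n : ℕ} (hs : 1 ≤ s) (ht : 5 ≤ t) (hn : n + 2 = 2 ^ (s + t) + 2 ^ s) (f : P4)
    (hf : f ∈ homog n) (h0 : ∀ τ, Gd s t τ → ∀ M : Mat, IsUnit M → ph M (sp τ) f = 0) :
    f ∈ hitSub n := by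
  refine mainU n (Gd s t) ?_ (fun τ h => Gd_ok h) ?_ f hf h0
  · intro w h4 hD
    rcases classify s t hs ht w h4 (by omega) with h | ⟨z, hz, h⟩
    · exact Or.inl h
    · right
      rcases h with h | ⟨h1, h⟩ | h | ⟨h1, h⟩
      · exact ⟨_, z, Or.inl rfl, hz, h⟩
      · exact ⟨_, z, Or.inr (Or.inl ⟨h1, rfl⟩), hz, h⟩
      · exact ⟨_, z, Or.inr (Or.inr (Or.inl rfl)), hz, h⟩
      · exact ⟨_, z, Or.inr (Or.inr (Or.inr ⟨h1, rfl⟩)), hz, h⟩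
  · intro τ z hg lam h
    rcases hg with rfl | ⟨h1, rfl⟩ | rfl | ⟨h1, rfl⟩
    · exact spnI s t ht z lam h
    · exact spnII s t ht z lam h
    · exact spnIII s t ht z lam h
    · exact spnIV t ht z lam h
theorem substM_mul (M N : Mat) (f : P4) : substM (M * N) f = substM N (substM M f) := by
  have : substM (M * N) = (substM N).comp (substM M) := by
    apply MvPolynomial.algHom_ext
    intro i
    simp only [substM, AlgHom.comp_apply, aeval_X, map_sum, map_smul, Matrix.mul_apply,
      Finset.sum_smul, Finset.smul_sum, mul_smul]
    exact Finset.sum_comm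
  rw [this]; rfl
theorem substM_one (f : P4) : substM (1 : Mat) f = f := by
  have : substM (1 : Mat) = AlgHom.id kk P4 := by
    apply MvPolynomial.algHom_ext
    intro i
    simp [substM, Matrix.one_apply]
  rw [this]; rfl
theorem ph_mul (M N : Mat) (σ : List ℕ) (f : P4) : ph (M * N) σ f = ph N σ (substM M f) := by
  simp [ph, substM_mul]
theorem homog_induct {n : ℕ} {p : P4 → Prop} (h0 : p 0) (hx : ∀ E : Fin 4 → ℕ, ∑ i, E i = n → p (xp E))
    (ha : ∀ a b, p a → p b → p (a + b)) (f : P4) (hf : f ∈ homog n) : p f := by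
  have h := homog_le_span n f hf
  clear hf
  induction h using Submodule.span_induction with
  | mem x h => obtain ⟨E, hE, rfl⟩ := h; exact hx E hE
  | zero => exact h0
  | add x y _ _ h1 h2 => exact ha _ _ h1 h2
  | smul a x _ h =>
    rcases kk_zero_or_one a with rfl | rfl
    · rw [zero_smul]; exact h0
    · rwa [one_smul]
theorem xp_mem {E : Fin 4 → ℕ} {n : ℕ} (h : ∑ i, E i = n) : xp E ∈ homog n := by
  rw [← h]; exact xp_homog E
theorem substM_mem (M : Mat) {n : ℕ} (f : P4) (hf : f ∈ homog n) : substM M f ∈ homog n := by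
  refine homog_induct (p := fun f => substM M f ∈ homog n) ?_ ?_ ?_ f hf
  · simp
  · intro E hE; rw [← hE]; exact substM_homog M E
  · intro a b h1 h2; rw [map_add]; exact Submodule.add_mem _ h1 h2
theorem mem_inv {n : ℕ} (f : P4) : f ∈ invPre n glSet ↔
    f ∈ homog n ∧ ∀ M : Mat, IsUnit M → substM M f - f ∈ hitSub n := by
  simp [invPre, glSet]
theorem ph_hit {s t n : ℕ} {τ : List ℕ} (h : Gd s t τ) (M : Mat) (f : P4) (hf : f ∈ hitSub n) :
    ph M (sp τ) f = 0 :=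
  LinearMap.mem_ker.mp (ph_HH M τ (Gd_ok h).1 (Gd_ok h).2 (hit_le_HH n hf))
theorem inv_const {s t n : ℕ} {τ : List ℕ} (h : Gd s t τ) (M : Mat) (hM : IsUnit M) (f : P4)
    (hf : f ∈ invPre n glSet) : ph M (sp τ) f = ph 1 (sp τ) f := by
  have h1 := ph_hit h 1 _ (((mem_inv f).mp hf).2 M hM)
  rw [map_sub, sub_eq_zero, ← ph_mul, mul_one] at h1
  exact h1
theorem const_inv {s t n : ℕ} (hs : 1 ≤ s) (ht : 5 ≤ t) (hn : n + 2 = 2 ^ (s + t) + 2 ^ s) (f : P4)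
    (hf : f ∈ homog n) (c : List ℕ → kk)
    (h0 : ∀ τ, Gd s t τ → ∀ M : Mat, IsUnit M → ph M (sp τ) f = c τ) : f ∈ invPre n glSet := by
  rw [mem_inv]
  refine ⟨hf, fun N hN => upper hs ht hn _ (Submodule.sub_mem _ (substM_mem N f hf) hf) ?_⟩
  intro τ hτ M hM
  rw [map_sub, ← ph_mul, h0 τ hτ _ (hN.mul hM), h0 τ hτ M hM, sub_self]
theorem Qmk_eq_zero {n : ℕ} {f : P4} (hf : f ∈ homog n) : Qmk n f = 0 ↔ f ∈ hitSub n := by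
  have : (toHomog n f : P4) = f := by
    have h1 : homogeneousComponent n f = f := by rw [homogeneousComponent_of_mem hf, if_pos rfl]
    exact h1
  rw [Qmk, LinearMap.comp_apply, Submodule.mkQ_apply, Submodule.Quotient.mk_eq_zero,
    Submodule.mem_comap, Submodule.subtype_apply, this]
theorem inv_finrank {n k : ℕ} (th : Fin k → P4 →ₗ[kk] kk) (f : Fin k → P4)
    (hth : ∀ i, ∀ g ∈ hitSub n, th i g = 0) (hf : ∀ j, f j ∈ invPre n glSet)
    (hd : ∀ i j, th i (f j) = if i = j then 1 else 0)
    (hz : ∀ g ∈ invPre n glSet, (∀ i, th i g = 0) → g ∈ hitSub n) :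
    Module.finrank kk ↥(QInv n glSet) = k := by
  have hh : ∀ g ∈ invPre n glSet, g ∈ homog n := fun g hg => ((mem_inv g).mp hg).1
  have hli : LinearIndependent kk fun j => Qmk n (f j) := by
    rw [Fintype.linearIndependent_iff]
    intro c hc i
    have h1 : Qmk n (∑ j, c j • f j) = 0 := by rw [map_sum]; simpa using hc
    rw [Qmk_eq_zero (Submodule.sum_mem _ fun j _ => Submodule.smul_mem _ _ (hh _ (hf j)))] at h1
    have h2 := hth i _ h1
    simpa [hd] using h2
  have hsp : Submodule.span kk (Set.range fun j => Qmk n (f j)) = QInv n glSet := by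
    apply le_antisymm
    · rw [Submodule.span_le]
      rintro _ ⟨j, rfl⟩
      exact ⟨f j, hf j, rfl⟩
    · rintro _ ⟨g, hg, rfl⟩
      have h1 : g - ∑ j, th j g • f j ∈ hitSub n := by
        apply hz
        · exact Submodule.sub_mem _ hg (Submodule.sum_mem _ fun j _ => Submodule.smul_mem _ _ (hf j))
        · intro i; simp [hd]
      rw [← Qmk_eq_zero (Submodule.sub_mem _ (hh g hg)
        (Submodule.sum_mem _ fun j _ => Submodule.smul_mem _ _ (hh _ (hf j)))), map_sub, sub_eq_zero] at h1
      rw [h1, map_sum]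
      refine Submodule.sum_mem _ fun j _ => ?_
      rw [map_smul]
      exact Submodule.smul_mem _ _ (Submodule.subset_span ⟨j, rfl⟩)
  rw [← hsp, finrank_span_eq_card hli, Fintype.card_fin]
theorem inv_dim {s t n k : ℕ} (hs : 1 ≤ s) (ht : 5 ≤ t) (hn : n + 2 = 2 ^ (s + t) + 2 ^ s)
    (τ : Fin k → List ℕ) (hτ : ∀ i, Gd s t (τ i)) (f : Fin k → P4) (hf : ∀ j, f j ∈ homog n)
    (c : Fin k → List ℕ → kk)
    (hc : ∀ j σ, Gd s t σ → ∀ M : Mat, IsUnit M → ph M (sp σ) (f j) = c j σ)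
    (hd : ∀ i j, c j (τ i) = if i = j then 1 else 0)
    (hz : ∀ g ∈ invPre n glSet, (∀ i, ph 1 (sp (τ i)) g = 0) → ∀ σ, Gd s t σ → ph 1 (sp σ) g = 0) :
    Module.finrank kk ↥(QInv n glSet) = k := by
  refine inv_finrank (fun i => ph 1 (sp (τ i))) f ?_ ?_ ?_ ?_
  · intro i g hg; exact ph_hit (hτ i) 1 g hg
  · intro j; exact const_inv hs ht hn (f j) (hf j) (c j) (hc j)
  · intro i j; rw [hc j _ (hτ i) 1 isUnit_one, hd]
  · intro g hg h
    refine upper hs ht hn g ((mem_inv g).mp hg).1 fun σ hσ M hM => ?_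
    rw [inv_const hσ M hM g hg]; exact hz g hg h σ hσ
theorem substM_mon (M : Mat) (m : Fin 4 → kk) (j : Fin 4 → Fin 4)
    (h : ∀ i, ∑ k, M i k • (X k : P4) = m i • X (j i)) (E : Fin 4 → ℕ) :
    substM M (xp E) = (∏ i, m i ^ E i) • xp (fun k => ∑ i, if j i = k then E i else 0) := by
  have e : ∀ F : Fin 4 → ℕ, xp F = ∏ k, X k ^ F k := fun F => rfl
  rw [e E, map_prod]
  simp only [map_pow, substM, aeval_X, h, smul_pow]
  rw [Finset.prod_smul]
  congr 1
  rw [e]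
  simp only [← Finset.prod_pow_eq_pow_sum]
  rw [Finset.prod_comm]
  refine Finset.prod_congr rfl fun i _ => ?_
  rw [Finset.prod_eq_single (j i)]
  · simp
  · intro b _ hb; rw [if_neg hb.symm, pow_zero]
  · simp
theorem cf_cols (E : Fin 4 → ℕ) (M N : Mat) (h : ∀ i j, E j ≠ 0 → M i j = N i j) (g : P4) :
    cf E (substM M g) = cf E (substM N g) := by
  classical
  let d : Fin 4 → kk := fun j => if E j ≠ 0 then 1 else 0
  have key : ∀ g : P4, cf E (substM (Matrix.diagonal d) g) = cf E g := by
    intro g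
    induction g using xp_induction with
    | h0 => simp
    | hx F =>
      rw [substM_mon (Matrix.diagonal d) d id (fun i => by simp [Matrix.diagonal_apply]), map_smul]
      have : (fun k => ∑ i, if id i = k then F i else 0) = F := by funext k; simp
      rw [this, cf_xp]
      by_cases hE : E = F
      · subst hE
        have : ∏ i, d i ^ E i = 1 := by
          refine Finset.prod_eq_one fun i _ => ?_
          by_cases hi : E i = 0
          · rw [hi, pow_zero]
          · simp [d, hi]
        rw [this, one_smul]
      · simp [hE]
    | ha a b h1 h2 => simp only [map_add, h1, h2]
  have hMN : M * Matrix.diagonal d = N * Matrix.diagonal d := by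
    ext i j
    rw [Matrix.mul_diagonal, Matrix.mul_diagonal]
    by_cases hj : E j = 0
    · simp [d, hj]
    · rw [h i j hj]
  rw [← key, ← key (substM N g), ← substM_mul, ← substM_mul, hMN]
theorem ex_rep (m k : ℕ) (hk : k ≤ 4) (w : List ℕ) (i : Fin 4) :
    ex (sp (List.replicate m k ++ w)) i = (if (i : ℕ) < k then 2 ^ m - 1 else 0) + 2 ^ m * ex (sp w) i := by
  induction m with
  | zero => simp
  | succ m ih =>
    have : ex (sp (List.replicate (m + 1) k ++ w)) i =
        (if (i : ℕ) < k then 1 else 0) + 2 * ex (sp (List.replicate m k ++ w)) i := by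
      rw [← cb_sp k hk i]; rfl
    rw [this, ih, pow_succ]
    have := Nat.one_le_two_pow (n := m)
    split_ifs
    · zify [this, Nat.one_le_two_pow, show 1 ≤ 2 ^ m * 2 by omega]; ring
    · ring
theorem ex_ones (m : ℕ) : ex (sp (List.replicate m 1)) = Pi.single 0 (2 ^ m - 1) := by
  funext i
  have := ex_rep m 1 (by norm_num) [] i
  rw [List.append_nil] at this
  rw [this]
  fin_cases i <;> simp [sp, ex]
theorem ex_gI (s t : ℕ) : ex (sp (gI s t)) = ![2 ^ (s + t) - 1, 2 ^ s - 1, 0, 0] := by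
  funext i
  have h1 := Nat.one_le_two_pow (n := s)
  have h2 := Nat.one_le_two_pow (n := t)
  rw [gI, ex_rep s 2 (by norm_num), ex_ones]
  fin_cases i <;> simp
  rw [pow_add, Nat.mul_sub, mul_one]
  have := Nat.le_mul_of_pos_right (2 ^ s) h2
  omega
theorem ph_ones (M : Mat) (m : ℕ) (E : Fin 4 → ℕ) (hE : ∑ i, E i = 2 ^ m - 1) :
    ph M (sp (List.replicate m 1)) (xp E) = ∏ i, M i 0 ^ E i := by
  rw [ph, LinearMap.comp_apply, AlgHom.toLinearMap_apply, ex_ones,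
    cf_cols _ M (Matrix.of fun i j => if j = 0 then M i 0 else 0), substM_mon _ (fun i => M i 0) (fun _ => 0), map_smul, cf_xp,
    if_pos, smul_eq_mul, mul_one]
  · funext k
    fin_cases k <;> simp [hE]
  · intro i; simp
  · intro i j hj
    by_cases h : j = 0
    · subst h; simp
    · simp [h] at hj
theorem phI_cols {a b c d s t : ℕ} (f : P4) :
    ph (Mm [a, b, c, d]) (sp (gI s t)) f = ph (Mm [a, b, 0, 0]) (sp (gI s t)) f := by
  rw [ph, ph, LinearMap.comp_apply, LinearMap.comp_apply]
  refine cf_cols _ _ _ ?_ f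
  intro i j hj
  rw [ex_gI] at hj
  fin_cases j <;> simp at hj <;> rfl
theorem phI_e0 (s t b : ℕ) (hb : tb b 0 = false) (E : Fin 4 → ℕ)
    (hE : ∑ i, E i + 2 = 2 ^ (s + t) + 2 ^ s) : ph (Mm [1, b, 0, 0]) (sp (gI s t)) (xp E) =
    if E 0 + 1 = 2 ^ (s + t) then kb (tb b 1) ^ E 1 * kb (tb b 2) ^ E 2 * kb (tb b 3) ^ E 3 else 0 := by
  have h1 := Nat.one_le_two_pow (n := s)
  have h2 := Nat.one_le_two_pow (n := s + t)
  rw [ph, LinearMap.comp_apply, AlgHom.toLinearMap_apply, ex_gI,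
    substM_mon _ (![1, kb (tb b 1), kb (tb b 2), kb (tb b 3)]) ![0, 1, 1, 1], map_smul, cf_xp]
  · rw [Fin.sum_univ_four] at hE
    have hiff : (![2 ^ (s + t) - 1, 2 ^ s - 1, 0, 0] = fun k : Fin 4 =>
        ∑ i : Fin 4, if (![0, 1, 1, 1] : Fin 4 → Fin 4) i = k then E i else 0) ↔ E 0 + 1 = 2 ^ (s + t) := by
      constructor
      · intro h
        have := congrFun h 0
        simp [Fin.sum_univ_four] at this; omega
      · intro h
        funext k
        fin_cases k <;> simp [Fin.sum_univ_four] <;> omega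
    simp only [hiff]
    split_ifs <;> simp [Fin.prod_univ_four]
  · intro i
    have d1 : ∀ i : Fin 4, kb (tb 1 i) = if i = 0 then 1 else 0 := by decide
    have d2 : ∀ i : Fin 4, kb (tb 0 i) = 0 := by decide
    have e1 : Mm [1, b, 0, 0] i 0 = if i = 0 then 1 else 0 := d1 i
    have e2 : Mm [1, b, 0, 0] i 1 = kb (tb b i) := rfl
    have e3 : Mm [1, b, 0, 0] i 2 = 0 := d2 i
    have e4 : Mm [1, b, 0, 0] i 3 = 0 := d2 i
    rw [Fin.sum_univ_four, e1, e2, e3, e4]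
    have : kb false = 0 := rfl
    fin_cases i <;> simp [hb, this]
theorem choose_top (r : ℕ) : ∀ n k, k + 1 = 2 ^ r → k < n → n ≤ 2 * k → n.choose k % 2 = 0 := by
  induction r with
  | zero => intro n k h; rw [pow_zero] at h; omega
  | succ r ih =>
    intro n k h h1 h2
    have h3 : n.choose k ≡ (n % 2).choose (k % 2) * (n / 2).choose (k / 2) [MOD 2] :=
      have : Fact (Nat.Prime 2) := ⟨Nat.prime_two⟩
      Choose.choose_modEq_choose_mod_mul_choose_div_nat
    unfold Nat.ModEq at h3
    rw [pow_succ] at h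
    rw [h3]
    rcases Nat.mod_two_eq_zero_or_one n with hn | hn
    · rw [hn, show k % 2 = 1 by omega]; simp
    · rw [Nat.mul_mod, ih (n / 2) (k / 2) (by omega) (by omega) (by omega)]; simp
theorem U_ij : ∀ i j : Fin 4, kb (tb (([1, 3, 4, 8] : List ℕ).getD j 0) i) =
    if i = j ∨ (i = 0 ∧ j = 1) then 1 else 0 := by decide
theorem cf_U (N K r : ℕ) (hN : N + 1 = 2 ^ r) (hK : K ≤ N) (g : P4) (hg : g ∈ homog (N + K)) :
    cf ![N, K, 0, 0] (substM (Mm [1, 3, 4, 8]) g) = cf ![N, K, 0, 0] g := by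
  refine homog_induct (p := fun g => cf ![N, K, 0, 0] (substM (Mm [1, 3, 4, 8]) g) = cf ![N, K, 0, 0] g)
    (by simp) ?_ (fun a b h1 h2 => by simp only [map_add, h1, h2]) g hg
  intro E hE
  have e : ∀ F : Fin 4 → ℕ, xp F = X 0 ^ F 0 * X 1 ^ F 1 * X 2 ^ F 2 * X 3 ^ F 3 := fun F => by
    rw [xp, Fin.prod_univ_four]
  have hM : ∀ i j, Mm [1, 3, 4, 8] i j = if i = j ∨ (i = 0 ∧ j = 1) then 1 else 0 := U_ij
  have h1 : substM (Mm [1, 3, 4, 8]) (xp E) = ∑ m ∈ Finset.range (E 0 + 1),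
      ((E 0).choose m : kk) • xp ![m, E 0 - m + E 1, E 2, E 3] := by
    rw [e E]
    simp only [map_mul, map_pow, substM, aeval_X, hM, Fin.sum_univ_four]
    simp only [Fin.isValue, Fin.reduceEq, or_true, or_false, and_true, and_false, if_true, if_false,
      one_smul, zero_smul, add_zero, zero_add]
    rw [add_pow, Finset.sum_mul, Finset.sum_mul, Finset.sum_mul]
    refine Finset.sum_congr rfl fun m hm => ?_
    rw [e, smul_eq_C_mul, map_natCast]
    simp only [Matrix.cons_val]
    ring
  rw [h1, map_sum]
  simp only [map_smul, cf_xp, smul_eq_mul]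
  rw [Fin.sum_univ_four] at hE
  have h2 : ∀ m ∈ Finset.range (E 0 + 1), ((E 0).choose m : kk) *
      (if ![N, K, 0, 0] = ![m, E 0 - m + E 1, E 2, E 3] then 1 else 0) = 
      if m = N then (if ![N, K, 0, 0] = E then 1 else 0) else 0 := by
    intro m hm
    rw [Finset.mem_range] at hm
    by_cases hc : ![N, K, 0, 0] = ![m, E 0 - m + E 1, E 2, E 3]
    · rw [if_pos hc, mul_one]
      have c0 := congrFun hc 0
      have c1 := congrFun hc 1
      have c2 := congrFun hc 2
      have c3 := congrFun hc 3
      simp at c0 c1 c2 c3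
      rw [if_pos c0.symm]
      by_cases h0 : E 0 = N
      · rw [if_pos, h0, c0]
        · simp
        · funext i; fin_cases i <;> simp <;> omega
      · rw [if_neg]
        · have := choose_top r (E 0) N hN (by omega) (by omega)
          rw [← c0, ZMod.natCast_eq_zero_iff]; omega
        · intro h; apply h0; rw [← h]; rfl
    · rw [if_neg hc, mul_zero]
      by_cases hmN : m = N
      · rw [if_pos hmN, if_neg]
        intro h; apply hc
        subst h
        simp only [Matrix.cons_val] at *
        subst hmN; simp
      · rw [if_neg hmN]
  rw [Finset.sum_congr rfl h2]
  by_cases hE' : ![N, K, 0, 0] = E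
  · subst hE'; simp
  · simp [hE']
theorem tb_xor : ∀ a < 16, ∀ b < 16, ∀ i < 4, tb (a ^^^ b) i = (tb a i ^^ tb b i) := by decide +kernel
theorem phI_U {s t a b : ℕ} (ha : a < 16) (hb : b < 16) (f : P4)
    (hf : f ∈ homog (2 ^ (s + t) - 1 + (2 ^ s - 1))) :
    ph (Mm [a, a ^^^ b, 0, 0]) (sp (gI s t)) f = ph (Mm [a, b, 0, 0]) (sp (gI s t)) f := by
  have h1 : Mm [a, b, 0, 0] * Mm [1, 3, 4, 8] = Mm [a, a ^^^ b, 0, 0] := by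
    have hM : ∀ i j, Mm [1, 3, 4, 8] i j = if i = j ∨ (i = 0 ∧ j = 1) then 1 else 0 := U_ij
    ext i j
    rw [Matrix.mul_apply, Fin.sum_univ_four]
    simp only [hM]
    have e0 : ∀ c, Mm [a, c, 0, 0] i 0 = kb (tb a i) := fun c => rfl
    have e1 : ∀ c, Mm [a, c, 0, 0] i 1 = kb (tb c i) := fun c => rfl
    have e2 : ∀ c, Mm [a, c, 0, 0] i 2 = kb (tb 0 i) := fun c => rfl
    have e3 : ∀ c, Mm [a, c, 0, 0] i 3 = kb (tb 0 i) := fun c => rfl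
    fin_cases j
    · simp [e0, e1, e2, e3]
    · simp [e0, e1, e2, e3, tb_xor a ha b hb i i.2, kb_xor]
    · simp [e0, e1, e2, e3]
    · simp [e0, e1, e2, e3]
  have h2 := Nat.one_le_two_pow (n := s)
  have h3 := Nat.pow_le_pow_right (n := 2) (by norm_num) (show s ≤ s + t by omega)
  rw [← h1, ph_mul, ph, LinearMap.comp_apply, AlgHom.toLinearMap_apply, ex_gI,
    cf_U _ _ (s + t) (by omega) (by omega) _ (substM_mem _ f hf), ph, LinearMap.comp_apply, ex_gI]
  rfl
theorem DD_append (u w : List ℕ) : DD (u ++ w) = DD u + 2 ^ u.length * DD w := by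
  induction u with
  | nil => simp [DD]
  | cons a u ih => simp only [List.cons_append, DD, ih, List.length_cons, pow_succ]; ring
theorem tight (τ2 : List ℕ) (τ1 : List ℕ) (h1 : ∀ k ∈ τ1, k = 3 ∨ k = 4) : ∀ F : Fin 4 → ℕ,
    ∑ i, F i = DD (τ1 ++ τ2) → (∀ M, ph M (sp (τ1 ++ τ2)) (xp F) = 0) ∨
    ∃ l F', l.map pc = τ1 ∧ (∀ c ∈ l, c < 16) ∧ ∑ i, F' i = DD τ2 ∧ F = ex l + 2 ^ l.length • F' ∧
      ∀ M, ph M (sp (τ1 ++ τ2)) (xp F) = (List.zipWith (pl M) (sp τ1) l).prod * ph M (sp τ2) (xp F') := by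
  induction τ1 with
  | nil => intro F hF; right; exact ⟨[], F, by simp [sp, ex]; simpa using hF⟩
  | cons k τ ih =>
    intro F hF
    have hk := h1 k (by simp)
    obtain ⟨c, hc, hcw, hF2⟩ := split2 F
    set F2 : Fin 4 → ℕ := fun i => F i / 2 with hF2d
    have hs : ∑ i, F i = pc c + 2 * ∑ i, F2 i := by
      conv_lhs => rw [hF2]
      rw [← sum_cb, Finset.mul_sum, ← Finset.sum_add_distrib]; rfl
    have e : xp F = xp (cb c) * xp F2 ^ 2 := by conv_lhs => rw [hF2, xp_add, xp_pow]
    have hD : DD (k :: τ ++ τ2) = k + 2 * DD (τ ++ τ2) := rfl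
    have h4 := wt_le F
    have hpk := pc_sp k (by omega)
    have hstep : ∀ M, ph M (sp (k :: τ ++ τ2)) (xp F) = pl M (2 ^ k - 1) c * ph M (sp (τ ++ τ2)) (xp F2) := by
      intro M
      rw [e]
      exact ph_cons M (2 ^ k - 1) (sp (τ ++ τ2)) c _ (by omega)
    by_cases hpc : pc c = k
    · rcases ih (fun k hk => h1 k (by simp [hk])) F2 (by omega) with h | ⟨l, F', a1, a2, a3, a4, a5⟩
      · left; intro M; rw [hstep, h, mul_zero]
      · right
        refine ⟨c :: l, F', by simp [hpc, a1], by simpa [hc] using a2, a3, ?_, ?_⟩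
        · rw [hF2, a4, ex, List.length_cons, pow_succ, mul_comm, mul_smul, smul_add, add_assoc]
        · intro M; rw [hstep, a5, ← mul_assoc]; rfl
    · left; intro M; rw [hstep, pl_ne M (by omega), zero_mul]
def TS (τ : List ℕ) : Submodule kk P4 := Submodule.span kk {p | ∃ l, l.map pc = τ ∧ p = mono l}
theorem mono_TS {l τ : List ℕ} (h : l.map pc = τ) : mono l ∈ TS τ := Submodule.subset_span ⟨l, h, rfl⟩
theorem sum_ex (l : List ℕ) : ∑ i, ex l i = DD (l.map pc) := by
  induction l with
  | nil => simp [ex, DD]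
  | cons c l ih =>
    simp only [List.map_cons, DD, ← ih, ← sum_cb, Finset.mul_sum, ← Finset.sum_add_distrib]
    rfl
theorem TS_homog {τ : List ℕ} {n : ℕ} (h : DD τ = n) : TS τ ≤ homog n := by
  rw [TS, Submodule.span_le]
  rintro _ ⟨l, hl, rfl⟩
  exact xp_mem (by rw [sum_ex, hl, h])
theorem ltw_ex (u v w : List ℕ) (p q : ℕ) (hpq : p < q) : ∀ l : List ℕ, l.map pc = u ++ p :: v →
    ltw (ex l) (u ++ q :: w) := by
  induction u with
  | nil =>
    intro l hl
    cases l with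
    | nil => simp at hl
    | cons c l =>
      simp only [List.map_cons, List.nil_append, List.cons.injEq] at hl
      left
      rw [ex, wt_add2, wt_cb]; omega
  | cons a u ih =>
    intro l hl
    cases l with
    | nil => simp at hl
    | cons c l =>
      simp only [List.map_cons, List.cons_append, List.cons.injEq] at hl
      have := ltw_cons (cb_le c) (ih l hl.2)
      rw [wt_cb, hl.1] at this
      exact this
theorem TS_low {τ τ' u v w : List ℕ} {p q : ℕ} (h4 : ∀ k ∈ τ', k ≤ 4) (e : τ = u ++ p :: v)
    (e' : τ' = u ++ q :: w) (hpq : p < q) (M : Mat) (f : P4) (hf : f ∈ TS τ) : ph M (sp τ') f = 0 := by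
  have : TS τ ≤ LinearMap.ker (ph M (sp τ')) := by
    rw [TS, Submodule.span_le]
    rintro _ ⟨l, hl, rfl⟩
    refine ph_low M (sp τ') [] ⟨0, rfl⟩ (ex l) ?_
    rw [sp_pc τ' h4, List.append_nil, e']
    exact ltw_ex u v w p q hpq l (by rw [hl, e])
  exact this hf
def padl (m : ℕ) (l : List ℕ) : List ℕ := l ++ List.replicate (m - l.length) (l.headD 0)
theorem padl_pc {m k : ℕ} {l : List ℕ} (h : ∀ c ∈ l, pc c = k) (hm : l.length ≤ m) (h0 : l = [] → m = 0) :
    (padl m l).map pc = List.replicate m k := by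
  rw [List.eq_replicate_iff]
  constructor
  · simp [padl]; omega
  · intro b hb
    simp only [padl, List.map_append, List.mem_append, List.mem_map, List.map_replicate, List.mem_replicate] at hb
    rcases hb with ⟨c, hc, rfl⟩ | ⟨h1, rfl⟩
    · exact h c hc
    · cases l with
      | nil => exact absurd (h0 rfl) (by simpa using h1)
      | cons a l => exact h a (by simp)
theorem padl_prod (m : ℕ) (l : List ℕ) (g : ℕ → kk) (h0 : l = [] → m = 0) :
    ((padl m l).map g).prod = (l.map g).prod := by
  rw [padl, List.map_append, List.prod_append, List.map_replicate, List.prod_replicate]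
  cases l with
  | nil => simp [h0 rfl]
  | cons a l =>
    simp only [List.headD_cons, List.map_cons, List.prod_cons]
    rcases kk_zero_or_one (g a) with h | h <;> simp [h]
theorem zip_rep (M : Mat) (m k : ℕ) (l : List ℕ) (h : l.length = m) :
    List.zipWith (pl M) (sp (List.replicate m k)) l = l.map (pl M (2 ^ k - 1)) := by
  subst h
  induction l with
  | nil => rfl
  | cons c l ih => simp only [sp, List.length_cons, List.replicate_succ, List.map_cons, List.zipWith_cons_cons]
                   simp only [sp] at ih
                   rw [ih]
theorem rep_len {l : List ℕ} {m k : ℕ} (h : l.map pc = List.replicate m k) : l.length = m := by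
  simpa using congrArg List.length h
theorem zip_app (M : Mat) (σ1 σ2 l1 l2 : List ℕ) (h : l1.length = σ1.length) :
    (List.zipWith (pl M) (σ1 ++ σ2) (l1 ++ l2)).prod =
    (List.zipWith (pl M) σ1 l1).prod * (List.zipWith (pl M) σ2 l2).prod := by
  rw [List.zipWith_append h.symm, List.prod_append]
theorem sp_app (a b : List ℕ) : sp (a ++ b) = sp a ++ sp b := by simp [sp]
theorem ph_pad (M : Mat) (hM : IsUnit M) (f A k1 B k2 : ℕ) (S T : List ℕ) (h1 : k1 ≤ 4) (h2 : k2 ≤ 4)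
    (hS : ∀ c ∈ S, pc c = k1) (hT : ∀ c ∈ T, pc c = k2) (hA : S.length ≤ A) (hB : T.length ≤ B)
    (hA0 : S = [] → A = 0) (hB0 : T = [] → B = 0) :
    mono (List.replicate f 15 ++ (padl A S ++ padl B T)) ∈
      TS (List.replicate f 4 ++ (List.replicate A k1 ++ List.replicate B k2)) ∧
    ph M (sp (List.replicate f 4 ++ (List.replicate A k1 ++ List.replicate B k2)))
      (mono (List.replicate f 15 ++ (padl A S ++ padl B T))) =
      (S.map (pl M (2 ^ k1 - 1))).prod * (T.map (pl M (2 ^ k2 - 1))).prod := by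
  have p0 : (List.replicate f 15).map pc = List.replicate f 4 := by rw [List.map_replicate]; rfl
  have p1 := padl_pc hS hA hA0
  have p2 := padl_pc hT hB hB0
  have hp : (List.replicate f 15 ++ (padl A S ++ padl B T)).map pc =
      List.replicate f 4 ++ (List.replicate A k1 ++ List.replicate B k2) := by
    rw [List.map_append, List.map_append, p0, p1, p2]
  refine ⟨mono_TS hp, ?_⟩
  rw [ph_mono _ _ _ (by
    rw [hp, sp_pc]
    intro k hk
    simp only [List.mem_append, List.mem_replicate] at hk
    omega), sp_app, sp_app, zip_app _ _ _ _ _ (by simp [sp]), zip_app _ _ _ _ _ (by simp [sp, rep_len p1]),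
    zip_rep _ _ _ _ (by simp), zip_rep _ _ _ _ (rep_len p1), zip_rep _ _ _ _ (rep_len p2),
    padl_prod _ _ _ hA0, padl_prod _ _ _ hB0]
  have : pl M (2 ^ 4 - 1) 15 = 1 := (unit_iff M).mp hM
  rw [List.map_replicate, List.prod_replicate, this, one_pow, one_mul]
theorem pl_k {a b c d k x : ℕ} (hk : k ≤ 3) (hx : x < 16) :
    pl (Mm [a, b, c, d]) (2 ^ k - 1) x = kb (pbc ([a, b, c].take k) (2 ^ k - 1) x) := by
  rw [← pl_pb _ _ _ (lt_of_le_of_lt (Nat.sub_le_sub_right (Nat.pow_le_pow_right (by norm_num) hk) 1) (by norm_num)) hx]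
  refine cf_cols _ _ _ ?_ _
  intro i j hj
  rw [cb_sp k (by omega)] at hj
  have hj : (j : ℕ) < k := by by_contra h; simp [h] at hj
  rw [Mm, Mm]
  congr 2
  have h3 : k = 0 ∨ k = 1 ∨ k = 2 ∨ k = 3 := by omega
  rcases h3 with rfl | rfl | rfl | rfl <;> fin_cases j <;> simp at hj <;> rfl
theorem all_prod (g : ℕ → Bool) (l : List ℕ) : (l.map fun x => kb (g x)).prod = kb (l.all g) := by
  induction l with
  | nil => rfl
  | cons a l ih => rw [List.map_cons, List.prod_cons, ih, List.all_cons, kb_and]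
theorem xor_ne {a b c d : ℕ} (h : IsUnit (Mm [a, b, c, d])) (x y z : Bool) (hx : x ∨ y ∨ z)
    (he : ∀ i < 4, ((x && tb a i) ^^ ((y && tb b i) ^^ (z && tb c i))) = false) : False := by
  have h1 : (Mm [a, b, c, d]).mulVec ![kb x, kb y, kb z, 0] = 0 := by
    funext i
    have := congrArg kb (he i i.2)
    rw [kb_xor, kb_xor, kb_and, kb_and, kb_and] at this
    rw [Matrix.mulVec, dotProduct, Fin.sum_univ_four]
    simp only [Matrix.cons_val, mul_zero, add_zero, Pi.zero_apply]
    have e : kb false = 0 := rfl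
    rw [e] at this
    rw [← this]
    have e0 : Mm [a, b, c, d] i 0 = kb (tb a i) := rfl
    have e1 : Mm [a, b, c, d] i 1 = kb (tb b i) := rfl
    have e2 : Mm [a, b, c, d] i 2 = kb (tb c i) := rfl
    rw [e0, e1, e2]; ring
  have h2 : (![kb x, kb y, kb z, 0] : Fin 4 → kk) = 0 :=
    Matrix.mulVec_injective_of_isUnit h (by rw [h1, Matrix.mulVec_zero])
  have h3 := congrFun h2 0
  have h4 := congrFun h2 1
  have h5 := congrFun h2 2
  simp at h3 h4 h5
  revert h3 h4 h5 hx
  cases x <;> cases y <;> cases z <;> decide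
def ind3 (a b c : ℕ) : Bool := a != 0 && b != 0 && c != 0 && a != b && a != c && b != c && (a ^^^ b) != c
theorem ind3_unit {a b c d : ℕ} (ha : a < 16) (hb : b < 16) (h : IsUnit (Mm [a, b, c, d])) :
    ind3 a b c = true := by
  have z0 : ∀ i < 4, tb 0 i = false := by decide
  simp only [ind3, Bool.and_eq_true, bne_iff_ne]
  refine ⟨⟨⟨⟨⟨⟨?_, ?_⟩, ?_⟩, ?_⟩, ?_⟩, ?_⟩, ?_⟩ <;> intro h0
  · exact xor_ne h true false false (by simp) fun i hi => by simp [h0, z0 i hi]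
  · exact xor_ne h false true false (by simp) fun i hi => by simp [h0, z0 i hi]
  · exact xor_ne h false false true (by simp) fun i hi => by simp [h0, z0 i hi]
  · exact xor_ne h true true false (by simp) fun i hi => by simp [h0]
  · exact xor_ne h true false true (by simp) fun i hi => by simp [h0]
  · exact xor_ne h false true true (by simp) fun i hi => by simp [h0]
  · exact xor_ne h true true true (by simp) fun i hi => by 
      simp only [← h0, tb_xor a ha b hb i hi]; cases tb a i <;> cases tb b i <;> rfl
def Rz (τ : List ℕ) (g : ℕ → ℕ → ℕ → kk) : Prop := ∃ f ∈ TS τ, ∀ a < 16, ∀ b < 16, ∀ c < 16, ∀ d < 16,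
  IsUnit (Mm [a, b, c, d]) → ph (Mm [a, b, c, d]) (sp τ) f = g a b c
theorem Rz.sum {τ : List ℕ} {ι : Type} (I : Finset ι) (g : ι → ℕ → ℕ → ℕ → kk) (h : ∀ i ∈ I, Rz τ (g i)) :
    Rz τ fun a b c => ∑ i ∈ I, g i a b c := by
  classical
  induction I using Finset.induction_on with
  | empty => exact ⟨0, Submodule.zero_mem _, by simp⟩
  | insert i I hi ih =>
    obtain ⟨f1, h1, h1'⟩ := h i (by simp)
    obtain ⟨f2, h2, h2'⟩ := ih fun j hj => h j (by simp [hj])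
    refine ⟨f1 + f2, Submodule.add_mem _ h1 h2, ?_⟩
    intro a ha b hb c hc d hd hu
    rw [map_add, h1' a ha b hb c hc d hd hu, h2' a ha b hb c hc d hd hu]
    beta_reduce
    rw [Finset.sum_insert hi]
theorem Rz.smul {τ : List ℕ} (r : kk) {g : ℕ → ℕ → ℕ → kk} (h : Rz τ g) : Rz τ fun a b c => r * g a b c := by
  obtain ⟨f, h1, h2⟩ := h
  exact ⟨r • f, Submodule.smul_mem _ _ h1, fun a ha b hb c hc d hd hu => by
    rw [map_smul, h2 a ha b hb c hc d hd hu, smul_eq_mul]⟩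
theorem Rz.congr {τ : List ℕ} {g g' : ℕ → ℕ → ℕ → kk} (h : Rz τ g)
    (he : ∀ a < 16, ∀ b < 16, ∀ c < 16, ind3 a b c = true → g a b c = g' a b c) : Rz τ g' := by
  obtain ⟨f, h1, h2⟩ := h
  exact ⟨f, h1, fun a ha b hb c hc d hd hu => by
    rw [h2 a ha b hb c hc d hd hu, he a ha b hb c hc (ind3_unit ha hb hu)]⟩
theorem Rz_pad (f A k1 B k2 : ℕ) (S T : List ℕ) (h1 : k1 ≤ 3) (h2 : k2 ≤ 3)
    (hS : ∀ c ∈ S, c < 16 ∧ pc c = k1) (hT : ∀ c ∈ T, c < 16 ∧ pc c = k2) (hA : S.length ≤ A) (hB : T.length ≤ B)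
    (hA0 : S = [] → A = 0) (hB0 : T = [] → B = 0) :
    Rz (List.replicate f 4 ++ (List.replicate A k1 ++ List.replicate B k2)) fun a b c =>
      kb (S.all (pbc ([a, b, c].take k1) (2 ^ k1 - 1))) * kb (T.all (pbc ([a, b, c].take k2) (2 ^ k2 - 1))) := by
  refine ⟨_, (ph_pad 1 isUnit_one f A k1 B k2 S T (by omega) (by omega) (fun c hc => (hS c hc).2)
    (fun c hc => (hT c hc).2) hA hB hA0 hB0).1, ?_⟩
  intro a ha b hb c hc d hd hu
  rw [(ph_pad _ hu f A k1 B k2 S T (by omega) (by omega) (fun c hc => (hS c hc).2)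
    (fun c hc => (hT c hc).2) hA hB hA0 hB0).2]
  beta_reduce
  rw [← all_prod, ← all_prod]
  congr 2
  · exact List.map_congr_left fun x hx => pl_k h1 (hS x hx).1
  · exact List.map_congr_left fun x hx => pl_k h2 (hT x hx).1
def lo (z : ℕ) : ℕ := if tb z 0 then 0 else if tb z 1 then 1 else if tb z 2 then 2 else 3
def oth (z : ℕ) : List ℕ := [0, 1, 2, 3].filter (· != lo z)
def prs (z S : ℕ) : List ℕ := ([0, 1, 2].filter (tb S)).map fun m => 2 ^ lo z + 2 ^ (oth z).getD m 0
def rep (z y : ℕ) : ℕ := (([0, 1, 2].filter (tb y)).map fun m => 2 ^ (oth z).getD m 0).sum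
def ons (T : ℕ) : List ℕ := [1, 2, 4, 8].filter fun x => T &&& x == x
def Yv (a b : ℕ) : ℕ := ([0, 1, 2].map fun m =>
  if (prs a (2 ^ m)).all (pbc [a, b] 3) then 2 ^ m else 0).sum
theorem ons_ok : ∀ T ∈ Finset.Icc 1 15, (∀ c ∈ ons T, c < 16 ∧ pc c = 1) ∧ (ons T).length ≤ 4 ∧ ons T ≠ [] := by
  decide +kernel
theorem prs_ok : ∀ z ∈ Finset.Icc 1 15, ∀ S ∈ Finset.Icc 1 7, (∀ c ∈ prs z S, c < 16 ∧ pc c = 2) ∧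
    (prs z S).length = pc S ∧ prs z S ≠ [] := by decide +kernel
theorem ons_sum : ∀ a < 16, ∀ z ∈ Finset.Icc 1 15, ∑ T ∈ (Finset.Icc 1 15).filter (fun T => T &&& z = z),
    kb ((ons T).all (pbc [a] 1)) = if z = a then 1 else 0 := by decide +kernel
theorem prs_Y : ∀ a ∈ Finset.Icc 1 15, ∀ b ∈ (Finset.Icc 1 15).erase a,
    Yv a b ∈ Finset.Icc 1 7 ∧ (rep a (Yv a b) = b ∨ rep a (Yv a b) = a ^^^ b) ∧
    ∀ S ∈ Finset.Icc 1 7, (prs a S).all (pbc [a, b] 3) = decide (S &&& Yv a b = S) := by decide +kernel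
theorem pc_two : ∀ i : Fin 4, pc (2 ^ (i : ℕ)) = 1 := by decide
theorem cb_two : ∀ i j : Fin 4, cb (2 ^ (i : ℕ)) j = if j = i then 1 else 0 := by decide
theorem moeb3 (F : ℕ → kk) : ∀ Y ∈ Finset.Icc 1 7, ∑ S ∈ Finset.Icc 1 7,
    (∑ y ∈ (Finset.Icc 1 7).filter (fun y => y &&& S = y), F y) * kb (decide (S &&& Y = S)) = F Y := by
  have h : ∀ G : Fin 8 → kk, ∀ Y ∈ Finset.Icc 1 7, ∑ S ∈ Finset.Icc 1 7,
    (∑ y ∈ (Finset.Icc 1 7).filter (fun y => y &&& S = y), G (Fin.ofNat 8 y)) * kb (decide (S &&& Y = S)) =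
      G (Fin.ofNat 8 Y) := by decide +kernel
  intro Y hY
  have h1 := h (fun i => F i) Y hY
  have e : ∀ y ∈ Finset.Icc 1 7, F ((Fin.ofNat 8 y : Fin 8) : ℕ) = F y := by
    intro y hy
    rw [Finset.mem_Icc] at hy
    simp [Nat.mod_eq_of_lt (show y < 8 by omega)]
  rw [e Y hY] at h1
  rw [← h1]
  refine Finset.sum_congr rfl fun S _ => ?_
  congr 1
  exact Finset.sum_congr rfl fun y hy => (e y (Finset.mem_filter.mp hy).1).symm
theorem corrI (s t : ℕ) (ht : 5 ≤ t) (F : ℕ → ℕ → kk) (hU : ∀ a < 16, ∀ b < 16, F a (a ^^^ b) = F a b)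
    (hF : ∀ z ∈ Finset.Icc 1 15, ∀ S ∈ Finset.Icc 1 7, s < pc S →
      ∑ y ∈ (Finset.Icc 1 7).filter (fun y => y &&& S = y), F z (rep z y) = 0) :
    Rz (gI s t) fun a b _ => F a b := by
  have h := Rz.sum (τ := gI s t) (Finset.Icc 1 15) (fun z a b c =>
    ∑ S ∈ Finset.Icc 1 7, ∑ T ∈ (Finset.Icc 1 15).filter (fun T => T &&& z = z),
      (∑ y ∈ (Finset.Icc 1 7).filter (fun y => y &&& S = y), F z (rep z y)) *
      (kb ((prs z S).all (pbc [a, b] 3)) * kb ((ons T).all (pbc [a] 1)))) ?_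
  · refine h.congr ?_
    intro a ha b hb c hc hi
    simp only [ind3, Bool.and_eq_true, bne_iff_ne] at hi
    obtain ⟨⟨⟨⟨⟨⟨a0, b0⟩, -⟩, ab⟩, -⟩, -⟩, -⟩ := hi
    obtain ⟨y1, y2, y3⟩ := prs_Y a (by rw [Finset.mem_Icc]; omega) b
      (by rw [Finset.mem_erase, Finset.mem_Icc]; omega)
    have haz : a ∈ Finset.Icc 1 15 := by rw [Finset.mem_Icc]; omega
    simp only [← Finset.mul_sum]
    have e1 : ∀ z ∈ Finset.Icc 1 15, (∑ S ∈ Finset.Icc 1 7,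
        (∑ y ∈ (Finset.Icc 1 7).filter (fun y => y &&& S = y), F z (rep z y)) *
        (kb ((prs z S).all (pbc [a, b] 3)) * ∑ T ∈ (Finset.Icc 1 15).filter (fun T => T &&& z = z),
          kb ((ons T).all (pbc [a] 1)))) = if z = a then F a b else 0 := by
      intro z hz
      rw [ons_sum a ha z hz]
      by_cases hza : z = a
      · subst hza
        simp only [if_true, mul_one]
        rw [Finset.sum_congr rfl fun S hS => by rw [y3 S hS], moeb3 (fun y => F z (rep z y)) _ y1]
        rcases y2 with h | h
        · rw [h]
        · rw [h, hU z ha b hb]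
      · simp [hza]
    rw [Finset.sum_congr rfl e1]
    simp only [Finset.sum_ite_eq', haz, if_true]
  · intro z hz
    refine Rz.sum _ (fun S a b c => _) fun S hS => Rz.sum _ (fun T a b c => _) fun T hT => ?_
    obtain ⟨o1, o2, o3⟩ := ons_ok T (Finset.mem_filter.mp hT).1
    obtain ⟨q1, q2, q3⟩ := prs_ok z hz S hS
    by_cases hs : s < pc S
    · rw [hF z hz S hS hs]
      simp only [zero_mul]
      exact ⟨0, Submodule.zero_mem _, by simp⟩
    · exact Rz.smul _ (Rz_pad 0 s 2 t 1 (prs z S) (ons T) (by norm_num) (by norm_num) q1 o1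
        (by omega) (by omega) (fun h => absurd h q3) (fun h => absurd h o3))
theorem corrII {s t n : ℕ} (ht : 5 ≤ t) (hD : DD (gII s t) = n) (f : P4) (hf : f ∈ homog n) :
    ∃ f' ∈ TS (gII s t), ∀ M : Mat, ph M (sp (gII s t)) f' = ph M (sp (gII s t)) f := by
  refine homog_induct (p := fun f => ∃ f' ∈ TS (gII s t), ∀ M : Mat, ph M (sp (gII s t)) f' = ph M (sp (gII s t)) f)
    ⟨0, Submodule.zero_mem _, by simp⟩ ?_ ?_ f hf
  · intro E hE
    have e : gII s t = (4 :: List.replicate (s - 2) 3) ++ List.replicate (t + 1) 1 := by simp [gII]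
    have h := tight (List.replicate (t + 1) 1) (4 :: List.replicate (s - 2) 3)
      (by intro k hk; simp at hk; omega) E (by rw [hE, ← hD, e])
    rw [← e] at h
    rcases h with h | ⟨l, F', h1, h2, h3, -, h5⟩
    · exact ⟨0, Submodule.zero_mem _, fun M => by rw [h M, map_zero]⟩
    · have hm : DD (List.replicate (t + 1) 1) = 2 ^ (t + 1) - 1 := by
        have : ∀ m, DD (List.replicate m 1) = 2 ^ m - 1 := by
          intro m
          induction m with
          | zero => rfl
          | succ m ih =>
            rw [List.replicate_succ, DD, ih, pow_succ]
            have := Nat.one_le_two_pow (n := m); omega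
        exact this _
      rw [hm] at h3
      let T := (List.finRange 4).filter fun i => F' i != 0
      let Tl := T.map fun i : Fin 4 => 2 ^ (i : ℕ)
      have hT : ∀ c ∈ Tl, pc c = 1 := by
        intro c hc
        obtain ⟨i, -, rfl⟩ := List.mem_map.mp hc
        exact pc_two i
      have hl : Tl.length ≤ t + 1 := by
        have := List.length_filter_le (fun i => F' i != 0) (List.finRange 4)
        simp only [Tl, T, List.length_map]
        rw [List.length_finRange] at this
        omega
      have h0 : Tl = [] → t + 1 = 0 := by
        intro h
        exfalso
        have h6 : ∀ i, F' i = 0 := by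
          intro i
          by_contra hi
          have : i ∈ T := List.mem_filter.mpr ⟨List.mem_finRange i, by simpa using hi⟩
          rw [List.map_eq_nil_iff.mp h] at this
          simp at this
        simp only [h6, Finset.sum_const_zero] at h3
        have := Nat.one_lt_two_pow (n := t + 1) (by omega)
        omega
      have hp := padl_pc hT hl h0
      have hpp : (l ++ padl (t + 1) Tl).map pc = gII s t := by rw [List.map_append, h1, hp, e]
      refine ⟨mono (l ++ padl (t + 1) Tl), mono_TS hpp, fun M => ?_⟩
      rw [h5, ph_ones M _ F' h3, ph_mono _ _ _ (by 
        rw [hpp, sp_pc]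
        intro k hk
        simp only [gII, List.mem_cons, List.mem_append, List.mem_replicate] at hk
        omega), e, sp_app, zip_app _ _ _ _ _ (by
        rw [sp, List.length_map, ← h1, List.length_map]), zip_rep _ _ _ _ (rep_len hp), padl_prod _ _ _ h0]
      congr 1
      have e1 : ∀ i : Fin 4, pl M (2 ^ 1 - 1) (2 ^ (i : ℕ)) = M i 0 := by
        intro i
        have := ph_ones M 1 (cb (2 ^ (i : ℕ))) (by rw [sum_cb, pc_two]; rfl)
        rw [Finset.prod_eq_single i (fun j _ hj => by rw [cb_two, if_neg hj, pow_zero]) (by simp), cb_two,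
          if_pos rfl, pow_one] at this
        rw [← this]
        have : ex (sp (List.replicate 1 1)) = cb (2 ^ 1 - 1) := by funext j; simp [sp, ex]
        rw [ph, this]
        rfl
      simp only [Tl, T, List.map_map, Function.comp_def, e1]
      rw [← List.prod_ofFn, List.ofFn_eq_map]
      generalize List.finRange 4 = L
      induction L with
      | nil => rfl
      | cons a L ih =>
        by_cases ha : F' a = 0
        · simp [List.filter_cons, ha, ih]
        · have : M a 0 ^ F' a = M a 0 := by
            rcases kk_zero_or_one (M a 0) with h | h <;> simp [h, ha]
          simp [List.filter_cons, ha, ih, this]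
  · rintro a b ⟨f1, h1, h1'⟩ ⟨f2, h2, h2'⟩
    exact ⟨f1 + f2, Submodule.add_mem _ h1 h2, fun M => by rw [map_add, map_add, h1', h2']⟩
theorem Rz.lsum {τ : List ℕ} {ι : Type} (L : List ι) (g : ι → ℕ → ℕ → ℕ → kk) (h : ∀ i ∈ L, Rz τ (g i)) :
    Rz τ fun a b c => (L.map fun i => g i a b c).sum := by
  induction L with
  | nil => exact ⟨0, Submodule.zero_mem _, by simp⟩
  | cons i I ih =>
    obtain ⟨f1, h1, h1'⟩ := h i (by simp)
    obtain ⟨f2, h2, h2'⟩ := ih fun j hj => h j (by simp [hj])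
    refine ⟨f1 + f2, Submodule.add_mem _ h1 h2, ?_⟩
    intro a ha b hb c hc d hd hu
    rw [map_add, h1' a ha b hb c hc d hd hu, h2' a ha b hb c hc d hd hu]
    rfl
def hbit (H x : ℕ) : Bool := tb H (if x == 14 then 0 else if x == 13 then 1 else if x == 11 then 2 else 3)
def pbit (P x : ℕ) : Bool := P / (if x == 3 then 1 else if x == 5 then 2 else if x == 9 then 4 else
  if x == 6 then 8 else if x == 10 then 16 else 32) % 2 == 1
def bsum (L : List ℕ) (f : ℕ → Bool) : ℕ := L.foldr (fun x r => (if f x then 1 else 0) + 2 * r) 0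
def hls : List ℕ := [14, 13, 11, 7]
def pls : List ℕ := [3, 5, 9, 6, 10, 12]
def Hm (a b c : ℕ) : ℕ := bsum hls (pbc [a, b, c] 7)
def Pm (a b : ℕ) : ℕ := bsum pls (pbc [a, b] 3)
def par (x : ℕ) : Bool := pc x % 2 == 1
def opts (x : ℕ) : List ℕ := hls.filter fun y => (15 - y) &&& x == 0
def goodH (a H : ℕ) : Bool := a != 0 && H != 0 && !(par (a &&& H))
def goodP (P H : ℕ) : Bool := P != 0 && !((pbit P 3 && pbit P 12) ^^ ((pbit P 5 && pbit P 10) ^^ (pbit P 9 && pbit P 6)))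
  && pls.all fun x => !(pbit P x) || (opts x).any (hbit H)
def frc (n : ℕ) (f : ℕ → Bool) : Bool := Nat.rec (f 0) (fun k _ => f (k + 1)) n
theorem frc_eq (n : ℕ) (f : ℕ → Bool) : frc n f = f n := by cases n <;> rfl
theorem chk0 : ∀ a < 16, ∀ b < 16, frc (Pm a b) (fun P => (List.range 16).all fun c => !(ind3 a b c) ||
    frc (Hm a b c) fun H => goodH a H && goodP P H) = true := by decide +kernel
theorem chk1 : ∀ a < 16, ∀ b < 16, ∀ c < 16, (!(ind3 a b c) || (goodH a (Hm a b c) && goodP (Pm a b) (Hm a b c))) = true := by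
  intro a ha b hb c hc
  have h := chk0 a ha b hb
  rw [frc_eq, List.all_eq_true] at h
  have h := h c (by simpa using hc)
  rwa [frc_eq] at h
theorem Hm_lt (a b c : ℕ) : Hm a b c < 16 := by
  simp only [Hm, bsum, hls, List.foldr_cons, List.foldr_nil]; split_ifs <;> norm_num
theorem Pm_lt (a b : ℕ) : Pm a b < 64 := by
  simp only [Pm, bsum, pls, List.foldr_cons, List.foldr_nil]; split_ifs <;> norm_num
theorem hbit_sum : ∀ x ∈ hls, ∀ u0 u1 u2 u3 : Bool, hbit ((if u0 then 1 else 0) + 2 * ((if u1 then 1 else 0) + 2 *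
    ((if u2 then 1 else 0) + 2 * ((if u3 then 1 else 0) + 2 * 0)))) x =
    if x == 14 then u0 else if x == 13 then u1 else if x == 11 then u2 else u3 := by decide +kernel
theorem pbit_sum : ∀ x ∈ pls, ∀ u0 u1 u2 u3 u4 u5 : Bool, pbit ((if u0 then 1 else 0) + 2 * ((if u1 then 1 else 0) + 2 *
    ((if u2 then 1 else 0) + 2 * ((if u3 then 1 else 0) + 2 * ((if u4 then 1 else 0) + 2 * ((if u5 then 1 else 0) + 2 * 0)))))) x =
    if x == 3 then u0 else if x == 5 then u1 else if x == 9 then u2 else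
    if x == 6 then u3 else if x == 10 then u4 else u5 := by decide +kernel
theorem hbit_Hm (a b c : ℕ) : ∀ x ∈ hls, pbc [a, b, c] 7 x = hbit (Hm a b c) x := by
  intro x hx
  simp only [Hm, bsum, hls, List.foldr_cons, List.foldr_nil]
  rw [hbit_sum x hx]
  simp only [hls, List.mem_cons, List.not_mem_nil, or_false] at hx
  rcases hx with rfl | rfl | rfl | rfl <;> rfl
theorem pbit_Pm (a b : ℕ) : ∀ x ∈ pls, pbc [a, b] 3 x = pbit (Pm a b) x := by
  intro x hx
  simp only [Pm, bsum, pls, List.foldr_cons, List.foldr_nil]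
  rw [pbit_sum x hx]
  simp only [pls, List.mem_cons, List.not_mem_nil, or_false] at hx
  rcases hx with rfl | rfl | rfl | rfl | rfl | rfl <;> rfl
theorem all_cg {p q : ℕ → Bool} {L : List ℕ} (h : ∀ x ∈ L, p x = q x) : L.all p = L.all q := by
  induction L with
  | nil => rfl
  | cons a L ih => rw [List.all_cons, List.all_cons, h a (by simp), ih fun x hx => h x (by simp [hx])]
def subs : List ℕ → List (List ℕ)
  | [] => [[]]
  | a :: l => (subs l) ++ (subs l).map (a :: ·)
def tII : List (List ℕ × List ℕ) := (List.range 16).tail.flatMap fun T =>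
  ((subs ((oth T).map fun j => 15 - 2 ^ j)).tail).map fun S => (S, ons T)
theorem tII_ok : ∀ i ∈ tII, (∀ c ∈ i.1, c < 16 ∧ pc c = 3) ∧ (∀ c ∈ i.2, c < 16 ∧ pc c = 1) ∧ i.1.length ≤ 3 ∧
    i.2.length ≤ 4 ∧ i.1 ≠ [] ∧ i.2 ≠ [] ∧ (∀ c ∈ i.1, c ∈ hls) := by decide +kernel
theorem tII_sum : ∀ a < 16, ∀ H < 16, (!(goodH a H) || (tII.map fun i => kb (i.1.all (hbit H)) * kb (i.2.all (pbc [a] 1))).sum == 1) = true := by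
  decide +kernel
theorem RzII (s t : ℕ) (hs : 5 ≤ s) (ht : 5 ≤ t) : Rz (gII s t) fun _ _ _ => 1 := by
  refine (Rz.lsum tII (fun i a b c => kb (i.1.all (pbc [a, b, c] 7)) * kb (i.2.all (pbc [a] 1))) ?_).congr ?_
  · intro i hi
    obtain ⟨h1, h2, h3, h4, h5, h6, h7⟩ := tII_ok i hi
    exact Rz_pad 1 (s - 2) 3 (t + 1) 1 i.1 i.2 (by norm_num) (by norm_num) h1 h2 (by omega) (by omega)
      (fun h => absurd h h5) (fun h => absurd h h6)
  · intro a ha b hb c hc hi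
    have h := chk1 a ha b hb c hc
    rw [hi, Bool.not_true, Bool.false_or, Bool.and_eq_true] at h
    have h2 := tII_sum a ha _ (Hm_lt a b c)
    rw [h.1, Bool.not_true, Bool.false_or, beq_iff_eq] at h2
    refine Eq.trans (congrArg List.sum (List.map_congr_left fun i hi => ?_)) h2
    rw [all_cg fun x hx => hbit_Hm a b c x ((tII_ok i hi).2.2.2.2.2.2 x hx)]
theorem ons_sum1 : ∀ a < 16, (a == 0 || ((List.range 16).tail.map fun T => kb ((ons T).all (pbc [a] 1))).sum == 1) = true := by
  decide +kernel
theorem ons_rng : ∀ T ∈ (List.range 16).tail, T ∈ Finset.Icc 1 15 := by decide +kernel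
theorem RzII2 (t : ℕ) (ht : 5 ≤ t) : Rz (gII 2 t) fun _ _ _ => 1 := by
  refine (Rz.lsum (List.range 16).tail (fun T a b c => kb (([] : List ℕ).all (pbc [a, b, c] 7)) * kb ((ons T).all (pbc [a] 1))) ?_).congr ?_
  · intro i hi
    obtain ⟨o1, o2, o3⟩ := ons_ok i (ons_rng i hi)
    exact Rz_pad 1 0 3 (t + 1) 1 [] (ons i) (by norm_num) (by norm_num) (by simp) o1 (by simp) (by omega)
      (fun _ => rfl) (fun h => absurd h o3)
  · intro a ha b hb c hc hi
    have h := ons_sum1 a ha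
    have ha : (a == 0) = false := by
      simp only [ind3, Bool.and_eq_true] at hi
      have := hi.1.1.1.1.1.1
      simpa using this
    rw [ha, Bool.false_or, beq_iff_eq] at h
    refine Eq.trans (congrArg List.sum (List.map_congr_left fun i hi => ?_)) h
    rw [List.all_nil]
    exact one_mul _
def tq : List (List ℕ) := (subs []).map (3 :: ·) ++ (subs [3]).map (5 :: ·) ++ (subs [3, 5]).map (9 :: ·) ++
  (subs [3, 5]).map (6 :: ·) ++ (subs [3, 9, 6]).map (10 :: ·) ++
  ((subs [5, 9, 6, 10]).filter fun l => l.length != 4).map (12 :: ·) ++ [[12, 5, 10], [12, 5, 10, 3]]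
def tIII : List (List ℕ × List ℕ) := tq.flatMap fun T => ((subs (opts (T.headD 0))).tail).map fun S => (S, T)
theorem tq_ok : ∀ T ∈ tq, (∀ c ∈ T, c < 16 ∧ pc c = 2) ∧ T.length ≤ 4 ∧ T ≠ [] ∧ (∀ c ∈ T, c ∈ pls) := by decide +kernel
theorem tIII_ok : ∀ i ∈ tIII, (∀ c ∈ i.1, c < 16 ∧ pc c = 3) ∧ i.1.length ≤ 2 ∧ i.1 ≠ [] ∧ (∀ c ∈ i.1, c ∈ hls) ∧ i.2 ∈ tq := by
  decide +kernel
theorem tIII_sum : ∀ P < 64, ∀ H < 16, (!(goodP P H) || (tIII.map fun i => kb (i.1.all (hbit H)) * kb (i.2.all (pbit P))).sum == 1) = true := by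
  decide +kernel
theorem tq_sum : ∀ P < 64, (!(goodP P 15) || (tq.map fun i => kb (i.all (pbit P))).sum == 1) = true := by
  decide +kernel
theorem goodP15 : ∀ P < 64, ∀ H < 16, (!(goodP P H) || goodP P 15) = true := by decide +kernel
theorem RzIII (s t : ℕ) (hs : 3 ≤ s) (ht : 5 ≤ t) : Rz (gIII s t) fun _ _ _ => 1 := by
  refine (Rz.lsum tIII (fun i a b c => kb (i.1.all (pbc [a, b, c] 7)) * kb (i.2.all (pbc [a, b] 3))) ?_).congr ?_
  · intro i hi
    obtain ⟨h1, h2, h3, h4, h5⟩ := tIII_ok i hi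
    obtain ⟨o1, o2, o3, o4⟩ := tq_ok i.2 h5
    exact Rz_pad 1 (s - 1) 3 (t - 1) 2 i.1 i.2 (by norm_num) (by norm_num) h1 o1 (by omega) (by omega)
      (fun h => absurd h h3) (fun h => absurd h o3)
  · intro a ha b hb c hc hi
    have h := chk1 a ha b hb c hc
    rw [hi, Bool.not_true, Bool.false_or, Bool.and_eq_true] at h
    have h2 := tIII_sum _ (Pm_lt a b) _ (Hm_lt a b c)
    rw [h.2, Bool.not_true, Bool.false_or, beq_iff_eq] at h2
    refine Eq.trans (congrArg List.sum (List.map_congr_left fun i hi => ?_)) h2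
    rw [all_cg fun x hx => hbit_Hm a b c x ((tIII_ok i hi).2.2.2.1 x hx),
      all_cg fun x hx => pbit_Pm a b x ((tq_ok i.2 (tIII_ok i hi).2.2.2.2).2.2.2 x hx)]
theorem RzIII1 (t : ℕ) (ht : 5 ≤ t) : Rz (gIII 1 t) fun _ _ _ => 1 := by
  refine (Rz.lsum tq (fun i a b c => kb (([] : List ℕ).all (pbc [a, b, c] 7)) * kb (i.all (pbc [a, b] 3))) ?_).congr ?_
  · intro i hi
    obtain ⟨o1, o2, o3, o4⟩ := tq_ok i hi
    exact Rz_pad 1 0 3 (t - 1) 2 [] i (by norm_num) (by norm_num) (by simp) o1 (by simp) (by omega)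
      (fun _ => rfl) (fun h => absurd h o3)
  · intro a ha b hb c hc hi
    have h := chk1 a ha b hb c hc
    rw [hi, Bool.not_true, Bool.false_or, Bool.and_eq_true] at h
    have h3 := goodP15 _ (Pm_lt a b) _ (Hm_lt a b c)
    rw [h.2, Bool.not_true, Bool.false_or] at h3
    have h2 := tq_sum _ (Pm_lt a b)
    rw [h3, Bool.not_true, Bool.false_or, beq_iff_eq] at h2
    refine Eq.trans (congrArg List.sum (List.map_congr_left fun i hi => ?_)) h2
    rw [List.all_nil, all_cg fun x hx => pbit_Pm a b x ((tq_ok i hi).2.2.2 x hx)]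
    exact one_mul _
theorem DD_rep (m k : ℕ) : DD (List.replicate m k) = k * (2 ^ m - 1) := by
  induction m with
  | zero => rfl
  | succ m ih =>
    rw [List.replicate_succ, DD, ih, pow_succ]
    have := Nat.one_le_two_pow (n := m)
    zify [this, show 1 ≤ 2 ^ m * 2 by omega]; ring
theorem DD_gI {s t n : ℕ} (hn : n + 2 = 2 ^ (s + t) + 2 ^ s) : DD (gI s t) = n := by
  have h1 := Nat.one_le_two_pow (n := s)
  have h2 := Nat.one_le_two_pow (n := t)
  rw [gI, DD_append, DD_rep, DD_rep, List.length_replicate]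
  zify [h1, h2] at hn ⊢; rw [pow_add] at hn; linear_combination -hn
theorem DD_gII {s t n : ℕ} (hs : 2 ≤ s) (hn : n + 2 = 2 ^ (s + t) + 2 ^ s) : DD (gII s t) = n := by
  obtain ⟨s, rfl⟩ := Nat.exists_eq_add_of_le' hs
  have h1 := Nat.one_le_two_pow (n := s)
  have h2 := Nat.one_le_two_pow (n := t + 1)
  rw [gII, DD, DD_append, DD_rep, DD_rep, List.length_replicate, Nat.add_sub_cancel]
  zify [h1, h2] at hn ⊢
  simp only [pow_add, pow_one, pow_two] at hn ⊢; linear_combination -hn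
theorem DD_gIII {s t n : ℕ} (hs : 1 ≤ s) (ht : 1 ≤ t) (hn : n + 2 = 2 ^ (s + t) + 2 ^ s) : DD (gIII s t) = n := by
  obtain ⟨s, rfl⟩ := Nat.exists_eq_add_of_le' hs
  obtain ⟨t, rfl⟩ := Nat.exists_eq_add_of_le' ht
  have h1 := Nat.one_le_two_pow (n := s)
  have h2 := Nat.one_le_two_pow (n := t)
  rw [gIII, DD, DD_append, DD_rep, DD_rep, List.length_replicate, Nat.add_sub_cancel, Nat.add_sub_cancel]
  zify [h1, h2] at hn ⊢
  simp only [pow_add, pow_one] at hn ⊢; linear_combination -hn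
theorem DD_gIV {t n : ℕ} (ht : 3 ≤ t) (hn : n + 2 = 2 ^ (1 + t) + 2 ^ 1) : DD (gIV t) = n := by
  obtain ⟨t, rfl⟩ := Nat.exists_eq_add_of_le' ht
  have h1 := Nat.one_le_two_pow (n := t)
  rw [gIV, DD, DD, DD_append, DD_rep, DD_rep, List.length_replicate, Nat.add_sub_cancel]
  zify [h1] at hn ⊢
  simp only [pow_add, pow_one] at hn ⊢; linear_combination -hn
theorem odd_zero {s t n : ℕ} {τ : List ℕ} (h : Gd s t τ) (L : List (List ℕ)) (hu : ∀ cl ∈ L, unitb cl = true)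
    (hl : L.length % 2 = 1) (g : P4) (hg : g ∈ invPre n glSet) :
    (L.map fun cl => ph (Mm cl) (sp τ) g).sum = ph 1 (sp τ) g := by
  have : (L.map fun cl => ph (Mm cl) (sp τ) g) = L.map fun _ => ph 1 (sp τ) g :=
    List.map_congr_left fun cl hcl => inv_const h _ (unitb_unit (hu cl hcl)) g hg
  rw [this, List.map_const', List.sum_replicate]
  rcases kk_zero_or_one (ph 1 (sp τ) g) with h | h
  · simp [h]
  · rw [h, nsmul_eq_mul, mul_one]
    exact (ZMod.natCast_eq_natCast_iff L.length 1 2).mpr (by rw [Nat.ModEq, hl])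
theorem cst {n : ℕ} (τ1 τ2 : List ℕ) (h1 : ∀ k ∈ τ1, k = 3 ∨ k = 4) (L : List (List ℕ))
    (hD : DD (τ1 ++ τ2) = n) (g : P4) (hg : g ∈ homog n)
    (key : ∀ l F', l.map pc = τ1 → (∀ c ∈ l, c < 16) → ∑ i, F' i = DD τ2 →
      (L.map fun cl => (List.zipWith (pl (Mm cl)) (sp τ1) l).prod * ph (Mm cl) (sp τ2) (xp F')).sum = 0) :
    (L.map fun cl => ph (Mm cl) (sp (τ1 ++ τ2)) g).sum = 0 := by
  refine homog_induct (p := fun g => (L.map fun cl => ph (Mm cl) (sp (τ1 ++ τ2)) g).sum = 0) ?_ ?_ ?_ g hg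
  · simp
  · intro E hE
    rcases tight τ2 τ1 h1 E (by rw [hE, hD]) with h | ⟨l, F', e1, e2, e3, -, e5⟩
    · simp [h]
    · simp only [e5]
      exact key l F' e1 e2 e3
  · intro a b ha hb
    simp only [map_add]
    rw [List.sum_map_add, ha, hb, add_zero]
theorem c_IV {t n : ℕ} (ht : 5 ≤ t) (hn : n + 2 = 2 ^ (1 + t) + 2 ^ 1) (g : P4) (hg : g ∈ invPre n glSet) :
    ph 1 (sp (gIV t)) g = 0 := by
  rw [← odd_zero (τ := gIV t) (Or.inr (Or.inr (Or.inr ⟨rfl, rfl⟩))) [[1, 2, 4, 8], [2, 1, 4, 8], [3, 1, 4, 8]]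
    (by decide +kernel) (by decide) g hg]
  refine cst (4 :: 4 :: List.replicate (t - 3) 3) (List.replicate 1 1)
    (by intro k hk; simp at hk; omega) _ (DD_gIV (by omega) hn) g ((mem_inv g).mp hg).1 ?_
  intro l F' h1 h2 h3
  have hq : ∀ c < 16, ∀ S ∈ [7, 15], pbc [2, 1, 4, 8] S c = pbc [1, 2, 4, 8] S c ∧
    pbc [3, 1, 4, 8] S c = pbc [1, 2, 4, 8] S c := by decide +kernel
  have hS : ∀ S ∈ sp (4 :: 4 :: List.replicate (t - 3) 3), S ∈ [7, 15] := by
    intro S hS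
    simp only [sp, List.map_cons, List.map_replicate, List.mem_cons, List.mem_replicate] at hS
    simp only [List.mem_cons, List.not_mem_nil, or_false]
    omega
  have hz : ∀ (σ l : List ℕ) , (∀ S ∈ σ, S ∈ [7, 15]) → (∀ c ∈ l, c < 16) →
      List.zipWith (pl (Mm [2, 1, 4, 8])) σ l = List.zipWith (pl (Mm [1, 2, 4, 8])) σ l ∧
      List.zipWith (pl (Mm [3, 1, 4, 8])) σ l = List.zipWith (pl (Mm [1, 2, 4, 8])) σ l := by
    intro σ
    induction σ with
    | nil => intro l _ _; simp
    | cons S σ ih =>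
      intro l hσ hl
      cases l with
      | nil => simp
      | cons c l =>
        have hS := hσ S (by simp)
        have hS' : S < 16 := by simp at hS; omega
        have hc := hl c (by simp)
        obtain ⟨i1, i2⟩ := ih l (fun S h => hσ S (by simp [h])) (fun c h => hl c (by simp [h]))
        rw [List.zipWith_cons_cons, List.zipWith_cons_cons, List.zipWith_cons_cons, i1, i2]
        simp only [pl_pb _ _ _ hS' hc]
        rw [(hq c hc S hS).1, (hq c hc S hS).2]
        exact ⟨rfl, rfl⟩
  obtain ⟨z1, z2⟩ := hz _ l hS h2
  have h3 : ∑ i, F' i = 2 ^ 1 - 1 := h3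
  simp only [List.map_cons, List.map_nil, List.sum_cons, List.sum_nil, z1, z2, ph_ones _ _ _ h3]
  have hf : ∀ a < 2, ∀ b < 2, ∀ c < 2, ∀ d < 2, a + b + c + d = 1 →
      kb (tb 1 0) ^ a * kb (tb 1 1) ^ b * kb (tb 1 2) ^ c * kb (tb 1 3) ^ d +
      (kb (tb 2 0) ^ a * kb (tb 2 1) ^ b * kb (tb 2 2) ^ c * kb (tb 2 3) ^ d +
      (kb (tb 3 0) ^ a * kb (tb 3 1) ^ b * kb (tb 3 2) ^ c * kb (tb 3 3) ^ d + 0)) = 0 := by decide +kernel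
  rw [Fin.sum_univ_four] at h3
  have := hf (F' 0) (by omega) (F' 1) (by omega) (F' 2) (by omega) (F' 3) (by omega) (by omega)
  simp only [Fin.prod_univ_four]
  have := congrArg (fun y => (List.zipWith (pl (Mm [1, 2, 4, 8])) (sp (4 :: 4 :: List.replicate (t - 3) 3)) l).prod * y) this
  simp only [mul_add, mul_zero] at this
  exact this
theorem c_III2 {t n : ℕ} (ht : 5 ≤ t) (hn : n + 2 = 2 ^ (2 + t) + 2 ^ 2) (g : P4) (hg : g ∈ invPre n glSet) :
    ph 1 (sp (gIII 2 t)) g = 0 := by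
  rw [← odd_zero (τ := gIII 2 t) (Or.inr (Or.inr (Or.inl rfl))) [[1, 2, 4, 8], [1, 2, 8, 4], [1, 2, 12, 8]]
    (by decide +kernel) (by decide) g hg]
  refine cst [4, 3] (List.replicate (t - 1) 2)
    (by intro k hk; simp at hk; omega) _ (DD_gIII (s := 2) (by omega) (by omega) hn) g ((mem_inv g).mp hg).1 ?_
  intro l F' h1 h2 h3
  have ht : ∀ c d c' d' : ℕ, ph (Mm [1, 2, c, d]) (sp (List.replicate (t - 1) 2)) (xp F') =
      ph (Mm [1, 2, c', d']) (sp (List.replicate (t - 1) 2)) (xp F') := by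
    intro c d c' d'
    refine cf_cols _ _ _ ?_ _
    intro i j hj
    have := ex_rep (t - 1) 2 (by norm_num) [] j
    rw [List.append_nil] at this
    rw [this] at hj
    fin_cases j <;> simp [sp, ex] at hj <;> rfl
  obtain ⟨c0, c1, rfl⟩ := List.length_eq_two.mp (by simpa using congrArg List.length h1 : l.length = 2)
  · have hq : ∀ c < 16, ∀ c' < 16, kb (pbc [1, 2, 4, 8] 15 c) * kb (pbc [1, 2, 4, 8] 7 c') +
        (kb (pbc [1, 2, 8, 4] 15 c) * kb (pbc [1, 2, 8, 4] 7 c') +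
        (kb (pbc [1, 2, 12, 8] 15 c) * kb (pbc [1, 2, 12, 8] 7 c') + 0)) = 0 := by decide +kernel
    have hc := h2 c0 (by simp)
    have hc' := h2 c1 (by simp)
    have e := hq c0 hc c1 hc'
    simp only [List.map_cons, List.map_nil, List.sum_cons, List.sum_nil, sp, List.zipWith_cons_cons,
      List.zipWith_nil_left, List.prod_cons, List.prod_nil, mul_one]
    simp only [sp] at ht
    rw [ht 8 4 4 8, ht 12 8 4 8]
    rw [pl_pb _ _ _ (by norm_num) hc, pl_pb _ _ _ (by norm_num) hc, pl_pb _ _ _ (by norm_num) hc,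
      pl_pb _ _ _ (by norm_num) hc', pl_pb _ _ _ (by norm_num) hc', pl_pb _ _ _ (by norm_num) hc']
    generalize ph _ _ _ = x
    norm_num only at e ⊢
    linear_combination x * e
def L7 : List (List ℕ) := [[1, 2, 4, 8], [1, 2, 8, 4], [1, 4, 8, 2], [1, 6, 8, 2], [1, 10, 4, 2], [1, 12, 2, 4], [1, 6, 10, 2]]
theorem c_II34 {s t n : ℕ} (hs : s = 3 ∨ s = 4) (hn : n + 2 = 2 ^ (s + t) + 2 ^ s) (g : P4)
    (hg : g ∈ invPre n glSet) : ph 1 (sp (gII s t)) g = 0 := by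
  rw [← odd_zero (τ := gII s t) (Or.inr (Or.inl ⟨by omega, rfl⟩)) L7 (by decide +kernel) (by decide) g hg]
  refine cst (4 :: List.replicate (s - 2) 3) (List.replicate (t + 1) 1)
    (by intro k hk; simp at hk; omega) _ (DD_gII (by omega) hn) g ((mem_inv g).mp hg).1 ?_
  intro l F' h1 h2 h3
  have ht : ∀ cl ∈ L7, ph (Mm cl) (sp (List.replicate (t + 1) 1)) (xp F') =
      ph (Mm [1, 0, 0, 0]) (sp (List.replicate (t + 1) 1)) (xp F') := by
    intro cl hcl
    have hcl : cl.getD 0 0 = 1 := by revert cl; decide +kernel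
    refine cf_cols _ _ _ ?_ _
    intro i j hj
    rw [ex_ones] at hj
    have hj : j = 0 := by by_contra h; simp [h] at hj
    subst hj
    have : ∀ cl, Mm cl i 0 = kb (tb (cl.getD 0 0) i) := fun _ => rfl
    rw [this, this, hcl]
    rfl
  rw [List.map_congr_left fun cl hcl => by rw [ht cl hcl], List.sum_map_mul_right]
  suffices (L7.map fun cl => (List.zipWith (pl (Mm cl)) (sp (4 :: List.replicate (s - 2) 3)) l).prod).sum = 0 by
    rw [this, zero_mul]
  have e15 : (2 ^ 4 - 1) = 15 := by norm_num
  have e7 : (2 ^ 3 - 1) = 7 := by norm_num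
  rcases hs with rfl | rfl
  · obtain ⟨c0, c1, rfl⟩ := List.length_eq_two.mp (by simpa using congrArg List.length h1 : l.length = 2)
    · have hc := h2 c0 (by simp)
      have hc' := h2 c1 (by simp)
      have hq : ∀ c < 16, ∀ c' < 16, (L7.map fun cl => kb (pbc cl 15 c) * kb (pbc cl 7 c')).sum = 0 := by decide +kernel
      rw [← hq c0 hc c1 hc']
      refine congrArg List.sum (List.map_congr_left fun cl _ => ?_)
      simp only [sp, List.map_cons, List.map_nil, Nat.reduceSub, List.replicate_one, List.zipWith_cons_cons,
        List.zipWith_nil_left, List.prod_cons, List.prod_nil, mul_one, Nat.reducePow]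
      rw [pl_pb _ _ _ (by norm_num) hc, pl_pb _ _ _ (by norm_num) hc']
  · obtain ⟨c0, c1, c2, rfl⟩ := List.length_eq_three.mp (by simpa using congrArg List.length h1 : l.length = 3)
    · have hc := h2 c0 (by simp)
      have hc' := h2 c1 (by simp)
      have hc2 := h2 c2 (by simp)
      have hp : c0 = 15 := by
        have h := (List.cons.inj h1).1
        have : ∀ c < 16, pc c = 4 → c = 15 := by decide
        exact this c0 hc h
      have hq : ∀ c' < 16, ∀ c2 < 16, (L7.map fun cl => kb (pbc cl 15 15) * (kb (pbc cl 7 c') * kb (pbc cl 7 c2))).sum = 0 := by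
        decide +kernel
      rw [← hq c1 hc' c2 hc2]
      refine congrArg List.sum (List.map_congr_left fun cl _ => ?_)
      simp only [sp, List.map_cons, List.map_nil, Nat.reduceSub, List.replicate_succ, List.replicate_zero, List.zipWith_cons_cons,
        List.zipWith_nil_left, List.prod_cons, List.prod_nil, mul_one, Nat.reducePow]
      rw [hp, pl_pb _ _ _ (by norm_num) (by norm_num), pl_pb _ _ _ (by norm_num) hc', pl_pb _ _ _ (by norm_num) hc2]
def Nl (z : ℕ) : List ℕ := z :: (oth z).map (2 ^ ·)
theorem Nl_unit : ∀ z ∈ Finset.Icc 1 15, unitb (Nl z) = true := by decide +kernel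
theorem Nl_mul0 : ∀ z ∈ Finset.Icc 1 15, ∀ y ∈ Finset.Icc 1 7, ∀ i j : Fin 4,
    kb (tb ([z, rep z y, 0, 0].getD j 0) i) =
      ∑ k : Fin 4, kb (tb ((Nl z).getD k 0) i) * kb (tb ([1, 2 * y, 0, 0].getD j 0) k) := by decide +kernel
theorem Nl_mul (z : ℕ) (hz : z ∈ Finset.Icc 1 15) (y : ℕ) (hy : y ∈ Finset.Icc 1 7) :
    Mm [z, rep z y, 0, 0] = Mm (Nl z) * Mm [1, 2 * y, 0, 0] := by
  ext i j
  rw [Matrix.mul_apply]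
  exact Nl_mul0 z hz y hy i j
theorem tb2y : ∀ y ∈ Finset.Icc 1 7, tb (2 * y) 0 = false := by decide
theorem s1num : ∀ S ∈ (Finset.Icc 1 7).filter (fun S => 1 < pc S), ∀ a < 2, ∀ b < 2, ∀ c < 2, a + b + c = 1 →
    ∑ y ∈ (Finset.Icc 1 7).filter (fun y => y &&& S = y),
      kb (tb (2 * y) 1) ^ a * kb (tb (2 * y) 2) ^ b * kb (tb (2 * y) 3) ^ c = 0 := by decide +kernel
theorem s2num : ∀ a < 4, ∀ b < 4, ∀ c < 4, a + b + c = 3 →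
    ∑ y ∈ (Finset.Icc 1 7).filter (fun y => y &&& 7 = y),
      kb (tb (2 * y) 1) ^ a * kb (tb (2 * y) 2) ^ b * kb (tb (2 * y) 3) ^ c =
      if 1 = a ∧ 1 = b ∧ 1 = c then 1 else 0 := by decide +kernel
theorem e0sum1 {t n : ℕ} (hn : n + 2 = 2 ^ (1 + t) + 2 ^ 1) (S : ℕ) (hS : S ∈ Finset.Icc 1 7) (hp : 1 < pc S)
    (g : P4) (hg : g ∈ homog n) :
    ∑ y ∈ (Finset.Icc 1 7).filter (fun y => y &&& S = y), ph (Mm [1, 2 * y, 0, 0]) (sp (gI 1 t)) g = 0 := by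
  refine homog_induct (p := fun g => ∑ y ∈ (Finset.Icc 1 7).filter (fun y => y &&& S = y),
    ph (Mm [1, 2 * y, 0, 0]) (sp (gI 1 t)) g = 0) (by simp) ?_ ?_ g hg
  · intro E hE
    rw [Finset.sum_congr rfl fun y hy => phI_e0 1 t (2 * y) (tb2y y (Finset.mem_filter.mp hy).1) E (by omega)]
    by_cases h : E 0 + 1 = 2 ^ (1 + t)
    · simp only [h, if_true]
      rw [Fin.sum_univ_four] at hE
      exact s1num S (Finset.mem_filter.mpr ⟨hS, hp⟩) _ (by omega) _ (by omega) _ (by omega) (by omega)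
    · simp [h]
  · intro a b ha hb
    simp only [map_add, Finset.sum_add_distrib]
    rw [ha, hb, add_zero]
theorem ex_gII2 (t : ℕ) : ex (sp (gII 2 t)) = ![2 ^ (2 + t) - 1, 1, 1, 1] := by
  funext i
  have e : gII 2 t = List.replicate 1 4 ++ List.replicate (t + 1) 1 := rfl
  rw [e, ex_rep 1 4 (by norm_num), ex_ones]
  have := Nat.one_le_two_pow (n := t + 1)
  have h2 : 2 ^ (2 + t) = 2 * 2 ^ (t + 1) := by ring
  fin_cases i
  · simp [h2]; omega
  · simp
  · simp
  · simp
theorem e0sum2 {t n : ℕ} (hn : n + 2 = 2 ^ (2 + t) + 2 ^ 2) (g : P4) (hg : g ∈ homog n) :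
    ∑ y ∈ (Finset.Icc 1 7).filter (fun y => y &&& 7 = y), ph (Mm [1, 2 * y, 0, 0]) (sp (gI 2 t)) g =
      ph 1 (sp (gII 2 t)) g := by
  refine homog_induct (p := fun g => ∑ y ∈ (Finset.Icc 1 7).filter (fun y => y &&& 7 = y),
    ph (Mm [1, 2 * y, 0, 0]) (sp (gI 2 t)) g = ph 1 (sp (gII 2 t)) g) (by simp) ?_ ?_ g hg
  · intro E hE
    rw [Finset.sum_congr rfl fun y hy => phI_e0 2 t (2 * y) (tb2y y (Finset.mem_filter.mp hy).1) E (by omega)]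
    rw [ph, LinearMap.comp_apply, AlgHom.toLinearMap_apply, substM_one, cf_xp, ex_gII2]
    rw [Fin.sum_univ_four] at hE
    have h2 := Nat.one_le_two_pow (n := 2 + t)
    by_cases h : E 0 + 1 = 2 ^ (2 + t)
    · simp only [h, if_true]
      rw [s2num _ (by omega) _ (by omega) _ (by omega) (by omega)]
      refine if_congr ?_ rfl rfl
      constructor
      · rintro ⟨h1, h2, h3⟩
        funext i
        fin_cases i
        · simp; omega
        · simpa using h1
        · simpa using h2
        · simpa using h3
      · intro h
        exact ⟨congrFun h 1, congrFun h 2, congrFun h 3⟩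
    · simp only [h, if_false, Finset.sum_const_zero]
      rw [if_neg]
      intro h'
      have := congrFun h' 0
      simp at this
      omega
  · intro a b ha hb
    simp only [map_add, Finset.sum_add_distrib]
    rw [ha, hb]
theorem zsum1 {t n : ℕ} (hn : n + 2 = 2 ^ (1 + t) + 2 ^ 1) (z : ℕ) (hz : z ∈ Finset.Icc 1 15) (S : ℕ)
    (hS : S ∈ Finset.Icc 1 7) (hp : 1 < pc S) (g : P4) (hg : g ∈ homog n) :
    ∑ y ∈ (Finset.Icc 1 7).filter (fun y => y &&& S = y), ph (Mm [z, rep z y, 0, 0]) (sp (gI 1 t)) g = 0 := by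
  rw [← e0sum1 hn S hS hp (substM (Mm (Nl z)) g) (substM_mem _ g hg)]
  exact Finset.sum_congr rfl fun y hy => by rw [Nl_mul z hz y (Finset.mem_filter.mp hy).1, ph_mul]
theorem zsum2 {t n : ℕ} (hn : n + 2 = 2 ^ (2 + t) + 2 ^ 2) (z : ℕ) (hz : z ∈ Finset.Icc 1 15)
    (g : P4) (hg : g ∈ homog n) :
    ∑ y ∈ (Finset.Icc 1 7).filter (fun y => y &&& 7 = y), ph (Mm [z, rep z y, 0, 0]) (sp (gI 2 t)) g =
      ph (Mm (Nl z)) (sp (gII 2 t)) g := by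
  have := e0sum2 hn (substM (Mm (Nl z)) g) (substM_mem _ g hg)
  rw [← ph_mul, mul_one] at this
  rw [← this]
  exact Finset.sum_congr rfl fun y hy => by rw [Nl_mul z hz y (Finset.mem_filter.mp hy).1, ph_mul]
def yext (y : ℕ) : List ℕ := if tb y 0 then [1, 2 * y, 4, 8] else if tb y 1 then [1, 2 * y, 2, 8] else [1, 2 * y, 2, 4]
theorem yext_unit : ∀ y ∈ Finset.Icc 1 7, unitb (yext y) = true := by decide +kernel
theorem yext_ph {s t n : ℕ} (y : ℕ) (hy : y ∈ Finset.Icc 1 7) (g : P4) (hg : g ∈ invPre n glSet) :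
    ph (Mm [1, 2 * y, 0, 0]) (sp (gI s t)) g = ph 1 (sp (gI s t)) g := by
  rw [← inv_const (τ := gI s t) (Or.inl rfl) _ (unitb_unit (yext_unit y hy)) g hg, yext]
  split_ifs <;> exact phI_cols g |>.symm
theorem c_I1 {t n : ℕ} (hn : n + 2 = 2 ^ (1 + t) + 2 ^ 1) (g : P4) (hg : g ∈ invPre n glSet) :
    ph 1 (sp (gI 1 t)) g = 0 := by
  have h := e0sum1 hn 3 (by decide) (by decide) g ((mem_inv g).mp hg).1
  rw [Finset.sum_congr rfl fun y hy => yext_ph y (Finset.mem_filter.mp hy).1 g hg, Finset.sum_const] at h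
  have e : ((Finset.Icc 1 7).filter (fun y => y &&& 3 = y)).card = 3 := by decide
  rw [e] at h
  rcases kk_zero_or_one (ph 1 (sp (gI 1 t)) g) with h1 | h1
  · exact h1
  · rw [h1] at h; exact absurd h (by decide)
theorem c_I2 {t n : ℕ} (hn : n + 2 = 2 ^ (2 + t) + 2 ^ 2) (g : P4) (hg : g ∈ invPre n glSet) :
    ph 1 (sp (gI 2 t)) g = ph 1 (sp (gII 2 t)) g := by
  have h := e0sum2 hn g ((mem_inv g).mp hg).1
  rw [Finset.sum_congr rfl fun y hy => yext_ph y (Finset.mem_filter.mp hy).1 g hg, Finset.sum_const] at h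
  have e : ((Finset.Icc 1 7).filter (fun y => y &&& 7 = y)).card = 7 := by decide
  rw [e] at h
  rw [← h]
  rcases kk_zero_or_one (ph 1 (sp (gI 2 t)) g) with h1 | h1
  · rw [h1]; rfl
  · rw [h1]; decide
theorem addI {s t n : ℕ} (ht : 5 ≤ t) (hn : n + 2 = 2 ^ (s + t) + 2 ^ s) (f : P4) (hf : f ∈ homog n) (r : kk)
    (hF : ∀ z ∈ Finset.Icc 1 15, ∀ S ∈ Finset.Icc 1 7, s < pc S →
      ∑ y ∈ (Finset.Icc 1 7).filter (fun y => y &&& S = y), (ph (Mm [z, rep z y, 0, 0]) (sp (gI s t)) f + r) = 0) :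
    ∃ f' ∈ TS (gI s t), ∀ M : Mat, IsUnit M → ph M (sp (gI s t)) (f + f') = r := by
  have hf' : f ∈ homog (2 ^ (s + t) - 1 + (2 ^ s - 1)) := by
    have h1 := Nat.one_le_two_pow (n := s)
    have h2 := Nat.one_le_two_pow (n := s + t)
    convert hf using 2; omega
  obtain ⟨f', h1, h2⟩ := corrI s t ht (fun a b => ph (Mm [a, b, 0, 0]) (sp (gI s t)) f + r)
    (fun a ha b hb => by beta_reduce; rw [phI_U ha hb f hf']) hF
  refine ⟨f', h1, fun M hM => ?_⟩
  obtain ⟨a, ha, b, hb, c, hc, d, hd, rfl⟩ := exists_cl M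
  rw [map_add, h2 a ha b hb c hc d hd hM, phI_cols, ← add_assoc, CharTwo.add_self_eq_zero, zero_add]
theorem pc_le (S : ℕ) (hS : S ∈ Finset.Icc 1 7) : pc S ≤ 3 := by revert S; decide
theorem addI3 {s t n : ℕ} (hs : 3 ≤ s) (ht : 5 ≤ t) (hn : n + 2 = 2 ^ (s + t) + 2 ^ s) (f : P4)
    (hf : f ∈ homog n) (r : kk) :
    ∃ f' ∈ TS (gI s t), ∀ M : Mat, IsUnit M → ph M (sp (gI s t)) (f + f') = r :=
  addI ht hn f hf r fun z hz S hS h => absurd (pc_le S hS) (by omega)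
theorem addI1 {t n : ℕ} (ht : 5 ≤ t) (hn : n + 2 = 2 ^ (1 + t) + 2 ^ 1) (f : P4) (hf : f ∈ homog n) :
    ∃ f' ∈ TS (gI 1 t), ∀ M : Mat, IsUnit M → ph M (sp (gI 1 t)) (f + f') = 0 :=
  addI ht hn f hf 0 fun z hz S hS h => by simp only [add_zero]; exact zsum1 hn z hz S hS h f hf
theorem addI2 {t n : ℕ} (ht : 5 ≤ t) (hn : n + 2 = 2 ^ (2 + t) + 2 ^ 2) (f : P4) (hf : f ∈ homog n)
    (h1 : ∀ M : Mat, IsUnit M → ph M (sp (gII 2 t)) f = 1) :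
    ∃ f' ∈ TS (gI 2 t), ∀ M : Mat, IsUnit M → ph M (sp (gI 2 t)) (f + f') = 1 :=
  addI ht hn f hf 1 fun z hz S hS h => by
    have : ∀ S ∈ Finset.Icc 1 7, 2 < pc S → S = 7 := by decide
    obtain rfl := this S hS h
    rw [Finset.sum_add_distrib, zsum2 hn z hz f hf, h1 _ (unitb_unit (Nl_unit z hz))]
    decide
theorem RzU {τ : List ℕ} {r : kk} (h : Rz τ fun _ _ _ => r) : ∃ f ∈ TS τ, ∀ M : Mat, IsUnit M → ph M (sp τ) f = r := by
  obtain ⟨f, h1, h2⟩ := h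
  refine ⟨f, h1, fun M hM => ?_⟩
  obtain ⟨a, ha, b, hb, c, hc, d, hd, rfl⟩ := exists_cl M
  exact h2 a ha b hb c hc d hd hM
theorem low_I {s t : ℕ} {σ w : List ℕ} (hs : 1 ≤ s) (h4 : ∀ k ∈ σ, k ≤ 4) (e : σ = 4 :: w) (M : Mat) (f : P4)
    (hf : f ∈ TS (gI s t)) : ph M (sp σ) f = 0 := by
  obtain ⟨s, rfl⟩ := Nat.exists_eq_add_of_le' hs
  exact TS_low (u := []) (p := 2) (q := 4) (v := List.replicate s 2 ++ List.replicate t 1) (w := w) h4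
    (by simp [gI, List.replicate_succ]) e (by norm_num) M f hf
theorem low_I_II {s t : ℕ} (hs : 2 ≤ s) (M : Mat) (f : P4) (hf : f ∈ TS (gI s t)) : ph M (sp (gII s t)) f = 0 :=
  low_I (by omega) (Gd_ok (Or.inr (Or.inl ⟨hs, rfl⟩))).1 rfl M f hf
theorem low_I_III {s t : ℕ} (hs : 1 ≤ s) (M : Mat) (f : P4) (hf : f ∈ TS (gI s t)) : ph M (sp (gIII s t)) f = 0 :=
  low_I (by omega) (Gd_ok (s := s) (t := t) (Or.inr (Or.inr (Or.inl rfl)))).1 rfl M f hf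
theorem low_I_IV {t : ℕ} (M : Mat) (f : P4) (hf : f ∈ TS (gI 1 t)) : ph M (sp (gIV t)) f = 0 :=
  low_I (by omega) (Gd_ok (s := 1) (t := t) (Or.inr (Or.inr (Or.inr ⟨rfl, rfl⟩)))).1 rfl M f hf
theorem low_II_III {s t : ℕ} (hs : 2 ≤ s) (M : Mat) (f : P4) (hf : f ∈ TS (gII s t)) :
    ph M (sp (gIII s t)) f = 0 := by
  refine TS_low (u := 4 :: List.replicate (s - 2) 3) (p := 1) (q := 3) (v := List.replicate t 1)
    (w := List.replicate (t - 1) 2) (Gd_ok (s := s) (t := t) (Or.inr (Or.inr (Or.inl rfl)))).1 ?_ ?_ (by norm_num) M f hf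
  · simp [gII, List.replicate_succ]
  · obtain ⟨s, rfl⟩ := Nat.exists_eq_add_of_le' hs
    rw [gIII, show s + 2 - 1 = s + 1 by omega, Nat.add_sub_cancel, List.replicate_succ']
    simp
theorem low_III_IV {t : ℕ} (ht : 5 ≤ t) (M : Mat) (f : P4) (hf : f ∈ TS (gIII 1 t)) : ph M (sp (gIV t)) f = 0 := by
  obtain ⟨t, rfl⟩ := Nat.exists_eq_add_of_le' ht
  refine TS_low (u := [4]) (p := 2) (q := 4) (v := List.replicate (t + 3) 2)
    (Gd_ok (s := 1) (t := t + 5) (Or.inr (Or.inr (Or.inr ⟨rfl, rfl⟩)))).1 ?_ rfl (by norm_num) M f hf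
  rfl
theorem case1 {t n : ℕ} (ht : 5 ≤ t) (hn : n + 2 = 2 ^ (1 + t) + 2 ^ 1) :
    Module.finrank kk ↥(QInv n glSet) = 1 := by
  obtain ⟨f0, a1, a2⟩ := RzU (RzIII1 t ht)
  have b1 := TS_homog (DD_gIII (by omega) (by omega) hn) a1
  obtain ⟨f1, c1, c2⟩ := addI1 ht hn f0 b1
  have hf := Submodule.add_mem _ b1 (TS_homog (DD_gI hn) c1)
  have hIII : ∀ M : Mat, IsUnit M → ph M (sp (gIII 1 t)) (f0 + f1) = 1 := fun M hM => by
    rw [map_add, a2 M hM, low_I_III le_rfl M f1 c1, add_zero]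
  have hIV : ∀ M : Mat, IsUnit M → ph M (sp (gIV t)) (f0 + f1) = 0 := fun M hM => by
    rw [map_add, low_III_IV ht M f0 a1, low_I_IV M f1 c1, add_zero]
  refine inv_dim le_rfl ht hn (fun _ => gIII 1 t) (fun _ => Or.inr (Or.inr (Or.inl rfl))) (fun _ => f0 + f1)
    (fun _ => hf) (fun _ σ => ph 1 (sp σ) (f0 + f1)) ?_ ?_ ?_
  · rintro _ σ (rfl | ⟨h, rfl⟩ | rfl | ⟨-, rfl⟩) M hM
    · rw [c2 M hM, c2 1 isUnit_one]
    · omega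
    · rw [hIII M hM, hIII 1 isUnit_one]
    · rw [hIV M hM, hIV 1 isUnit_one]
  · intro i j
    rw [if_pos (Subsingleton.elim i j)]
    exact hIII 1 isUnit_one
  · rintro g hg h0 σ (rfl | ⟨h, rfl⟩ | rfl | ⟨-, rfl⟩)
    · exact c_I1 hn g hg
    · omega
    · exact h0 0
    · exact c_IV ht hn g hg
theorem case2 {t n : ℕ} (ht : 5 ≤ t) (hn : n + 2 = 2 ^ (2 + t) + 2 ^ 2) :
    Module.finrank kk ↥(QInv n glSet) = 1 := by
  obtain ⟨f0, a1, a2⟩ := RzU (RzII2 t ht)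
  have b1 := TS_homog (DD_gII (by omega) hn) a1
  obtain ⟨f1, c1, c2⟩ := addI2 ht hn f0 b1 a2
  have hf := Submodule.add_mem _ b1 (TS_homog (DD_gI hn) c1)
  have hII : ∀ M : Mat, IsUnit M → ph M (sp (gII 2 t)) (f0 + f1) = 1 := fun M hM => by
    rw [map_add, a2 M hM, low_I_II le_rfl M f1 c1, add_zero]
  have hIII : ∀ M : Mat, IsUnit M → ph M (sp (gIII 2 t)) (f0 + f1) = 0 := fun M hM => by
    rw [map_add, low_II_III le_rfl M f0 a1, low_I_III (by omega) M f1 c1, add_zero]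
  refine inv_dim (s := 2) (by omega) ht hn (fun _ => gII 2 t) (fun _ => Or.inr (Or.inl ⟨le_rfl, rfl⟩)) (fun _ => f0 + f1)
    (fun _ => hf) (fun _ σ => ph 1 (sp σ) (f0 + f1)) ?_ ?_ ?_
  · rintro _ σ (rfl | ⟨h, rfl⟩ | rfl | ⟨h, rfl⟩) M hM
    · rw [c2 M hM, c2 1 isUnit_one]
    · rw [hII M hM, hII 1 isUnit_one]
    · rw [hIII M hM, hIII 1 isUnit_one]
    · omega
  · intro i j
    rw [if_pos (Subsingleton.elim i j)]
    exact hII 1 isUnit_one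
  · rintro g hg h0 σ (rfl | ⟨h, rfl⟩ | rfl | ⟨h, rfl⟩)
    · rw [c_I2 hn g hg]; exact h0 0
    · exact h0 0
    · exact c_III2 ht hn g hg
    · omega
theorem elI {s t n : ℕ} (hs : 3 ≤ s) (ht : 5 ≤ t) (hn : n + 2 = 2 ^ (s + t) + 2 ^ s) : ∃ f ∈ homog n,
    ∀ M : Mat, IsUnit M → ph M (sp (gI s t)) f = 1 ∧ ph M (sp (gII s t)) f = 0 ∧ ph M (sp (gIII s t)) f = 0 := by
  obtain ⟨f, c1, c2⟩ := addI3 hs ht hn 0 (Submodule.zero_mem _) 1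
  simp only [zero_add] at c2
  exact ⟨f, TS_homog (DD_gI hn) c1, fun M hM => ⟨c2 M hM, low_I_II (by omega) M f c1, low_I_III (by omega) M f c1⟩⟩
theorem elII {s t n : ℕ} (hs : 5 ≤ s) (ht : 5 ≤ t) (hn : n + 2 = 2 ^ (s + t) + 2 ^ s) : ∃ f ∈ homog n,
    ∀ M : Mat, IsUnit M → ph M (sp (gI s t)) f = 0 ∧ ph M (sp (gII s t)) f = 1 ∧ ph M (sp (gIII s t)) f = 0 := by
  obtain ⟨f0, a1, a2⟩ := RzU (RzII s t hs ht)
  have b1 := TS_homog (DD_gII (by omega) hn) a1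
  obtain ⟨f, c1, c2⟩ := addI3 (by omega) ht hn f0 b1 0
  refine ⟨f0 + f, Submodule.add_mem _ b1 (TS_homog (DD_gI hn) c1), fun M hM => ⟨c2 M hM, ?_, ?_⟩⟩
  · rw [map_add, a2 M hM, low_I_II (by omega) M f c1, add_zero]
  · rw [map_add, low_II_III (by omega) M f0 a1, low_I_III (by omega) M f c1, add_zero]
theorem elIII {s t n : ℕ} (hs : 3 ≤ s) (ht : 5 ≤ t) (hn : n + 2 = 2 ^ (s + t) + 2 ^ s) : ∃ f ∈ homog n,
    ∀ M : Mat, IsUnit M → ph M (sp (gI s t)) f = 0 ∧ ph M (sp (gII s t)) f = 0 ∧ ph M (sp (gIII s t)) f = 1 := by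
  obtain ⟨f0, a1, a2⟩ := RzU (RzIII s t hs ht)
  have b1 := TS_homog (DD_gIII (by omega) (by omega) hn) a1
  have hD := DD_gII (s := s) (t := t) (by omega) hn
  obtain ⟨f1, d1, d2⟩ := corrII ht hD f0 b1
  have e1 := Submodule.add_mem _ b1 (TS_homog hD d1)
  obtain ⟨f, c1, c2⟩ := addI3 hs ht hn (f0 + f1) e1 0
  refine ⟨f0 + f1 + f, Submodule.add_mem _ e1 (TS_homog (DD_gI hn) c1), fun M hM => ⟨c2 M hM, ?_, ?_⟩⟩
  · rw [map_add, map_add, d2 M, low_I_II (by omega) M f c1, add_zero, CharTwo.add_self_eq_zero]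
  · rw [map_add, map_add, a2 M hM, low_II_III (by omega) M f1 d1, low_I_III (by omega) M f c1, add_zero, add_zero]
theorem case34 {s t n : ℕ} (hs : s = 3 ∨ s = 4) (ht : 5 ≤ t) (hn : n + 2 = 2 ^ (s + t) + 2 ^ s) :
    Module.finrank kk ↥(QInv n glSet) = 2 := by
  have hs3 : 3 ≤ s := by omega
  obtain ⟨f, hf, hfv⟩ := elI hs3 ht hn
  obtain ⟨g, hg, hgv⟩ := elIII hs3 ht hn
  refine inv_dim (by omega) ht hn ![gI s t, gIII s t] ?_ ![f, g] ?_ (fun j σ => ph 1 (sp σ) (![f, g] j)) ?_ ?_ ?_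
  · intro i; fin_cases i
    · exact Or.inl rfl
    · exact Or.inr (Or.inr (Or.inl rfl))
  · intro i; fin_cases i
    · exact hf
    · exact hg
  · rintro j σ (rfl | ⟨h, rfl⟩ | rfl | ⟨h, rfl⟩) M hM
    · fin_cases j
      · exact (hfv M hM).1.trans (hfv 1 isUnit_one).1.symm
      · exact (hgv M hM).1.trans (hgv 1 isUnit_one).1.symm
    · fin_cases j
      · exact (hfv M hM).2.1.trans (hfv 1 isUnit_one).2.1.symm
      · exact (hgv M hM).2.1.trans (hgv 1 isUnit_one).2.1.symm
    · fin_cases j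
      · exact (hfv M hM).2.2.trans (hfv 1 isUnit_one).2.2.symm
      · exact (hgv M hM).2.2.trans (hgv 1 isUnit_one).2.2.symm
    · omega
  · have h1 := hfv 1 isUnit_one
    have h2 := hgv 1 isUnit_one
    intro i j
    fin_cases i <;> fin_cases j
    · exact h1.1
    · exact h2.1
    · exact h1.2.2
    · exact h2.2.2
  · rintro g hg h0 σ (rfl | ⟨h, rfl⟩ | rfl | ⟨h, rfl⟩)
    · exact h0 0
    · exact c_II34 hs hn g hg
    · exact h0 1
    · omega
theorem case5 {s t n : ℕ} (hs : 5 ≤ s) (ht : 5 ≤ t) (hn : n + 2 = 2 ^ (s + t) + 2 ^ s) :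
    Module.finrank kk ↥(QInv n glSet) = 3 := by
  have hs3 : 3 ≤ s := by omega
  obtain ⟨f, hf, hfv⟩ := elI hs3 ht hn
  obtain ⟨k, hk, hkv⟩ := elII hs ht hn
  obtain ⟨g, hg, hgv⟩ := elIII hs3 ht hn
  refine inv_dim (by omega) ht hn ![gI s t, gII s t, gIII s t] ?_ ![f, k, g] ?_
    (fun j σ => ph 1 (sp σ) (![f, k, g] j)) ?_ ?_ ?_
  · intro i; fin_cases i
    · exact Or.inl rfl
    · exact Or.inr (Or.inl ⟨by omega, rfl⟩)
    · exact Or.inr (Or.inr (Or.inl rfl))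
  · intro i; fin_cases i
    · exact hf
    · exact hk
    · exact hg
  · rintro j σ (rfl | ⟨h, rfl⟩ | rfl | ⟨h, rfl⟩) M hM
    · fin_cases j
      · exact (hfv M hM).1.trans (hfv 1 isUnit_one).1.symm
      · exact (hkv M hM).1.trans (hkv 1 isUnit_one).1.symm
      · exact (hgv M hM).1.trans (hgv 1 isUnit_one).1.symm
    · fin_cases j
      · exact (hfv M hM).2.1.trans (hfv 1 isUnit_one).2.1.symm
      · exact (hkv M hM).2.1.trans (hkv 1 isUnit_one).2.1.symm
      · exact (hgv M hM).2.1.trans (hgv 1 isUnit_one).2.1.symm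
    · fin_cases j
      · exact (hfv M hM).2.2.trans (hfv 1 isUnit_one).2.2.symm
      · exact (hkv M hM).2.2.trans (hkv 1 isUnit_one).2.2.symm
      · exact (hgv M hM).2.2.trans (hgv 1 isUnit_one).2.2.symm
    · omega
  · have h1 := hfv 1 isUnit_one
    have h2 := hkv 1 isUnit_one
    have h3 := hgv 1 isUnit_one
    intro i j
    fin_cases i <;> fin_cases j
    · exact h1.1
    · exact h2.1
    · exact h3.1
    · exact h1.2.1
    · exact h2.2.1
    · exact h3.2.1
    · exact h1.2.2
    · exact h2.2.2
    · exact h3.2.2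
  · rintro g hg h0 σ (rfl | ⟨h, rfl⟩ | rfl | ⟨h, rfl⟩)
    · exact h0 0
    · exact h0 1
    · exact h0 2
    · omega
/-- In degree `n = 2(2^s-1) + 2^s(2^t-1) = 2^{s+t} + 2^s - 2` (`s ≥ 1`, `t ≥ 5`),
the space of `GL_4(F_2)`-invariants of `Q_n` has dimension `1` if `s ∈ {1,2}`, `2` if
`s ∈ {3,4}`, and `3` if `s ≥ 5`. -/
theorem statement_5 (s t n : ℕ) (hs : 1 ≤ s) (ht : 5 ≤ t)
    (hn : n = 2 * (2 ^ s - 1) + 2 ^ s * (2 ^ t - 1)) :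
    (s = 1 ∨ s = 2 → Module.finrank kk ↥(QInv n glSet) = 1) ∧
    (s = 3 ∨ s = 4 → Module.finrank kk ↥(QInv n glSet) = 2) ∧
    (5 ≤ s → Module.finrank kk ↥(QInv n glSet) = 3) := by
  have hn' : n + 2 = 2 ^ (s + t) + 2 ^ s := by
    have h1 := Nat.one_le_two_pow (n := s)
    have h2 := Nat.one_le_two_pow (n := t)
    rw [hn, pow_add]
    zify [h1, h2]; ring
  refine ⟨?_, fun h => case34 h ht hn', fun h => case5 h ht hn'⟩
  rintro (rfl | rfl)
  · exact case1 ht hn'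
  · exact case2 ht hn'
end
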